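/- Let n ≥ 1. Let Ψ⁻ and Ψ⁺ be nonzero vectors in (ℂ²)^⊗(2n+1) satisfying H_{2n+1}Ψ^± = E₀Ψ^±, where H_{2n+1} is the periodic XXZ Hamiltonian at Δ = −1/2 and E₀ is the smallest eigenvalue of H_{2n+1}, with SᶻΨ^± = ±(1/2)Ψ^±. Let E⁻(k) and E⁺(k) denote the emptiness formation probabilities computed from Ψ⁻ and Ψ⁺ respectively. Then E⁻(n) = E⁺(n+1) = Π_{j=1}^{n} [(2j−1)!²·(2j)!²] / [(j−1)!·j!·(3j−1)!·(3j)!], i.e. both equal the inverse of the number A_HT(2n+1) of Half-Turn Symmetric Alternating Sign Matrices of size 2n+1. -/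

import Mathlib

noncomputable section

/-- Spin configurations of a chain of length `N`; `true` = spin up `↑`. -/
abbrev Cfg (N : ℕ) := Fin N → Bool

/-- Pauli matrix `σ^x` in the basis `(↑,↓)`. -/
def sigmaX : Matrix Bool Bool ℂ := Matrix.of fun b c => if b = c then 0 else 1

/-- Pauli matrix `σ^y` in the basis `(↑,↓)`. -/
def sigmaY : Matrix Bool Bool ℂ :=
  Matrix.of fun b c => if b = c then 0 else if b then -Complex.I else Complex.I

/-- Pauli matrix `σ^z` in the basis `(↑,↓)`. -/
def sigmaZ : Matrix Bool Bool ℂ :=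
  Matrix.of fun b c => if b = c then (if b then 1 else -1) else 0

/-- `σ⁺ = σ^x + i σ^y`. -/
def sigmaP : Matrix Bool Bool ℂ := sigmaX + Complex.I • sigmaY

/-- `σ⁻ = σ^x − i σ^y`. -/
def sigmaM : Matrix Bool Bool ℂ := sigmaX - Complex.I • sigmaY

/-- A one-site operator `A` acting on the `i`-th tensor factor of `(ℂ²)^{⊗N}`. -/
def localOp (N : ℕ) (i : Fin N) (A : Matrix Bool Bool ℂ) : Matrix (Cfg N) (Cfg N) ℂ :=
  Matrix.of fun f g =>
    A (f i) (g i) * ∏ j ∈ Finset.univ.erase i, (if f j = g j then (1 : ℂ) else 0)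

/-- The cyclic successor `i+1` of a site index (mod `N`). -/
def cyc (N : ℕ) (i : Fin N) : Fin N :=
  ⟨(i.val + 1) % N, Nat.mod_lt _ (by have := i.isLt; omega)⟩

/-- Periodic XXZ Hamiltonian at `Δ = −1/2`:
`H_N = −(1/2)·Σ_{i=1}^{N} (σ^x_i σ^x_{i+1} + σ^y_i σ^y_{i+1} − (1/2) σ^z_i σ^z_{i+1})`,
site indices mod `N`. -/
def Hper (N : ℕ) : Matrix (Cfg N) (Cfg N) ℂ :=
  (-(1/2) : ℂ) • ∑ i : Fin N,
    (localOp N i sigmaX * localOp N (cyc N i) sigmaX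
      + localOp N i sigmaY * localOp N (cyc N i) sigmaY
      - (1/2 : ℂ) • (localOp N i sigmaZ * localOp N (cyc N i) sigmaZ))

/-- Total spin `Sᶻ = (1/2)·Σ_i σ^z_i`. -/
def Sz (N : ℕ) : Matrix (Cfg N) (Cfg N) ℂ := (1/2 : ℂ) • ∑ i : Fin N, localOp N i sigmaZ

/-- Projector onto spin up at site `i`: `p_i⁺ = (1 + σ^z_i)/2`. -/
def pUp (N : ℕ) (i : Fin N) : Matrix (Cfg N) (Cfg N) ℂ := (1/2 : ℂ) • (1 + localOp N i sigmaZ)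

/-- The product `Π_{i=1}^{k} p_i⁺` of projectors onto spin up at the first `k` sites. -/
def projProd (N k : ℕ) : Matrix (Cfg N) (Cfg N) ℂ :=
  (((List.finRange N).filter fun i : Fin N => decide (i.val < k)).map (pUp N)).prod

/-- Standard Hermitian inner product on `(ℂ²)^{⊗N}`. -/
def hermInner {N : ℕ} (v w : Cfg N → ℂ) : ℂ := ∑ f, (starRingEnd ℂ) (v f) * w f

/-- Emptiness formation probability `E(k) = ⟨Ψ, Π_{i=1}^k p_i⁺ Ψ⟩ / ⟨Ψ, Ψ⟩`. -/
def EFP {N : ℕ} (Ψ : Cfg N → ℂ) (k : ℕ) : ℂ :=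
  hermInner Ψ ((projProd N k).mulVec Ψ) / hermInner Ψ Ψ

/-- A primitive cube root of unity. -/
def ω : ℂ := (-1 + Complex.I * (Real.sqrt 3 : ℝ)) / 2

theorem ω_rel : ω ^ 2 + ω + 1 = 0 := by
  have h : ((Real.sqrt 3 : ℝ) : ℂ) ^ 2 = 3 := by
    rw [← Complex.ofReal_pow, Real.sq_sqrt (by norm_num)]; norm_num
  unfold ω
  linear_combination (1 / 4 : ℂ) * Complex.I ^ 2 * h + (3 / 4 : ℂ) * Complex.I_sq

theorem ω_cube : ω ^ 3 = 1 := by linear_combination (ω - 1) * ω_rel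

theorem ω_ne_zero : ω ≠ 0 := by
  intro h
  have := ω_cube
  rw [h] at this
  norm_num at this

theorem one_sub_ω_ne_zero : 1 - ω ≠ 0 := by
  intro h
  have h1 : ω = 1 := by linear_combination -h
  have := ω_rel
  rw [h1] at this
  norm_num at this

/-- The exchange weight `b`. -/
def bt (w z : ℂ) : ℂ := ω ^ 2 * (w - z) / (w - ω * z)
/-- The exchange weight `c`. -/
def gm (w z : ℂ) : ℂ := (1 - ω) * w / (w - ω * z)
/-- The inverse of `bt`. -/
def al (w z : ℂ) : ℂ := ω * (w - ω * z) / (w - z)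

theorem bt_self (w : ℂ) : bt w w = 0 := by simp [bt]

theorem gm_self {w : ℂ} (h : w ≠ 0) : gm w w = 1 := by
  have := one_sub_ω_ne_zero
  have h2 : w - ω * w = (1 - ω) * w := by ring
  rw [gm, h2, div_self (mul_ne_zero this h)]

theorem bt_mul_al {w z : ℂ} (h : w ≠ ω * z) (h' : w ≠ z) : bt w z * al w z = 1 := by
  have h1 := sub_ne_zero.2 h
  have h2 := sub_ne_zero.2 h'
  unfold bt al
  field_simp
  exact ω_cube

theorem gm_exchange {l x y : ℂ} (h1 : l - ω * x ≠ 0) (h2 : l - ω * y ≠ 0) :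
    (x - ω * y) * gm l y = (1 - ω) * x * gm l x + ω ^ 2 * (x - y) * (bt l x * gm l y) := by
  have := ω_rel
  unfold gm bt
  generalize hd : l - ω * x = d at *
  generalize he : l - ω * y = e at *
  field_simp
  subst hd he
  grind

theorem bt_gm_exchange {l x y : ℂ} (h1 : l - ω * x ≠ 0) (h2 : l - ω * y ≠ 0) :
    (x - ω * y) * (bt l y * gm l x) =
      ω ^ 2 * (x - y) * gm l x + (1 - ω) * y * (bt l x * gm l y) := by
  have := ω_rel
  unfold gm bt
  generalize hd : l - ω * x = d at *
  generalize he : l - ω * y = e at *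
  field_simp
  subst hd he
  grind

theorem gm_gm_exchange {l m x y : ℂ} (h1 : l - ω * x ≠ 0) (h2 : l - ω * y ≠ 0)
    (h3 : m - ω * x ≠ 0) (h4 : m - ω * y ≠ 0) (h5 : l - m ≠ 0) :
    gm l y * bt m y * al m l * gm m x + gm m y * bt l y * al l m * gm l x =
      gm l x * bt m x * al m l * gm m y + gm m x * bt l x * al l m * gm l y := by
  have := ω_rel
  have h6 : m - l = -(l - m) := by ring
  unfold gm bt al
  rw [h6]
  generalize hd : l - ω * x = d at *
  generalize he : l - ω * y = e at *
  generalize hf : m - ω * x = f at *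
  generalize hg : m - ω * y = g at *
  generalize hk : l - m = k at *
  field_simp
  subst hd he hf hg hk
  ring

/-- The action of one site on functions of the set of rapidities. -/
def step (p : Bool × ℂ) (f : Finset ℂ → ℂ) (W : Finset ℂ) : ℂ :=
  if p.1 then ∑ l ∈ W, gm l p.2 * (∏ j ∈ W.erase l, bt j p.2 * al j l) * f (W.erase l)
  else (∏ w ∈ W, bt w p.2) * f W

/-- Off-shell Bethe vectors. -/
def bethe (L : List (Bool × ℂ)) : Finset ℂ → ℂ :=
  L.foldr step (fun W => if W = ∅ then 1 else 0)

theorem bethe_nil (W : Finset ℂ) : bethe [] W = if W = ∅ then 1 else 0 := rfl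

theorem bethe_dn (z : ℂ) (L : List (Bool × ℂ)) (W : Finset ℂ) :
    bethe ((false, z) :: L) W = (∏ w ∈ W, bt w z) * bethe L W := by
  simp [bethe, step]

theorem bethe_up (z : ℂ) (L : List (Bool × ℂ)) (W : Finset ℂ) :
    bethe ((true, z) :: L) W = ∑ l ∈ W,
      gm l z * (∏ j ∈ W.erase l, bt j z * al j l) * bethe L (W.erase l) := by
  simp [bethe, step]

/-- A linear relation between Bethe vectors persists when sites are prepended. -/
theorem bethe_append_linear (A L₁ L₂ L₃ : List (Bool × ℂ)) (a b c : ℂ) (W₀ : Finset ℂ)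
    (h : ∀ W ⊆ W₀, a * bethe L₁ W = b * bethe L₂ W + c * bethe L₃ W) :
    ∀ W ⊆ W₀, a * bethe (A ++ L₁) W = b * bethe (A ++ L₂) W + c * bethe (A ++ L₃) W := by
  induction A with
  | nil => simpa using h
  | cons p A ih =>
    intro W hW
    obtain ⟨s, z⟩ := p
    cases s with
    | false =>
      simp only [List.cons_append, bethe_dn]
      linear_combination (∏ w ∈ W, bt w z) * ih W hW
    | true =>
      simp only [List.cons_append, bethe_up, Finset.mul_sum, ← Finset.sum_add_distrib]
      refine Finset.sum_congr rfl fun l _ => ?_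
      linear_combination (gm l z * ∏ j ∈ W.erase l, bt j z * al j l) *
        ih (W.erase l) ((Finset.erase_subset _ _).trans hW)

theorem bethe_exchange_up_dn (A B : List (Bool × ℂ)) (x y : ℂ) (W : Finset ℂ)
    (h : ∀ w ∈ W, w ≠ ω * x ∧ w ≠ ω * y) :
    (x - ω * y) * bethe (A ++ (true, y) :: (false, x) :: B) W =
      (1 - ω) * x * bethe (A ++ (true, x) :: (false, y) :: B) W +
      ω ^ 2 * (x - y) * bethe (A ++ (false, x) :: (true, y) :: B) W := by
  refine bethe_append_linear A _ _ _ _ _ _ W (fun V hV => ?_) W subset_rfl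
  simp only [bethe_up, bethe_dn, Finset.mul_sum, ← Finset.sum_add_distrib]
  refine Finset.sum_congr rfl fun l hl => ?_
  have h1 := sub_ne_zero.2 (h l (hV hl)).1
  have h2 := sub_ne_zero.2 (h l (hV hl)).2
  have key := gm_exchange h1 h2
  rw [← Finset.mul_prod_erase V _ hl]
  simp only [Finset.prod_mul_distrib]
  linear_combination (∏ j ∈ V.erase l, bt j y) * (∏ j ∈ V.erase l, bt j x) *
    (∏ j ∈ V.erase l, al j l) * bethe B (V.erase l) * key

theorem bethe_exchange_dn_up (A B : List (Bool × ℂ)) (x y : ℂ) (W : Finset ℂ)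
    (h : ∀ w ∈ W, w ≠ ω * x ∧ w ≠ ω * y) :
    (x - ω * y) * bethe (A ++ (false, y) :: (true, x) :: B) W =
      ω ^ 2 * (x - y) * bethe (A ++ (true, x) :: (false, y) :: B) W +
      (1 - ω) * y * bethe (A ++ (false, x) :: (true, y) :: B) W := by
  refine bethe_append_linear A _ _ _ _ _ _ W (fun V hV => ?_) W subset_rfl
  simp only [bethe_up, bethe_dn, Finset.mul_sum, ← Finset.sum_add_distrib]
  refine Finset.sum_congr rfl fun l hl => ?_
  have h1 := sub_ne_zero.2 (h l (hV hl)).1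
  have h2 := sub_ne_zero.2 (h l (hV hl)).2
  have key := bt_gm_exchange h1 h2
  rw [← Finset.mul_prod_erase V _ hl, ← Finset.mul_prod_erase V _ hl]
  simp only [Finset.prod_mul_distrib]
  linear_combination (∏ j ∈ V.erase l, bt j y) * (∏ j ∈ V.erase l, bt j x) *
    (∏ j ∈ V.erase l, al j l) * bethe B (V.erase l) * key

theorem sum_sum_erase_comm (W : Finset ℂ) (f : ℂ → ℂ → ℂ) :
    ∑ l ∈ W, ∑ m ∈ W.erase l, f l m = ∑ l ∈ W, ∑ m ∈ W.erase l, f m l := by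
  refine Finset.sum_comm' fun x y => ?_
  simp only [Finset.mem_erase]
  tauto

theorem sum_sum_erase_congr (W : Finset ℂ) (f g : ℂ → ℂ → ℂ)
    (h : ∀ l ∈ W, ∀ m ∈ W, l ≠ m → f l m + f m l = g l m + g m l) :
    ∑ l ∈ W, ∑ m ∈ W.erase l, f l m = ∑ l ∈ W, ∑ m ∈ W.erase l, g l m := by
  have h1 := sum_sum_erase_comm W f
  have h2 := sum_sum_erase_comm W g
  have h3 : ∑ l ∈ W, ∑ m ∈ W.erase l, f l m + ∑ l ∈ W, ∑ m ∈ W.erase l, f m l =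
      ∑ l ∈ W, ∑ m ∈ W.erase l, g l m + ∑ l ∈ W, ∑ m ∈ W.erase l, g m l := by
    simp only [← Finset.sum_add_distrib]
    refine Finset.sum_congr rfl fun l hl => Finset.sum_congr rfl fun m hm => ?_
    exact h l hl m (Finset.mem_of_mem_erase hm) (Finset.ne_of_mem_erase hm).symm
  rw [← h1, ← h2] at h3
  linear_combination h3 / 2

theorem bethe_up_up (x y : ℂ) (B : List (Bool × ℂ)) (W : Finset ℂ) :
    bethe ((true, y) :: (true, x) :: B) W = ∑ l ∈ W, ∑ m ∈ W.erase l,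
      gm l y * bt m y * al m l * gm m x *
      ((∏ j ∈ (W.erase l).erase m, bt j y * bt j x * (al j l * al j m)) *
        bethe B ((W.erase l).erase m)) := by
  rw [bethe_up]
  refine Finset.sum_congr rfl fun l hl => ?_
  rw [bethe_up, Finset.mul_sum]
  refine Finset.sum_congr rfl fun m hm => ?_
  rw [← Finset.mul_prod_erase (W.erase l) _ hm]
  simp only [Finset.prod_mul_distrib]
  ring

theorem bethe_exchange_up_up (A B : List (Bool × ℂ)) (x y : ℂ) (W : Finset ℂ)
    (h : ∀ w ∈ W, w ≠ ω * x ∧ w ≠ ω * y) :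
    bethe (A ++ (true, y) :: (true, x) :: B) W = bethe (A ++ (true, x) :: (true, y) :: B) W := by
  have := bethe_append_linear A ((true, y) :: (true, x) :: B) ((true, x) :: (true, y) :: B) []
    1 1 0 W (fun V hV => ?_) W subset_rfl
  · simpa using this
  rw [bethe_up_up, bethe_up_up, zero_mul, add_zero, one_mul, one_mul]
  apply sum_sum_erase_congr
  intro l hl m hm hlm
  rw [Finset.erase_right_comm (a := m) (b := l)]
  have h1 := sub_ne_zero.2 (h l (hV hl)).1
  have h2 := sub_ne_zero.2 (h l (hV hl)).2
  have h3 := sub_ne_zero.2 (h m (hV hm)).1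
  have h4 := sub_ne_zero.2 (h m (hV hm)).2
  have h5 := sub_ne_zero.2 hlm
  have key := gm_gm_exchange h1 h2 h3 h4 h5
  simp only [Finset.prod_mul_distrib]
  linear_combination (∏ j ∈ (V.erase l).erase m, bt j y) * (∏ j ∈ (V.erase l).erase m, bt j x) *
    (∏ j ∈ (V.erase l).erase m, al j l) * (∏ j ∈ (V.erase l).erase m, al j m) *
     bethe B ((V.erase l).erase m) * key

theorem bethe_exchange_dn_dn (A B : List (Bool × ℂ)) (x y : ℂ) (W : Finset ℂ) :
    bethe (A ++ (false, y) :: (false, x) :: B) W =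
      bethe (A ++ (false, x) :: (false, y) :: B) W := by
  have := bethe_append_linear A ((false, y) :: (false, x) :: B) ((false, x) :: (false, y) :: B) []
    1 1 0 W (fun V hV => ?_) W subset_rfl
  · simpa using this
  simp only [bethe_dn]
  ring

theorem bethe_append_dn (L : List (Bool × ℂ)) (x : ℂ) (W : Finset ℂ) :
    bethe (L ++ [(false, x)]) W = bethe L W := by
  have := bethe_append_linear L [(false, x)] [] [] 1 1 0 W (fun V hV => ?_) W subset_rfl
  · simpa using this
  simp only [bethe_dn, bethe_nil]
  split_ifs with h <;> simp [h]

theorem bethe_append_up (L : List (Bool × ℂ)) (x : ℂ) (W : Finset ℂ) :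
    bethe (L ++ [(true, x)]) W = ∑ m ∈ W, gm m x * (L.map fun p => bt m p.2).prod *
      (∏ j ∈ W.erase m, al m j) * bethe L (W.erase m) := by
  induction L generalizing W with
  | nil =>
    simp only [List.nil_append, bethe_up, bethe_nil]
    refine Finset.sum_congr rfl fun m hm => ?_
    split_ifs with h <;> simp [h]
  | cons p L ih =>
    obtain ⟨s, z⟩ := p
    cases s with
    | false =>
      simp only [List.cons_append, bethe_dn, ih, Finset.mul_sum]
      refine Finset.sum_congr rfl fun m hm => ?_
      rw [← Finset.mul_prod_erase W _ hm]
      simp only [List.map_cons, List.prod_cons]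
      ring
    | true =>
      simp only [List.cons_append, bethe_up, ih, Finset.mul_sum]
      rw [sum_sum_erase_comm]
      refine Finset.sum_congr rfl fun m hm => Finset.sum_congr rfl fun l hl => ?_
      have hlm := Finset.ne_of_mem_erase hl
      have hm' : m ∈ W.erase l := Finset.mem_erase.2 ⟨hlm.symm, hm⟩
      rw [← Finset.mul_prod_erase (W.erase l) _ hm', ← Finset.mul_prod_erase (W.erase m) _ hl,
        Finset.erase_right_comm (a := m) (b := l)]
      simp only [List.map_cons, List.prod_cons]
      ring

theorem sum_partial_fractions (P : Polynomial ℂ) (s : Finset ℂ) (hP : P.degree < s.card) (x : ℂ)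
    (hx : x ∉ s) :
    ∑ k ∈ s, P.eval k * (∏ j ∈ s.erase k, (k - j)⁻¹) * (x - k)⁻¹ =
      P.eval x * ∏ k ∈ s, (x - k)⁻¹ := by
  have hx' : ∀ i ∈ s, x ≠ id i := fun i hi h => hx (h ▸ hi)
  have h1 := Lagrange.eq_interpolate (s := s) (v := id) (f := P) (Set.injOn_id _) hP
  have h2 := Lagrange.eval_interpolate_not_at_node (s := s) (v := id) (fun i => P.eval (id i)) hx'
  rw [← h1, Lagrange.eval_nodal] at h2
  rw [h2, mul_comm (∏ i ∈ s, (x - id i)), mul_assoc, ← Finset.prod_mul_distrib,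
    Finset.prod_eq_one (f := fun i => (x - id i) * (x - i)⁻¹)
      (fun i hi => mul_inv_cancel₀ (sub_ne_zero.2 (hx' i hi))), mul_one]
  refine Finset.sum_congr rfl fun k _ => ?_
  simp only [Lagrange.nodalWeight, id]
  ring

theorem bethe_eq_zero_of_card (L : List (Bool × ℂ)) (W : Finset ℂ)
    (h : W.card ≠ L.countP (·.1)) : bethe L W = 0 := by
  induction L generalizing W with
  | nil =>
    rw [bethe_nil, if_neg]
    rintro rfl
    simp at h
  | cons p L ih =>
    obtain ⟨s, z⟩ := p
    cases s with
    | false =>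
      rw [bethe_dn, ih W (by simpa using h), mul_zero]
    | true =>
      rw [bethe_up]
      refine Finset.sum_eq_zero fun l hl => ?_
      rw [ih, mul_zero]
      have := Finset.card_erase_add_one hl
      simp at h
      omega

/-- Sites with spin `s` and the given parameters. -/
def spins {α : Type*} (s : Bool) (l : List α) : List (Bool × α) := l.map fun z => (s, z)

theorem spins_cons {α : Type*} (s : Bool) (z : α) (l : List α) : spins s (z :: l) = (s, z) :: spins s l := rfl

theorem spins_append {α : Type*} (s : Bool) (l l' : List α) : spins s (l ++ l') = spins s l ++ spins s l' :=
  List.map_append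

theorem map_snd_spins {α : Type*} (s : Bool) (l : List α) : (spins s l).map Prod.snd = l := by
  simp [spins, Function.comp_def]

theorem countP_spins_true {α : Type*} (l : List α) : (spins true l).countP (·.1) = l.length := by
  simp [spins, List.countP_map, Function.comp_def]

theorem countP_spins_false {α : Type*} (l : List α) : (spins false l).countP (·.1) = 0 := by
  simp [spins, List.countP_map, Function.comp_def]

theorem bethe_spins_dn_append (D : List ℂ) (hD : D.Nodup) (L : List (Bool × ℂ)) (W : Finset ℂ) :
    bethe (spins false D ++ L) W = (∏ d ∈ D.toFinset, ∏ w ∈ W, bt w d) * bethe L W := by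
  rw [List.prod_toFinset _ hD]
  induction D with
  | nil => simp [spins]
  | cons d D ih =>
    rw [spins_cons, List.cons_append, bethe_dn, ih hD.of_cons, List.map_cons, List.prod_cons]
    ring

/-- Genericity of the inhomogeneities. -/
def Good (l : List ℂ) : Prop := l.Nodup ∧ ∀ x ∈ l, ∀ y ∈ l, x ≠ ω * y

theorem Good.perm {l l' : List ℂ} (h : Good l) (p : l.Perm l') : Good l' :=
  ⟨p.nodup_iff.1 h.1, fun x hx y hy => h.2 x (p.mem_iff.2 hx) y (p.mem_iff.2 hy)⟩

theorem Good.sublist {l l' : List ℂ} (h : Good l) (p : l'.Sublist l) : Good l' :=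
  ⟨h.1.sublist p, fun x hx y hy => h.2 x (p.subset hx) y (p.subset hy)⟩

theorem Good.of_cons {x : ℂ} {l : List ℂ} (h : Good (x :: l)) : Good l :=
  h.sublist (List.sublist_cons_self _ _)

theorem Good.ne_zero {l : List ℂ} (h : Good l) {x : ℂ} (hx : x ∈ l) : x ≠ 0 := by
  rintro rfl
  exact h.2 0 hx 0 hx (by simp)

theorem bethe_spins_up_self (U : List ℂ) (hU : Good U) :
    bethe (spins true U) U.toFinset = 1 := by
  induction U with
  | nil => simp [spins, bethe_nil]
  | cons u U ih =>
    have hu : u ∉ U.toFinset := by simpa using (List.nodup_cons.1 hU.1).1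
    rw [spins_cons, bethe_up, List.toFinset_cons, Finset.sum_eq_single u]
    · rw [Finset.erase_insert hu, ih hU.of_cons, gm_self (hU.ne_zero (by simp)),
        Finset.prod_eq_one]
      · simp
      · intro j hj
        refine bt_mul_al (hU.2 j ?_ u (by simp)) (ne_of_mem_of_not_mem hj hu)
        exact List.mem_cons_of_mem _ (List.mem_toFinset.1 hj)
    · intro l _ hlu
      rw [Finset.prod_eq_zero (i := u), mul_zero, zero_mul]
      · exact Finset.mem_erase.2 ⟨hlu.symm, Finset.mem_insert_self _ _⟩
      · rw [bt_self, zero_mul]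
    · intro h
      exact absurd (Finset.mem_insert_self _ _) h

theorem bethe_extreme (D U : List ℂ) (h : Good (D ++ U)) (W : Finset ℂ)
    (hW : W ⊆ (D ++ U).toFinset) :
    bethe (spins false D ++ spins true U) W =
      if W = U.toFinset then ∏ d ∈ D.toFinset, ∏ u ∈ U.toFinset, bt u d else 0 := by
  have hD : Good D := h.sublist (List.sublist_append_left _ _)
  have hU : Good U := h.sublist (List.sublist_append_right _ _)
  rw [bethe_spins_dn_append D hD.1]
  split_ifs with hWU
  · rw [hWU, bethe_spins_up_self U hU, mul_one]
  · by_cases hd : ∃ w ∈ W, w ∈ D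
    · obtain ⟨w, hw, hwD⟩ := hd
      rw [Finset.prod_eq_zero (List.mem_toFinset.2 hwD), zero_mul]
      exact Finset.prod_eq_zero hw (bt_self w)
    · push Not at hd
      rw [bethe_eq_zero_of_card, mul_zero]
      rw [countP_spins_true, ← List.toFinset_card_of_nodup hU.1]
      intro hc
      refine hWU (Finset.eq_of_subset_of_card_le (fun w hw => ?_) hc.ge)
      have := List.mem_toFinset.1 (hW hw)
      rw [List.mem_append] at this
      exact List.mem_toFinset.2 (this.resolve_left (hd w hw))

/-- The coefficient of a Bethe vector. -/
def cf (Z W : Finset ℂ) : ℂ := ∏ x ∈ Z \ W, ∏ w ∈ W, (x - w)⁻¹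

/-- The set of parameters of a list of sites. -/
def supp (L : List (Bool × ℂ)) : Finset ℂ := (L.map Prod.snd).toFinset

theorem supp_perm {L L' : List (Bool × ℂ)} (h : (L.map Prod.snd).Perm (L'.map Prod.snd)) :
    supp L = supp L' := List.toFinset_eq_of_perm _ _ h

/-- The inhomogeneous ground state component, without its prefactor. -/
def psiRat (L : List (Bool × ℂ)) : ℂ := ∑ W ∈ (supp L).powerset, cf (supp L) W * bethe L W

theorem supp_append_swap (A B : List (Bool × ℂ)) (s t s' t' : Bool) (x y : ℂ) :
    supp (A ++ (s, x) :: (t, y) :: B) = supp (A ++ (s', y) :: (t', x) :: B) := by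
  apply supp_perm
  simp only [List.map_append, List.map_cons]
  exact List.Perm.append_left _ (List.Perm.swap _ _ _)

theorem supp_append_congr (A B : List (Bool × ℂ)) (s t s' t' : Bool) (x y : ℂ) :
    supp (A ++ (s, x) :: (t, y) :: B) = supp (A ++ (s', x) :: (t', y) :: B) := by
  simp [supp]

theorem ne_of_good_supp {A B : List (Bool × ℂ)} {s t : Bool} {x y : ℂ}
    (h : Good ((A ++ (s, x) :: (t, y) :: B).map Prod.snd)) {W : Finset ℂ}
    (hW : W ⊆ supp (A ++ (s, x) :: (t, y) :: B)) :
    ∀ w ∈ W, w ≠ ω * x ∧ w ≠ ω * y := by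
  intro w hw
  have hw' := List.mem_toFinset.1 (hW hw)
  exact ⟨h.2 w hw' x (by simp), h.2 w hw' y (by simp)⟩

theorem psiRat_up_dn (A B : List (Bool × ℂ)) (x y : ℂ)
    (h : Good ((A ++ (true, x) :: (true, y) :: B).map Prod.snd)) :
    (x - ω * y) * psiRat (A ++ (true, y) :: (false, x) :: B) =
      (1 - ω) * x * psiRat (A ++ (true, x) :: (false, y) :: B) +
      ω ^ 2 * (x - y) * psiRat (A ++ (false, x) :: (true, y) :: B) := by
  unfold psiRat
  rw [supp_append_swap A B true false true true y x,
    supp_append_congr A B true false true true x y,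
    supp_append_congr A B false true true true x y]
  simp only [Finset.mul_sum, ← Finset.sum_add_distrib]
  refine Finset.sum_congr rfl fun W hW => ?_
  linear_combination cf (supp (A ++ (true, x) :: (true, y) :: B)) W *
    bethe_exchange_up_dn A B x y W (ne_of_good_supp h (Finset.mem_powerset.1 hW))

theorem psiRat_dn_up (A B : List (Bool × ℂ)) (x y : ℂ)
    (h : Good ((A ++ (true, x) :: (true, y) :: B).map Prod.snd)) :
    (x - ω * y) * psiRat (A ++ (false, y) :: (true, x) :: B) =
      ω ^ 2 * (x - y) * psiRat (A ++ (true, x) :: (false, y) :: B) +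
      (1 - ω) * y * psiRat (A ++ (false, x) :: (true, y) :: B) := by
  unfold psiRat
  rw [supp_append_swap A B false true true true y x,
    supp_append_congr A B true false true true x y,
    supp_append_congr A B false true true true x y]
  simp only [Finset.mul_sum, ← Finset.sum_add_distrib]
  refine Finset.sum_congr rfl fun W hW => ?_
  linear_combination cf (supp (A ++ (true, x) :: (true, y) :: B)) W *
    bethe_exchange_dn_up A B x y W (ne_of_good_supp h (Finset.mem_powerset.1 hW))

theorem psiRat_same (A B : List (Bool × ℂ)) (s : Bool) (x y : ℂ)
    (h : Good ((A ++ (true, x) :: (true, y) :: B).map Prod.snd)) :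
    psiRat (A ++ (s, y) :: (s, x) :: B) = psiRat (A ++ (s, x) :: (s, y) :: B) := by
  unfold psiRat
  rw [supp_append_swap A B s s s s y x]
  refine Finset.sum_congr rfl fun W hW => ?_
  congr 1
  cases s with
  | false => exact bethe_exchange_dn_dn A B x y W
  | true => exact bethe_exchange_up_up A B x y W (ne_of_good_supp h (Finset.mem_powerset.1 hW))

theorem psiRat_extreme (D U : List ℂ) (h : Good (D ++ U)) :
    psiRat (spins false D ++ spins true U) = cf (D ++ U).toFinset U.toFinset *
      ∏ d ∈ D.toFinset, ∏ u ∈ U.toFinset, bt u d := by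
  have hs : supp (spins false D ++ spins true U) = (D ++ U).toFinset := by
    simp [supp, map_snd_spins]
  unfold psiRat
  rw [hs, Finset.sum_eq_single U.toFinset]
  · rw [bethe_extreme D U h _ (by simp), if_pos rfl]
  · intro W hW hWU
    rw [bethe_extreme D U h _ (Finset.mem_powerset.1 hW), if_neg hWU, mul_zero]
  · intro hmem
    exact absurd (Finset.mem_powerset.2 (by simp)) hmem

/-- The binary value of a spin word; exchanging `↑↓` into `↓↑` decreases it. -/
def wordValue {α : Type*} : List (Bool × α) → ℕ
  | [] => 0
  | p :: L => (if p.1 then 2 ^ L.length else 0) + wordValue L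

theorem wordValue_append_lt {α : Type*} (A : List (Bool × α)) {L L' : List (Bool × α)}
    (hl : L.length = L'.length) (h : wordValue L < wordValue L') :
    wordValue (A ++ L) < wordValue (A ++ L') := by
  induction A with
  | nil => exact h
  | cons p A ih => simp only [List.cons_append, wordValue, List.length_append, hl]; omega

theorem wordValue_swap_lt {α : Type*} (A B : List (Bool × α)) (x y x' y' : α) :
    wordValue (A ++ (false, x) :: (true, y) :: B) <
      wordValue (A ++ (true, x') :: (false, y') :: B) := by
  apply wordValue_append_lt _ (by simp)
  have : 0 < 2 ^ B.length := by positivity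
  simp only [wordValue, List.length_cons, pow_succ]
  simp

theorem spins_sorted_or {α : Type*} (L : List (Bool × α)) :
    (∃ D U, L = spins false D ++ spins true U) ∨
      ∃ A B x y, L = A ++ (true, x) :: (false, y) :: B := by
  induction L with
  | nil => exact Or.inl ⟨[], [], rfl⟩
  | cons p L ih =>
    obtain ⟨s, z⟩ := p
    rcases ih with ⟨D, U, rfl⟩ | ⟨A, B, x, y, rfl⟩
    · cases s with
      | false => exact Or.inl ⟨z :: D, U, rfl⟩
      | true =>
        cases D with
        | nil => exact Or.inl ⟨[], z :: U, rfl⟩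
        | cons d D => exact Or.inr ⟨[], spins false D ++ spins true U, z, d, rfl⟩
    · exact Or.inr ⟨(s, z) :: A, B, x, y, rfl⟩

/-- Induction along the exchange relations, starting from the words `↓⋯↓↑⋯↑`. -/
theorem exchange_induction {α : Type*} {Q : List (Bool × α) → Prop}
    (base : ∀ D U, Q (spins false D ++ spins true U))
    (step : ∀ A B x y, Q (A ++ (false, x) :: (true, y) :: B) →
      Q (A ++ (false, y) :: (true, x) :: B) → Q (A ++ (true, x) :: (false, y) :: B))
    (L : List (Bool × α)) : Q L := by
  induction hv : wordValue L using Nat.strong_induction_on generalizing L with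
  | _ v ih =>
    subst hv
    rcases spins_sorted_or L with ⟨D, U, rfl⟩ | ⟨A, B, x, y, rfl⟩
    · exact base D U
    · exact step A B x y (ih _ (wordValue_swap_lt _ _ _ _ _ _) _ rfl)
        (ih _ (wordValue_swap_lt _ _ _ _ _ _) _ rfl)

theorem cf_insert {V u : Finset ℂ} (hVu : Disjoint V u) {k : ℂ} (hk : k ∈ V) :
    cf (V ∪ u) (insert k u) = (∏ y ∈ V, ∏ w ∈ u, (y - w)⁻¹) * (∏ w ∈ u, (k - w)) *
      ∏ y ∈ V.erase k, (y - k)⁻¹ := by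
  have hku : k ∉ u := Finset.disjoint_left.1 hVu hk
  have h1 : (V ∪ u) \ insert k u = V.erase k := by
    ext y
    have := @Finset.disjoint_left _ V u
    simp only [Finset.mem_sdiff, Finset.mem_union, Finset.mem_insert, Finset.mem_erase]
    grind
  rw [cf, h1, ← Finset.mul_prod_erase V _ hk]
  have h2 : (∏ w ∈ u, (k - w)⁻¹) * ∏ w ∈ u, (k - w) = 1 := by
    rw [← Finset.prod_mul_distrib]
    refine Finset.prod_eq_one fun w hw => inv_mul_cancel₀ (sub_ne_zero.2 ?_)
    exact (ne_of_mem_of_not_mem hw hku).symm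
  simp only [Finset.prod_insert hku, Finset.prod_mul_distrib]
  linear_combination (-(∏ y ∈ V.erase k, (y - k)⁻¹) *
    ∏ y ∈ V.erase k, ∏ w ∈ u, (y - w)⁻¹) * h2

theorem cyc_id_up (d u : Finset ℂ) (x : ℂ) (hxd : x ∉ d) (hxu : x ∉ u) (hdu : Disjoint d u)
    (hc : d.card = u.card + 2) (hx0 : x ≠ 0)
    (hg : ∀ y ∈ d ∪ u, x ≠ ω * y ∧ y ≠ ω * x) :
    cf (insert x d ∪ u) (insert x u) * (∏ y ∈ d, ∏ w ∈ insert x u, bt w y) *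
        ∏ y ∈ d ∪ u, (x - ω * y) =
      (∑ k ∈ insert x d, cf (insert x d ∪ u) (insert k u) *
        (gm k x * ∏ j ∈ u, bt j x * al j k)) * (∏ y ∈ d, ∏ w ∈ u, bt w y) *
        ∏ y ∈ d ∪ u, (y - ω * x) := by
  have hω := ω_rel
  have hω0 := ω_ne_zero
  have hω1 := one_sub_ω_ne_zero
  have hVu : Disjoint (insert x d) u := by
    rw [Finset.disjoint_insert_left]; exact ⟨hxu, hdu⟩
  set K := ∏ y ∈ insert x d, ∏ w ∈ u, (y - w)⁻¹ with hK
  set P : Polynomial ℂ := Polynomial.X * ∏ w ∈ u, (Polynomial.C w - Polynomial.C ω * Polynomial.X)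
    with hP
  have hPe : ∀ k, P.eval k = k * ∏ w ∈ u, (w - ω * k) := by
    intro k
    simp [hP, Polynomial.eval_prod]
  have hPd : P.degree < (insert x d).card := by
    rw [Finset.card_insert_of_notMem hxd, hc]
    refine lt_of_le_of_lt (b := ((1 + u.card : ℕ) : WithBot ℕ)) ?_ (by norm_cast; omega)
    rw [hP, Nat.cast_add]
    refine (Polynomial.degree_mul_le _ _).trans (add_le_add (by simp) ?_)
    refine (Polynomial.degree_prod_le _ _).trans ?_
    have : ∀ w ∈ u, (Polynomial.C w - Polynomial.C ω * Polynomial.X).degree ≤ 1 :=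
      fun w _ => by compute_degree
    refine (Finset.sum_le_sum this).trans ?_
    simp
  have hωxV : ω * x ∉ insert x d := by
    rw [Finset.mem_insert, not_or]
    refine ⟨fun h => hω1 ?_, fun h => (hg _ (Finset.mem_union_left _ h)).2 rfl⟩
    have : (1 - ω) * x = 0 := by linear_combination -h
    exact (mul_eq_zero.1 this).resolve_right hx0
  have hpf := sum_partial_fractions P (insert x d) hPd (ω * x) hωxV
  have hterm : ∀ k ∈ insert x d, cf (insert x d ∪ u) (insert k u) *
        (gm k x * ∏ j ∈ u, bt j x * al j k) =
      (K * (-1) ^ d.card * (ω - 1) * ∏ w ∈ u, ((x - w) * (w - ω * x)⁻¹)) *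
      (P.eval k * (∏ j ∈ (insert x d).erase k, (k - j)⁻¹) * (ω * x - k)⁻¹) := by
    intro k hk
    rw [cf_insert hVu hk, hPe]
    have h1 : (∏ w ∈ u, (k - w)) * ∏ j ∈ u, bt j x * al j k =
        (∏ w ∈ u, ((x - w) * (w - ω * x)⁻¹)) * ∏ w ∈ u, (w - ω * k) := by
      rw [← Finset.prod_mul_distrib, ← Finset.prod_mul_distrib]
      refine Finset.prod_congr rfl fun w hw => ?_
      have h2 : k - w ≠ 0 := sub_ne_zero.2 fun h => Finset.disjoint_left.1 hVu hk (h ▸ hw)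
      have h3 : w - k = -(k - w) := by ring
      unfold bt al
      rw [h3]
      generalize (w - ω * x) = e
      generalize hf : k - w = f at *
      field_simp
      rw [ω_cube]
      ring
    have h2 : ∏ y ∈ (insert x d).erase k, (y - k)⁻¹ =
        (-1) ^ d.card * ∏ j ∈ (insert x d).erase k, (k - j)⁻¹ := by
      have : d.card = ((insert x d).erase k).card := by
        rw [Finset.card_erase_of_mem hk, Finset.card_insert_of_notMem hxd]; rfl
      rw [this, ← Finset.prod_const, ← Finset.prod_mul_distrib]
      refine Finset.prod_congr rfl fun y _ => ?_
      rw [← neg_sub k y, inv_neg]; ring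
    have h3 : gm k x = (ω - 1) * k * (ω * x - k)⁻¹ := by
      rw [gm, ← neg_sub (ω * x) k, div_eq_mul_inv, inv_neg]; ring
    rw [h2, h3]
    linear_combination (K * (-1) ^ d.card * (∏ j ∈ (insert x d).erase k, (k - j)⁻¹) *
      (ω - 1) * k * (ω * x - k)⁻¹) * h1
  rw [Finset.sum_congr rfl hterm, ← Finset.mul_sum, hpf, hPe, cf_insert hVu (by simp), ← hK,
    Finset.erase_insert hxd, Finset.prod_insert hxd, Finset.prod_union hdu, Finset.prod_union hdu]
  have e1 : (-1 : ℂ) ^ d.card * (∏ y ∈ d, (ω * x - y)⁻¹) * ∏ y ∈ d, (y - ω * x) = 1 := by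
    rw [← Finset.prod_const, ← Finset.prod_mul_distrib, ← Finset.prod_mul_distrib]
    refine Finset.prod_eq_one fun y hy => ?_
    have h1 : y - ω * x ≠ 0 := sub_ne_zero.2 (hg y (Finset.mem_union_left _ hy)).2
    rw [← neg_sub y (ω * x), inv_neg]
    generalize y - ω * x = e at *
    field_simp
  have e2 : (∏ w ∈ u, ((x - w) * (w - ω * x)⁻¹)) * (∏ w ∈ u, (w - ω * (ω * x))) *
      ∏ w ∈ u, (w - ω * x) = (-ω ^ 2) ^ u.card * (∏ w ∈ u, (x - w)) * ∏ w ∈ u, (x - ω * w) := by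
    rw [← Finset.prod_const]
    simp only [← Finset.prod_mul_distrib]
    refine Finset.prod_congr rfl fun w hw => ?_
    have h1 : w - ω * x ≠ 0 := sub_ne_zero.2 (hg w (Finset.mem_union_right _ hw)).2
    have h2 : w - ω * (ω * x) = -ω ^ 2 * (x - ω * w) := by linear_combination -w * ω_cube
    rw [h2]
    generalize w - ω * x = e at *
    field_simp
  have e3 : (∏ y ∈ d, (y - x)⁻¹) * (∏ y ∈ d, ∏ w ∈ insert x u, bt w y) *
      ∏ y ∈ d, (x - ω * y) = (-ω ^ 2) ^ d.card * ∏ y ∈ d, ∏ w ∈ u, bt w y := by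
    rw [← Finset.prod_const]
    simp only [← Finset.prod_mul_distrib]
    refine Finset.prod_congr rfl fun y hy => ?_
    have h1 : x - ω * y ≠ 0 := sub_ne_zero.2 (hg y (Finset.mem_union_left _ hy)).1
    have h2 : x - y ≠ 0 := sub_ne_zero.2 fun h => hxd (h ▸ hy)
    rw [Finset.prod_insert hxu, ← neg_sub x y, inv_neg, bt]
    generalize x - ω * y = e at *
    field_simp
  have e4 : (ω - 1) * (ω * x * (ω * x - x)⁻¹) = ω := by
    have : ω * x - x = -((1 - ω) * x) := by ring
    rw [this, inv_neg]
    field_simp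
    ring
  have e5 : (-ω ^ 2) ^ d.card = ω * (-ω ^ 2) ^ u.card := by
    rw [hc, pow_add]
    linear_combination (-ω ^ 2) ^ u.card * ω * ω_cube
  generalize (∏ y ∈ d, ∏ w ∈ u, bt w y) = E at *
  generalize (∏ y ∈ d, ∏ w ∈ insert x u, bt w y) = E' at *
  calc _ = K * (∏ w ∈ u, (x - w)) * (∏ w ∈ u, (x - ω * w)) *
        ((∏ y ∈ d, (y - x)⁻¹) * E' * ∏ y ∈ d, (x - ω * y)) := by ring
    _ = K * E * ω * ((-ω ^ 2) ^ u.card * (∏ w ∈ u, (x - w)) * ∏ w ∈ u, (x - ω * w)) := by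
      rw [e3, e5]; ring
    _ = K * E * ((ω - 1) * (ω * x * (ω * x - x)⁻¹)) * ((∏ w ∈ u, ((x - w) * (w - ω * x)⁻¹)) *
        (∏ w ∈ u, (w - ω * (ω * x))) * ∏ w ∈ u, (w - ω * x)) *
        ((-1 : ℂ) ^ d.card * (∏ y ∈ d, (ω * x - y)⁻¹) * ∏ y ∈ d, (y - ω * x)) := by
      rw [e1, e2, e4]; ring
    _ = _ := by ring

theorem cf_erase_mul {X d : Finset ℂ} (hXd : Disjoint X d) {k : ℂ} (hk : k ∈ X)
    (hg : ∀ y ∈ d, k ≠ ω * y) :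
    cf (X ∪ d) (X.erase k) * (∏ y ∈ d, ∏ w ∈ X.erase k, bt w y) =
      (∏ y ∈ d, ∏ w ∈ X, (y - w)⁻¹ * bt w y) * (-ω) ^ d.card * (∏ y ∈ d, (k - ω * y)) *
      ∏ w ∈ X.erase k, (k - w)⁻¹ := by
  have hkd : k ∉ d := Finset.disjoint_left.1 hXd hk
  have h1 : (X ∪ d) \ X.erase k = insert k d := by
    ext y
    have := @Finset.disjoint_left _ X d
    simp only [Finset.mem_sdiff, Finset.mem_union, Finset.mem_insert, Finset.mem_erase]
    grind
  rw [cf, h1, Finset.prod_insert hkd, mul_assoc, mul_comm]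
  congr 1
  rw [← Finset.prod_const]
  simp only [← Finset.prod_mul_distrib]
  refine Finset.prod_congr rfl fun y hy => ?_
  rw [← Finset.mul_prod_erase X _ hk]
  have h2 : k - y ≠ 0 := sub_ne_zero.2 fun h => hkd (h ▸ hy)
  have h3 : k - ω * y ≠ 0 := sub_ne_zero.2 (hg y hy)
  have h4 : (y - k)⁻¹ * bt k y * (-ω * (k - ω * y)) = 1 := by
    rw [← neg_sub k y, inv_neg, bt]
    generalize k - ω * y = e at *
    field_simp
    linear_combination ω_cube
  linear_combination -(∏ w ∈ X.erase k, (y - w)⁻¹ * bt w y) * h4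

theorem cyc_id_dn (d u : Finset ℂ) (x : ℂ) (hxd : x ∉ d) (hxu : x ∉ u) (hdu : Disjoint d u)
    (hc : d.card = u.card) (hx0 : x ≠ 0)
    (hg : ∀ y ∈ d ∪ u, x ≠ ω * y ∧ y ≠ ω * x) (hg' : ∀ w ∈ u, ∀ y ∈ d, w ≠ ω * y) :
    (∑ k ∈ insert x u, cf (insert x u ∪ d) ((insert x u).erase k) *
        ((∏ y ∈ d, ∏ w ∈ (insert x u).erase k, bt w y) * gm x k)) * ∏ y ∈ d ∪ u, (x - ω * y) =
      cf (insert x u ∪ d) u * (∏ y ∈ insert x d, ∏ w ∈ u, bt w y) *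
        ∏ y ∈ d ∪ u, (y - ω * x) := by
  have hω := ω_rel
  have hω0 := ω_ne_zero
  have hω1 := one_sub_ω_ne_zero
  have hXd : Disjoint (insert x u) d := by
    rw [Finset.disjoint_insert_left]; exact ⟨hxd, hdu.symm⟩
  have hXg : ∀ k ∈ insert x u, ∀ y ∈ d, k ≠ ω * y := by
    intro k hk y hy
    rcases Finset.mem_insert.1 hk with rfl | hk
    · exact (hg y (Finset.mem_union_left _ hy)).1
    · exact hg' k hk y hy
  set K := ∏ y ∈ d, ∏ w ∈ insert x u, (y - w)⁻¹ * bt w y with hK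
  set P : Polynomial ℂ := ∏ y ∈ d, (Polynomial.X - Polynomial.C (ω * y)) with hP
  have hPe : ∀ k, P.eval k = ∏ y ∈ d, (k - ω * y) := by
    intro k
    simp [hP, Polynomial.eval_prod]
  have hPd : P.degree < (insert x u).card := by
    rw [Finset.card_insert_of_notMem hxu, ← hc, hP, Polynomial.degree_prod]
    simp only [Polynomial.degree_X_sub_C, Finset.sum_const, nsmul_one]
    norm_cast
    omega
  have hωx : ω ^ 2 * x ∉ insert x u := by
    rw [Finset.mem_insert, not_or]
    refine ⟨fun h => hω1 ?_, fun h => (hg _ (Finset.mem_union_right _ h)).1 ?_⟩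
    · have : (1 - ω) * ω ^ 2 * x = 0 := by linear_combination h - x * ω_cube
      rcases mul_eq_zero.1 this with h | h
      · exact (mul_eq_zero.1 h).resolve_right (pow_ne_zero _ hω0)
      · exact absurd h hx0
    · linear_combination -x * ω_cube
  have hpf := sum_partial_fractions P (insert x u) hPd (ω ^ 2 * x) hωx
  have hterm : ∀ k ∈ insert x u, cf (insert x u ∪ d) ((insert x u).erase k) *
        ((∏ y ∈ d, ∏ w ∈ (insert x u).erase k, bt w y) * gm x k) =
      (K * (-ω) ^ d.card * ((1 - ω) * x * ω ^ 2)) *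
      (P.eval k * (∏ j ∈ (insert x u).erase k, (k - j)⁻¹) * (ω ^ 2 * x - k)⁻¹) := by
    intro k hk
    rw [← mul_assoc, cf_erase_mul hXd hk (hXg k hk), hPe]
    have h3 : gm x k = (1 - ω) * x * ω ^ 2 * (ω ^ 2 * x - k)⁻¹ := by
      have : x - ω * k = ω * (ω ^ 2 * x - k) := by linear_combination -x * ω_cube
      have h5 : ω⁻¹ = ω ^ 2 := by
        rw [inv_eq_iff_eq_inv, eq_comm, inv_eq_of_mul_eq_one_left]
        linear_combination ω_cube
      rw [gm, this, div_eq_mul_inv, mul_inv, h5]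
      ring
    rw [h3]
    ring
  have hx := cf_erase_mul hXd (Finset.mem_insert_self x u) (hXg x (by simp))
  rw [Finset.erase_insert hxu, ← hK] at hx
  rw [Finset.sum_congr rfl hterm, ← Finset.mul_sum, hpf, hPe, Finset.prod_insert hxu,
    Finset.prod_insert hxd, Finset.prod_union hdu, Finset.prod_union hdu]
  have e1 : (∏ w ∈ u, (ω ^ 2 * x - w)⁻¹) * ∏ w ∈ u, (x - ω * w) = ω ^ u.card := by
    rw [← Finset.prod_const]
    simp only [← Finset.prod_mul_distrib]
    refine Finset.prod_congr rfl fun w hw => ?_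
    have h1 : x - ω * w ≠ 0 := sub_ne_zero.2 (hg w (Finset.mem_union_right _ hw)).1
    have : ω ^ 2 * x - w = ω ^ 2 * (x - ω * w) := by linear_combination w * ω_cube
    rw [this]
    generalize x - ω * w = e at *
    field_simp
    linear_combination -ω_cube
  have e2 : ∏ y ∈ d, (ω ^ 2 * x - ω * y) = (-ω) ^ d.card * ∏ y ∈ d, (y - ω * x) := by
    rw [← Finset.prod_const]
    simp only [← Finset.prod_mul_distrib]
    refine Finset.prod_congr rfl fun w hw => ?_
    ring
  have e3 : (∏ w ∈ u, (x - w)⁻¹) * (∏ w ∈ u, bt w x) * (∏ w ∈ u, (w - ω * x)) =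
      (-ω ^ 2) ^ u.card := by
    rw [← Finset.prod_const]
    simp only [← Finset.prod_mul_distrib]
    refine Finset.prod_congr rfl fun w hw => ?_
    have h1 : w - ω * x ≠ 0 := sub_ne_zero.2 (hg w (Finset.mem_union_right _ hw)).2
    have h2 : x - w ≠ 0 := sub_ne_zero.2 fun h => hxu (h ▸ hw)
    rw [bt, ← neg_sub x w]
    generalize w - ω * x = e at *
    field_simp
  have e4 : (1 - ω) * x * ω ^ 2 * (ω ^ 2 * x - x)⁻¹ = 1 := by
    have : ω ^ 2 * x - x = (1 - ω) * x * ω ^ 2 := by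
      linear_combination (ω - 1) * x * ω_rel
    rw [this]
    exact mul_inv_cancel₀ (mul_ne_zero (mul_ne_zero hω1 hx0) (pow_ne_zero _ hω0))
  have e5 : (-ω ^ 2) ^ u.card = (-ω) ^ d.card * ω ^ u.card := by
    rw [hc, ← mul_pow]; congr 1; ring
  generalize (∏ y ∈ d, ∏ w ∈ u, bt w y) = E at *
  rw [e2]
  calc _ = K * (-ω) ^ d.card * (-ω) ^ d.card * (∏ y ∈ d, (y - ω * x)) *
        (∏ y ∈ d, (x - ω * y)) * ((1 - ω) * x * ω ^ 2 * (ω ^ 2 * x - x)⁻¹) *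
        ((∏ w ∈ u, (ω ^ 2 * x - w)⁻¹) * ∏ w ∈ u, (x - ω * w)) := by ring
    _ = K * (-ω) ^ d.card * (∏ y ∈ d, (y - ω * x)) *
        (∏ y ∈ d, (x - ω * y)) * (-ω ^ 2) ^ u.card := by rw [e4, e1, e5]; ring
    _ = _ := by
      rw [← e3]
      linear_combination -(∏ w ∈ u, bt w x) * (∏ w ∈ u, (w - ω * x)) *
        (∏ y ∈ d, (y - ω * x)) * hx

theorem sum_powerset_sum_erase (Z u : Finset ℂ) (hu : u ⊆ Z) (G : Finset ℂ → ℂ → ℂ) :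
    ∑ W ∈ Z.powerset, ∑ l ∈ W, (if W.erase l = u then G W l else 0) =
      ∑ k ∈ Z \ u, G (insert k u) k := by
  have h1 : ∀ W ∈ Z.powerset, ∑ l ∈ W, (if W.erase l = u then G W l else 0) =
      ∑ l ∈ Z, if l ∈ Z \ u then (if W = insert l u then G (insert l u) l else 0) else 0 := by
    intro W hW
    rw [← Finset.sum_subset (Finset.mem_powerset.1 hW)]
    · refine Finset.sum_congr rfl fun l hl => ?_
      have hlZ := Finset.mem_powerset.1 hW hl
      by_cases h : W.erase l = u
      · have h2 : W = insert l u := by rw [← h, Finset.insert_erase hl]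
        have h3 : l ∈ Z \ u := by rw [Finset.mem_sdiff, ← h]; simp [hlZ]
        rw [if_pos h, if_pos h3, if_pos h2, ← h2]
      · rw [if_neg h]
        split_ifs with h3 h2
        · exact absurd (by rw [h2, Finset.erase_insert (Finset.mem_sdiff.1 h3).2]) h
        · rfl
        · rfl
    · intro l _ hl
      split_ifs with h3 h2
      · exact absurd (h2 ▸ Finset.mem_insert_self l u) hl
      · rfl
      · rfl
  rw [Finset.sum_congr rfl h1, Finset.sum_comm,
    ← Finset.sum_subset (Finset.sdiff_subset : Z \ u ⊆ Z)]
  · refine Finset.sum_congr rfl fun l hl => ?_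
    simp only [if_pos hl]
    rw [Finset.sum_ite_eq', if_pos]
    rw [Finset.mem_powerset, Finset.insert_subset_iff]
    exact ⟨(Finset.mem_sdiff.1 hl).1, hu⟩
  · intro l _ hl
    exact Finset.sum_eq_zero fun W _ => if_neg hl

theorem psiRat_up_cons_extreme (D U : List ℂ) (x : ℂ) (h : Good (x :: (D ++ U))) :
    psiRat ((true, x) :: (spins false D ++ spins true U)) =
      ∑ k ∈ insert x D.toFinset,
        cf (insert x D.toFinset ∪ U.toFinset) (insert k U.toFinset) *
        (gm k x * ∏ j ∈ U.toFinset, bt j x * al j k) *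
        ∏ d ∈ D.toFinset, ∏ u ∈ U.toFinset, bt u d := by
  have hs : supp ((true, x) :: (spins false D ++ spins true U)) =
      insert x D.toFinset ∪ U.toFinset := by
    simp [supp, map_snd_spins]
  have hn := List.nodup_cons.1 h.1
  have hd := List.nodup_append'.1 hn.2
  have hVu : Disjoint (insert x D.toFinset) U.toFinset := by
    rw [Finset.disjoint_left]
    intro y hy hyU
    rw [List.mem_toFinset] at hyU
    rcases Finset.mem_insert.1 hy with rfl | hy
    · exact hn.1 (List.mem_append_right _ hyU)
    · exact hd.2.2 (List.mem_toFinset.1 hy) hyU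
  have hZu : (insert x D.toFinset ∪ U.toFinset) \ U.toFinset = insert x D.toFinset := by
    rw [Finset.union_sdiff_right, Finset.sdiff_eq_self_of_disjoint hVu]
  unfold psiRat
  have key := sum_powerset_sum_erase (insert x D.toFinset ∪ U.toFinset) U.toFinset Finset.subset_union_right
    (fun W k => cf (insert x D.toFinset ∪ U.toFinset) W *
      (gm k x * ∏ j ∈ U.toFinset, bt j x * al j k) *
        ∏ d ∈ D.toFinset, ∏ u ∈ U.toFinset, bt u d)
  rw [hZu] at key
  rw [hs, ← key]
  refine Finset.sum_congr rfl fun W hW => ?_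
  rw [bethe_up, Finset.mul_sum]
  refine Finset.sum_congr rfl fun l hl => ?_
  by_cases hx : x ∈ W.erase l
  · rw [if_neg, Finset.prod_eq_zero hx, mul_zero, zero_mul, mul_zero]
    · rw [bt_self, zero_mul]
    · rintro h'
      exact Finset.disjoint_left.1 hVu (Finset.mem_insert_self _ _) (h' ▸ hx)
  · rw [bethe_extreme D U h.of_cons]
    · split_ifs with h'
      · rw [h']; ring
      · ring
    · intro w hw
      have h2 := Finset.mem_powerset.1 hW (Finset.erase_subset _ _ hw)
      have h3 : w ≠ x := ne_of_mem_of_not_mem hw hx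
      simp only [Finset.mem_union, Finset.mem_insert, List.mem_toFinset] at h2
      simp only [List.mem_toFinset, List.mem_append]
      tauto

theorem bethe_spins_up_perm {U U' : List ℂ} (p : U.Perm U') (W : Finset ℂ)
    (h : ∀ w ∈ W, ∀ z ∈ U, w ≠ ω * z) :
    bethe (spins true U) W = bethe (spins true U') W := by
  induction p generalizing W with
  | nil => rfl
  | cons z _ ih =>
    rw [spins_cons, spins_cons, bethe_up, bethe_up]
    refine Finset.sum_congr rfl fun l _ => ?_
    rw [ih _ fun w hw z hz => h w (Finset.erase_subset _ _ hw) z (List.mem_cons_of_mem _ hz)]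
  | swap x y l =>
    exact bethe_exchange_up_up [] (spins true l) x y W fun w hw =>
      ⟨h w hw x (by simp), h w hw y (by simp)⟩
  | trans p _ ih₁ ih₂ =>
    rw [ih₁ W h, ih₂ W fun w hw z hz => h w hw z (p.mem_iff.2 hz)]

theorem bethe_spins_up_erase (U : List ℂ) (x : ℂ) (h : Good (x :: U)) (k : ℂ) (hk : k ∈ x :: U) :
    bethe (spins true U) ((insert x U.toFinset).erase k) = gm x k := by
  have hn := List.nodup_cons.1 h.1
  have hxU : x ∉ U.toFinset := by simpa using hn.1
  have hx0 : x ≠ 0 := h.ne_zero (by simp)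
  rcases List.mem_cons.1 hk with rfl | hkU
  · rw [Finset.erase_insert hxU, bethe_spins_up_self U h.of_cons, gm_self hx0]
  · have hkx : k ≠ x := ne_of_mem_of_not_mem hkU hn.1
    have hp : U.Perm (U.erase k ++ [k]) :=
      (List.perm_cons_erase hkU).trans (List.perm_append_singleton k _).symm
    have hn' : (U.erase k).Nodup := hn.2.erase k
    have hU' : Good (U.erase k) := h.of_cons.sublist List.erase_sublist
    have hW : (insert x U.toFinset).erase k = insert x (U.erase k).toFinset := by
      ext w
      simp only [Finset.mem_erase, Finset.mem_insert, List.mem_toFinset, hn.2.mem_erase_iff]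
      grind
    have hxU' : x ∉ (U.erase k).toFinset := by
      rw [List.mem_toFinset]; exact fun h' => hn.1 (List.mem_of_mem_erase h')
    rw [bethe_spins_up_perm hp, spins_append, hW]
    · change bethe (spins true (U.erase k) ++ [(true, k)]) _ = _
      rw [bethe_append_up, Finset.sum_insert hxU', Finset.erase_insert hxU',
        bethe_spins_up_self _ hU', Finset.sum_eq_zero, add_zero, mul_one, mul_assoc]
      · have : (spins true (U.erase k)).map (fun p => bt x p.2) = (U.erase k).map (bt x) := by
          simp [spins, Function.comp_def]
        rw [this, ← List.prod_toFinset _ hn', ← Finset.prod_mul_distrib, Finset.prod_eq_one,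
          mul_one]
        intro j hj
        refine bt_mul_al (h.2 x (by simp) j ?_) (ne_of_mem_of_not_mem hj hxU').symm
        exact List.mem_cons_of_mem _ (List.mem_of_mem_erase (List.mem_toFinset.1 hj))
      · intro m hm
        have : ((spins true (U.erase k)).map fun p => bt m p.2).prod = 0 := by
          refine List.prod_eq_zero (List.mem_map.2 ⟨(true, m), ?_, bt_self m⟩)
          exact List.mem_map.2 ⟨m, List.mem_toFinset.1 hm, rfl⟩
        rw [this]; ring
    · intro w hw z hz
      refine h.2 w ?_ z (List.mem_cons_of_mem _ hz)
      simpa using Finset.mem_of_mem_erase hw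

theorem psiRat_append_dn_extreme (D U : List ℂ) (x : ℂ) (h : Good (x :: (D ++ U)))  :
    psiRat (spins false D ++ spins true U ++ [(false, x)]) =
      ∑ k ∈ insert x U.toFinset,
        cf (insert x U.toFinset ∪ D.toFinset) ((insert x U.toFinset).erase k) *
        ((∏ y ∈ D.toFinset, ∏ w ∈ (insert x U.toFinset).erase k, bt w y) * gm x k) := by
  have hs : supp (spins false D ++ spins true U ++ [(false, x)]) =
      insert x U.toFinset ∪ D.toFinset := by
    ext; simp [supp, map_snd_spins]; tauto
  have hn := List.nodup_cons.1 h.1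
  have hd := List.nodup_append'.1 hn.2
  have hxU : x ∉ U.toFinset := by
    rw [List.mem_toFinset]; exact fun h' => hn.1 (List.mem_append_right _ h')
  have hU : Good (x :: U) := h.sublist (by simp)
  unfold psiRat
  rw [hs, ← Finset.sum_subset (s₁ := (insert x U.toFinset).image (insert x U.toFinset).erase)]
  · rw [Finset.sum_image]
    · refine Finset.sum_congr rfl fun k hk => ?_
      rw [bethe_append_dn, bethe_spins_dn_append D hd.1, bethe_spins_up_erase U x hU]
      simpa using hk
    · intro k hk l hl hkl
      by_contra hne
      have : k ∈ (insert x U.toFinset).erase l := Finset.mem_erase.2 ⟨hne, hk⟩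
      rw [← hkl] at this
      simp at this
  · intro W hW
    obtain ⟨k, _, rfl⟩ := Finset.mem_image.1 hW
    exact Finset.mem_powerset.2 ((Finset.erase_subset _ _).trans Finset.subset_union_left)
  · intro W hW hWn
    rw [bethe_append_dn, bethe_spins_dn_append D hd.1]
    by_cases hWd : ∃ w ∈ W, w ∈ D
    · obtain ⟨w, hw, hwD⟩ := hWd
      rw [Finset.prod_eq_zero (List.mem_toFinset.2 hwD), zero_mul, mul_zero]
      exact Finset.prod_eq_zero hw (bt_self w)
    · push Not at hWd
      rw [bethe_eq_zero_of_card, mul_zero, mul_zero]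
      rw [countP_spins_true, ← List.toFinset_card_of_nodup hd.2.1]
      intro hc
      have hsub : W ⊆ insert x U.toFinset := by
        intro w hw
        have := Finset.mem_powerset.1 hW hw
        rw [Finset.mem_union] at this
        exact this.resolve_right fun h' => hWd w hw (List.mem_toFinset.1 h')
      have hc' := Finset.card_sdiff_add_card_eq_card hsub
      rw [Finset.card_insert_of_notMem hxU, hc, add_comm, add_right_inj,
        Finset.card_eq_one] at hc'
      obtain ⟨k, hk⟩ := hc'
      have hkm : k ∈ insert x U.toFinset \ W := by rw [hk]; simp
      refine hWn (Finset.mem_image.2 ⟨k, (Finset.mem_sdiff.1 hkm).1, ?_⟩)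
      rw [← Finset.sdiff_sdiff_eq_self hsub, hk, Finset.sdiff_singleton_eq_erase]

theorem map_prod_spins (D U : List ℂ) (hD : (D ++ U).Nodup) (f : ℂ → ℂ) :
    ((spins false D ++ spins true U).map fun p => f p.2).prod =
      ∏ y ∈ D.toFinset ∪ U.toFinset, f y := by
  rw [← List.toFinset_append, List.prod_toFinset _ hD]
  simp [spins, Function.comp_def]

theorem psiRat_cyc_extreme (D U : List ℂ) (s : Bool) (x : ℂ) (h : Good (x :: (D ++ U)))
    (hc : 2 * (U.length + if s then 1 else 0) = D.length + U.length) :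
    psiRat (spins false D ++ spins true U ++ [(s, x)]) *
        ((spins false D ++ spins true U).map fun p => x - ω * p.2).prod =
      psiRat ((s, x) :: (spins false D ++ spins true U)) *
        ((spins false D ++ spins true U).map fun p => p.2 - ω * x).prod := by
  have hn := List.nodup_cons.1 h.1
  have hd := List.nodup_append'.1 hn.2
  have hxD : x ∉ D.toFinset := by
    rw [List.mem_toFinset]; exact fun h' => hn.1 (List.mem_append_left _ h')
  have hxU : x ∉ U.toFinset := by
    rw [List.mem_toFinset]; exact fun h' => hn.1 (List.mem_append_right _ h')
  have hDU : Disjoint D.toFinset U.toFinset := by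
    rw [Finset.disjoint_left]
    exact fun y hy hyU => hd.2.2 (List.mem_toFinset.1 hy) (List.mem_toFinset.1 hyU)
  have hx0 : x ≠ 0 := h.ne_zero (by simp)
  have hg : ∀ y ∈ D.toFinset ∪ U.toFinset, x ≠ ω * y ∧ y ≠ ω * x := by
    intro y hy
    have hy' : y ∈ x :: (D ++ U) := by
      rw [← List.toFinset_append, List.mem_toFinset] at hy
      exact List.mem_cons_of_mem _ hy
    exact ⟨h.2 x (by simp) y hy', h.2 y hy' x (by simp)⟩
  rw [map_prod_spins D U hn.2 fun y => x - ω * y, map_prod_spins D U hn.2 fun y => y - ω * x]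
  have hcD := List.toFinset_card_of_nodup hd.1
  have hcU := List.toFinset_card_of_nodup hd.2.1
  cases s with
  | true =>
    have hgood : Good (D ++ (U ++ [x])) := by
      refine h.perm ?_
      rw [← List.append_assoc]
      exact (List.perm_append_singleton _ _).symm
    have h1 : spins false D ++ spins true U ++ [(true, x)] =
        spins false D ++ spins true (U ++ [x]) := by
      rw [spins_append, List.append_assoc]; rfl
    have h2 : (U ++ [x]).toFinset = insert x U.toFinset := by
      ext; simp
    have h3 : (D ++ (U ++ [x])).toFinset = insert x D.toFinset ∪ U.toFinset := by
      ext; simp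
    rw [h1, psiRat_extreme D (U ++ [x]) hgood, h2, h3, psiRat_up_cons_extreme D U x h,
      cyc_id_up D.toFinset U.toFinset x hxD hxU hDU (by simp at hc; omega) hx0 hg,
      Finset.sum_mul]
  | false =>
    have h1 : (false, x) :: (spins false D ++ spins true U) = spins false (x :: D) ++ spins true U :=
      rfl
    have h3 : (x :: D ++ U).toFinset = insert x U.toFinset ∪ D.toFinset := by
      ext; simp; tauto
    rw [h1, psiRat_extreme (x :: D) U h, h3, List.toFinset_cons, psiRat_append_dn_extreme D U x h,
      cyc_id_dn D.toFinset U.toFinset x hxD hxU hDU (by simp at hc; omega) hx0 hg]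
    intro w hw y hy
    refine h.2 w ?_ y ?_
    · simp [List.mem_toFinset.1 hw]
    · simp [List.mem_toFinset.1 hy]

theorem psiRat_cyc (s : Bool) (x : ℂ) (L : List (Bool × ℂ)) (h : Good (x :: L.map Prod.snd))
    (hc : 2 * ((s, x) :: L).countP (·.1) = L.length) :
    psiRat (L ++ [(s, x)]) * (L.map fun p => x - ω * p.2).prod =
      psiRat ((s, x) :: L) * (L.map fun p => p.2 - ω * x).prod := by
  revert h hc
  refine exchange_induction (Q := fun L => Good (x :: L.map Prod.snd) →
    2 * ((s, x) :: L).countP (·.1) = L.length →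
    psiRat (L ++ [(s, x)]) * (L.map fun p => x - ω * p.2).prod =
      psiRat ((s, x) :: L) * (L.map fun p => p.2 - ω * x).prod) ?_ ?_ L
  · intro D U h hc
    have hm : (spins false D ++ spins true U).map Prod.snd = D ++ U := by
      simp [map_snd_spins]
    rw [hm] at h
    refine psiRat_cyc_extreme D U s x h ?_
    rw [List.countP_cons, List.countP_append, countP_spins_true, countP_spins_false] at hc
    simpa [spins] using hc
  · intro A B x₁ y₁ h1 h2 h hc
    have g1 : Good (x :: (A ++ (false, x₁) :: (true, y₁) :: B).map Prod.snd) := by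
      simpa using h
    have g2 : Good (x :: (A ++ (false, y₁) :: (true, x₁) :: B).map Prod.snd) := by
      refine h.perm (List.Perm.cons _ ?_)
      simp only [List.map_append, List.map_cons]
      exact List.Perm.append_left _ (List.Perm.swap _ _ _)
    have h1 := h1 g1 (by simp [List.countP_cons] at hc ⊢; omega)
    have h2 := h2 g2 (by simp [List.countP_cons] at hc ⊢; omega)
    have e1 := psiRat_dn_up A (B ++ [(s, x)]) x₁ y₁ (h.perm (by
      simp only [List.map_append, List.map_cons]
      simpa using (List.perm_append_singleton x
        (A.map Prod.snd ++ x₁ :: y₁ :: B.map Prod.snd)).symm))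
    have e2 := psiRat_dn_up ((s, x) :: A) B x₁ y₁ (by simpa using h)
    have hne : ω ^ 2 * (x₁ - y₁) ≠ 0 := by
      refine mul_ne_zero (pow_ne_zero _ ω_ne_zero) (sub_ne_zero.2 fun hxy => ?_)
      have := (List.nodup_cons.1 h.1).2
      simp [hxy, List.nodup_append'] at this
    simp only [List.map_append, List.map_cons, List.prod_append, List.prod_cons, List.append_assoc,
      List.cons_append] at h1 h2 e1 e2 ⊢
    apply mul_left_cancel₀ hne
    linear_combination (x₁ - ω * y₁) * h2 - (1 - ω) * y₁ * h1 -
      e1 * ((A.map fun p => x - ω * p.2).prod * ((x - ω * x₁) * ((x - ω * y₁) *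
        (B.map fun p => x - ω * p.2).prod))) +
      e2 * ((A.map fun p => p.2 - ω * x).prod * ((x₁ - ω * x) * ((y₁ - ω * x) *
        (B.map fun p => p.2 - ω * x).prod)))

/-- Product of the factors `w - ω z` over all pairs `z` before `w`. -/
def pre : List ℂ → ℂ
  | [] => 1
  | z :: t => (t.map fun w => w - ω * z).prod * pre t

theorem pre_append (A B : List ℂ) :
    pre (A ++ B) = pre A * pre B * (A.map fun z => (B.map fun w => w - ω * z).prod).prod := by
  induction A with
  | nil => simp [pre]
  | cons a A ih => simp only [List.cons_append, pre, ih, List.map_append, List.prod_append,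
      List.map_cons, List.prod_cons]; ring

/-- The components of the inhomogeneous ground state, at pairwise generic parameters. -/
def psi (L : List (Bool × ℂ)) : ℂ := pre (L.map Prod.snd) * psiRat L

theorem psi_cyc (s : Bool) (x : ℂ) (L : List (Bool × ℂ)) (h : Good (x :: L.map Prod.snd))
    (hc : 2 * ((s, x) :: L).countP (·.1) = L.length) :
    psi (L ++ [(s, x)]) = psi ((s, x) :: L) := by
  have h1 := psiRat_cyc s x L h hc
  unfold psi
  rw [List.map_append, pre_append, List.map_cons, List.map_cons, pre]
  simp only [List.map_nil, pre, List.map_cons, List.prod_cons, List.prod_nil, mul_one,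
    List.map_map, Function.comp_def]
  linear_combination pre (L.map Prod.snd) * h1

theorem pre_swap (A B : List ℂ) (x y : ℂ) :
    (y - ω * x) * pre (A ++ y :: x :: B) = (x - ω * y) * pre (A ++ x :: y :: B) := by
  rw [pre_append, pre_append]
  simp only [pre, List.map_cons, List.prod_cons]
  have : (A.map fun z => (y - ω * z) * ((x - ω * z) * (B.map fun w => w - ω * z).prod)) =
      A.map fun z => (x - ω * z) * ((y - ω * z) * (B.map fun w => w - ω * z).prod) :=
    List.map_congr_left fun z _ => by ring
  rw [this]
  ring

theorem psi_up_dn (A B : List (Bool × ℂ)) (x y : ℂ)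
    (h : Good ((A ++ (true, x) :: (true, y) :: B).map Prod.snd)) :
    (y - ω * x) * psi (A ++ (true, y) :: (false, x) :: B) =
      (1 - ω) * x * psi (A ++ (true, x) :: (false, y) :: B) +
      ω ^ 2 * (x - y) * psi (A ++ (false, x) :: (true, y) :: B) := by
  have h1 := psiRat_up_dn A B x y h
  have h2 := pre_swap (A.map Prod.snd) (B.map Prod.snd) x y
  simp only [psi, List.map_append, List.map_cons]
  linear_combination h2 * psiRat (A ++ (true, y) :: (false, x) :: B) +
    pre (A.map Prod.snd ++ x :: y :: B.map Prod.snd) * h1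

theorem psi_dn_up (A B : List (Bool × ℂ)) (x y : ℂ)
    (h : Good ((A ++ (true, x) :: (true, y) :: B).map Prod.snd)) :
    (y - ω * x) * psi (A ++ (false, y) :: (true, x) :: B) =
      ω ^ 2 * (x - y) * psi (A ++ (true, x) :: (false, y) :: B) +
      (1 - ω) * y * psi (A ++ (false, x) :: (true, y) :: B) := by
  have h1 := psiRat_dn_up A B x y h
  have h2 := pre_swap (A.map Prod.snd) (B.map Prod.snd) x y
  simp only [psi, List.map_append, List.map_cons]
  linear_combination h2 * psiRat (A ++ (false, y) :: (true, x) :: B) +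
    pre (A.map Prod.snd ++ x :: y :: B.map Prod.snd) * h1

theorem psi_same (A B : List (Bool × ℂ)) (s : Bool) (x y : ℂ)
    (h : Good ((A ++ (true, x) :: (true, y) :: B).map Prod.snd)) :
    (y - ω * x) * psi (A ++ (s, y) :: (s, x) :: B) =
      (x - ω * y) * psi (A ++ (s, x) :: (s, y) :: B) := by
  have h1 := psiRat_same A B s x y h
  have h2 := pre_swap (A.map Prod.snd) (B.map Prod.snd) x y
  simp only [psi, List.map_append, List.map_cons]
  linear_combination h2 * psiRat (A ++ (s, y) :: (s, x) :: B) +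
    (x - ω * y) * pre (A.map Prod.snd ++ x :: y :: B.map Prod.snd) * h1

theorem psi_extreme (D U : List ℂ) (h : Good (D ++ U)) :
    psi (spins false D ++ spins true U) = pre D * pre U * (-ω ^ 2) ^ (D.length * U.length) := by
  have hn := List.nodup_append'.1 h.1
  have hsd : (D ++ U).toFinset \ U.toFinset = D.toFinset := by
    ext a
    have := @hn.2.2 a
    simp only [Finset.mem_sdiff, List.mem_toFinset, List.mem_append]
    tauto
  unfold psi
  rw [psiRat_extreme D U h, List.map_append, map_snd_spins, map_snd_spins, pre_append, cf, hsd]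
  rw [← List.prod_toFinset _ hn.1]
  have : ∀ d ∈ D.toFinset, (U.map fun w => w - ω * d).prod =
      ∏ w ∈ U.toFinset, (w - ω * d) := fun d _ => (List.prod_toFinset _ hn.2.1).symm
  rw [Finset.prod_congr rfl this, mul_assoc, ← Finset.prod_mul_distrib, ← Finset.prod_mul_distrib]
  congr 1
  rw [Finset.prod_congr rfl (g := fun _ => (-ω ^ 2) ^ U.length)]
  · rw [Finset.prod_const, List.toFinset_card_of_nodup hn.1, ← pow_mul, mul_comm]
  · intro d hd
    rw [← Finset.prod_mul_distrib, ← Finset.prod_mul_distrib,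
      Finset.prod_congr rfl (g := fun _ => -ω ^ 2)]
    · rw [Finset.prod_const, List.toFinset_card_of_nodup hn.2.1]
    · intro u hu
      rw [List.mem_toFinset] at hd hu
      have h1 : u - ω * d ≠ 0 := sub_ne_zero.2
        (h.2 u (List.mem_append_right _ hu) d (List.mem_append_left _ hd))
      have h2 : d - u ≠ 0 := sub_ne_zero.2 fun e => hn.2.2 hd (e ▸ hu)
      unfold bt
      generalize u - ω * d = e at *
      field_simp
      ring

/-- Substitute parameters for labels. -/
def relabel {α β : Type*} (z : α → β) (L : List (Bool × α)) : List (Bool × β) :=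
  L.map (Prod.map id z)

theorem relabel_nil {α β : Type*} (z : α → β) : relabel z [] = [] := rfl

theorem relabel_cons {α β : Type*} (z : α → β) (s : Bool) (x : α) (L : List (Bool × α)) :
    relabel z ((s, x) :: L) = (s, z x) :: relabel z L := rfl

theorem relabel_append {α β : Type*} (z : α → β) (A B : List (Bool × α)) :
    relabel z (A ++ B) = relabel z A ++ relabel z B := List.map_append

theorem relabel_spins {α β : Type*} (z : α → β) (s : Bool) (l : List α) :
    relabel z (spins s l) = spins s (l.map z) := by simp [relabel, spins, Function.comp_def]

theorem map_snd_relabel {α β : Type*} (z : α → β) (L : List (Bool × α)) :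
    (relabel z L).map Prod.snd = (L.map Prod.snd).map z := by
  simp [relabel, Function.comp_def]

theorem relabel_relabel {α β γ : Type*} (z : β → γ) (f : α → β) (L : List (Bool × α)) :
    relabel z (relabel f L) = relabel (z ∘ f) L := by
  simp [relabel, Function.comp_def]

theorem relabel_congr {α β : Type*} {z z' : α → β} {L : List (Bool × α)}
    (h : ∀ x ∈ L.map Prod.snd, z x = z' x) : relabel z L = relabel z' L := by
  refine List.map_congr_left fun p hp => ?_
  rw [Prod.map_apply', Prod.map_apply', h _ (List.mem_map_of_mem hp)]

theorem poly_ext (l : List ℕ) (hl : l.Nodup) (p q : MvPolynomial ℕ ℂ)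
    (h : ∀ z : ℕ → ℂ, Good (l.map z) → MvPolynomial.eval z p = MvPolynomial.eval z q) :
    p = q := by
  have hX : ∀ i j : ℕ, (MvPolynomial.X i - MvPolynomial.C ω * MvPolynomial.X j :
      MvPolynomial ℕ ℂ) ≠ 0 := by
    intro i j h0
    have := congrArg (MvPolynomial.eval fun _ => (1 : ℂ)) h0
    simp only [map_sub, map_mul, MvPolynomial.eval_X, MvPolynomial.eval_C, map_zero,
      mul_one] at this
    exact one_sub_ω_ne_zero this
  set G : MvPolynomial ℕ ℂ :=
    (∏ i ∈ l.toFinset, ∏ j ∈ l.toFinset.erase i, (MvPolynomial.X i - MvPolynomial.X j)) *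
    ∏ i ∈ l.toFinset, ∏ j ∈ l.toFinset, (MvPolynomial.X i - MvPolynomial.C ω * MvPolynomial.X j)
    with hG
  have hG0 : G ≠ 0 := by
    refine mul_ne_zero (Finset.prod_ne_zero_iff.2 fun i _ => Finset.prod_ne_zero_iff.2
      fun j hj => ?_) (Finset.prod_ne_zero_iff.2 fun i _ => Finset.prod_ne_zero_iff.2
      fun j _ => hX i j)
    exact sub_ne_zero.2 fun e => Finset.ne_of_mem_erase hj (MvPolynomial.X_injective e).symm
  have : G * (p - q) = 0 := by
    refine MvPolynomial.funext fun z => ?_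
    rw [map_mul, map_zero]
    by_cases hz : Good (l.map z)
    · rw [map_sub, h z hz, sub_self, mul_zero]
    · suffices MvPolynomial.eval z G = 0 by rw [this, zero_mul]
      by_contra hne
      apply hz
      rw [hG, map_mul, map_prod, map_prod] at hne
      simp only [map_prod, map_sub, map_mul, MvPolynomial.eval_X, MvPolynomial.eval_C] at hne
      have h1 := Finset.prod_ne_zero_iff.1 (left_ne_zero_of_mul hne)
      have h2 := Finset.prod_ne_zero_iff.1 (right_ne_zero_of_mul hne)
      refine ⟨(List.nodup_map_iff_inj_on hl).2 fun i hi j hj e => ?_, ?_⟩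
      · by_contra hij
        have := Finset.prod_ne_zero_iff.1 (h1 i (List.mem_toFinset.2 hi)) j
          (Finset.mem_erase.2 ⟨fun e => hij e.symm, List.mem_toFinset.2 hj⟩)
        exact this (sub_eq_zero.2 e)
      · intro x hx y hy
        obtain ⟨i, hi, rfl⟩ := List.mem_map.1 hx
        obtain ⟨j, hj, rfl⟩ := List.mem_map.1 hy
        exact sub_ne_zero.1 (Finset.prod_ne_zero_iff.1 (h2 i (List.mem_toFinset.2 hi)) j
          (List.mem_toFinset.2 hj))
  exact sub_eq_zero.1 ((mul_eq_zero.1 this).resolve_left hG0)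

theorem X_sub_X_dvd_rename_swap (i j : ℕ) (p : MvPolynomial ℕ ℂ) :
    MvPolynomial.X i - MvPolynomial.X j ∣ MvPolynomial.rename (Equiv.swap i j) p - p := by
  induction p using MvPolynomial.induction_on with
  | C a => simp
  | add p q hp hq =>
    rw [map_add, add_sub_add_comm]
    exact dvd_add hp hq
  | mul_X p k hp =>
    rw [map_mul, MvPolynomial.rename_X]
    have h2 : MvPolynomial.X i - MvPolynomial.X j ∣
        (MvPolynomial.X (Equiv.swap i j k) - MvPolynomial.X k : MvPolynomial ℕ ℂ) := by
      rw [Equiv.swap_apply_def]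
      split_ifs with h1 h2
      · rw [h1, ← dvd_neg, neg_sub]
      · rw [h2]
      · simp
    obtain ⟨a, ha⟩ := hp
    obtain ⟨b, hb⟩ := h2
    exact ⟨a * MvPolynomial.X (Equiv.swap i j k) + p * b, by
      linear_combination MvPolynomial.X (Equiv.swap i j k) * ha + p * hb⟩

theorem relabel_swap (A B : List (Bool × ℕ)) (s t : Bool) (x y : ℕ)
    (h : ((A ++ (s, x) :: (t, y) :: B).map Prod.snd).Nodup) :
    relabel (Equiv.swap x y) (A ++ (s, x) :: (t, y) :: B) = A ++ (s, y) :: (t, x) :: B := by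
  have hid : ∀ C : List (Bool × ℕ), (∀ a ∈ C.map Prod.snd, a ≠ x ∧ a ≠ y) →
      relabel (Equiv.swap x y) C = C := by
    intro C hC
    have : relabel (Equiv.swap x y) C = relabel id C := relabel_congr fun a ha =>
      Equiv.swap_apply_of_ne_of_ne (hC a ha).1 (hC a ha).2
    rw [this]
    simp [relabel]
  rw [List.map_append, List.map_cons, List.map_cons] at h
  have h' := List.nodup_append'.1 h
  have h2 := List.nodup_cons.1 h'.2.1
  have h3 := List.nodup_cons.1 h2.2
  rw [relabel_append, relabel_cons, relabel_cons, Equiv.swap_apply_left, Equiv.swap_apply_right,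
    hid A fun a ha => ⟨fun e => h'.2.2 ha (by simp [e]), fun e => h'.2.2 ha (by simp [e])⟩,
    hid B fun a ha => ⟨fun e => h2.1 (by rw [← e]; exact List.mem_cons_of_mem _ ha),
      fun e => h3.1 (by rw [← e]; exact ha)⟩]

/-- `P` is a polynomial form of the component labelled by `L`. -/
def Represents (L : List (Bool × ℕ)) (P : MvPolynomial ℕ ℂ) : Prop :=
  ∀ z : ℕ → ℂ, Good ((L.map Prod.snd).map z) → MvPolynomial.eval z P = psi (relabel z L)

theorem exists_pre_poly (l : List ℕ) :
    ∃ P : MvPolynomial ℕ ℂ, ∀ z : ℕ → ℂ, MvPolynomial.eval z P = pre (l.map z) := by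
  induction l with
  | nil => exact ⟨1, fun z => by simp [pre]⟩
  | cons a l ih =>
    obtain ⟨P, hP⟩ := ih
    refine ⟨(l.map fun w => MvPolynomial.X w - MvPolynomial.C ω * MvPolynomial.X a).prod * P,
      fun z => ?_⟩
    rw [map_mul, hP, map_list_prod, List.map_cons, pre, List.map_map, List.map_map]
    simp [Function.comp_def]

theorem exists_represents (L : List (Bool × ℕ)) :
    (L.map Prod.snd).Nodup → ∃ P, Represents L P := by
  refine exchange_induction (Q := fun L => (L.map Prod.snd).Nodup → ∃ P, Represents L P) ?_ ?_ L
  · intro D U _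
    obtain ⟨P, hP⟩ := exists_pre_poly D
    obtain ⟨Q, hQ⟩ := exists_pre_poly U
    refine ⟨P * Q * MvPolynomial.C ((-ω ^ 2) ^ (D.length * U.length)), fun z hz => ?_⟩
    rw [List.map_append, map_snd_spins, map_snd_spins, List.map_append] at hz
    rw [relabel_append, relabel_spins, relabel_spins, psi_extreme _ _ hz, map_mul, map_mul, hP, hQ,
      MvPolynomial.eval_C, List.length_map, List.length_map]
  · intro A B x y h1 _ hn
    obtain ⟨P, hP⟩ := h1 (by simpa using hn)
    obtain ⟨d, hd⟩ := X_sub_X_dvd_rename_swap x y P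
    refine ⟨MvPolynomial.C ω * ((MvPolynomial.X y - MvPolynomial.C ω * MvPolynomial.X x) * d -
      MvPolynomial.C ω * P), fun z hz => ?_⟩
    have hxy : z x - z y ≠ 0 := by
      refine sub_ne_zero.2 fun e => ?_
      have := hz.1
      simp [List.nodup_append', e] at this
    have hgood : Good ((relabel z A ++ (true, z x) :: (true, z y) :: relabel z B).map Prod.snd) := by
      simpa [map_snd_relabel] using hz
    have hP1 := hP z (by simpa using hz)
    have hsw := relabel_swap A B false true x y (by simpa using hn)
    have hP2 := hP (z ∘ Equiv.swap x y) (by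
      rw [← List.map_map, ← map_snd_relabel, hsw]
      refine hz.perm (List.Perm.map _ ?_)
      simp only [List.map_append, List.map_cons]
      exact List.Perm.append_left _ (List.Perm.swap _ _ _))
    rw [← MvPolynomial.eval_rename, ← relabel_relabel, hsw] at hP2
    have h3 := congrArg (MvPolynomial.eval z) hd
    have h4 := psi_dn_up _ _ _ _ hgood
    simp only [relabel_append, relabel_cons] at hP1 hP2 ⊢
    rw [← hP1, ← hP2] at h4
    simp only [map_sub, map_mul, MvPolynomial.eval_X, MvPolynomial.eval_C] at h3 ⊢
    apply mul_left_cancel₀ hxy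
    apply mul_left_cancel₀ (pow_ne_zero 2 ω_ne_zero)
    linear_combination h4 - (z y - ω * z x) * h3 + (MvPolynomial.eval z d * (z y - ω * z x) *
      (z x - z y) - ω * (z x - z y) * MvPolynomial.eval z P) * ω_cube

theorem Represents.unique {L : List (Bool × ℕ)} (hL : (L.map Prod.snd).Nodup)
    {P Q : MvPolynomial ℕ ℂ} (hP : Represents L P) (hQ : Represents L Q) : P = Q :=
  poly_ext _ hL _ _ fun z hz => by rw [hP z hz, hQ z hz]

theorem Represents.rename {L : List (Bool × ℕ)} {P : MvPolynomial ℕ ℂ} (hP : Represents L P)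
    (f : ℕ → ℕ) : Represents (relabel f L) (MvPolynomial.rename f P) := by
  intro z hz
  rw [MvPolynomial.eval_rename, relabel_relabel]
  refine hP _ ?_
  rwa [map_snd_relabel, List.map_map] at hz

theorem Represents.eval_congr {L : List (Bool × ℕ)} (hL : (L.map Prod.snd).Nodup)
    {P : MvPolynomial ℕ ℂ} (hP : Represents L P) {z z' : ℕ → ℂ}
    (h : relabel z L = relabel z' L) :
    MvPolynomial.eval z P = MvPolynomial.eval z' P := by
  rcases L with _ | ⟨⟨s, a⟩, L⟩
  · have h0 : Good [] := ⟨List.nodup_nil, by simp⟩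
    rw [hP z (by simpa using h0), hP z' (by simpa using h0), relabel_nil, relabel_nil]
  · classical
    set g : ℕ → ℕ := fun k => if k ∈ ((s, a) :: L).map Prod.snd then k else a with hg
    have h1 : relabel g ((s, a) :: L) = (s, a) :: L := by
      have : relabel g ((s, a) :: L) = relabel id ((s, a) :: L) :=
        relabel_congr fun x hx => by simp only [hg, if_pos hx, id]
      rw [this]
      simp [relabel]
    have h2 := hP.rename g
    rw [h1] at h2
    rw [hP.unique hL h2, MvPolynomial.eval_rename, MvPolynomial.eval_rename]
    congr 2
    funext k
    have hgk : g k ∈ ((s, a) :: L).map Prod.snd := by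
      simp only [hg]
      split_ifs with hk
      · exact hk
      · simp
    have h3 := congrArg (List.map Prod.snd) h
    rw [map_snd_relabel, map_snd_relabel] at h3
    exact List.map_inj_left.1 h3 _ hgk

theorem exists_label {α : Type*} [Inhabited α] (L : List (Bool × α)) :
    ∃ (L' : List (Bool × ℕ)) (z : ℕ → α), (L'.map Prod.snd).Nodup ∧ relabel z L' = L := by
  refine ⟨L.zipIdx.map fun p => (p.1.1, p.2), fun k => (L.map Prod.snd).getD k default, ?_, ?_⟩
  · rw [List.map_map]
    have : Prod.snd ∘ (fun p : (Bool × α) × ℕ => (p.1.1, p.2)) = Prod.snd := rfl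
    rw [this, List.zipIdx_map_snd]
    exact List.nodup_range'
  · apply List.ext_getElem
    · simp [relabel]
    · intro i h1 h2
      simp [relabel]
      rw [List.getElem?_eq_getElem h2]
      simp

theorem exists_relabel (M M' : List (Bool × ℕ)) (hM : (M.map Prod.snd).Nodup)
    (h : M.map Prod.fst = M'.map Prod.fst) : ∃ f, relabel f M = M' := by
  induction M generalizing M' with
  | nil =>
    have : M' = [] := List.map_eq_nil_iff.1 h.symm
    exact ⟨id, this.symm⟩
  | cons p M ih =>
    obtain ⟨s, k⟩ := p
    obtain ⟨⟨s', k'⟩, M', rfl, hk, hM'⟩ := List.map_eq_cons_iff.1 h.symm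
    have hn := List.nodup_cons.1 hM
    obtain ⟨f, rfl⟩ := ih M' hn.2 hM'.symm
    refine ⟨Function.update f k k', ?_⟩
    rw [relabel_cons, Function.update_self,
      relabel_congr (z := Function.update f k k') (z' := f) fun x hx =>
        Function.update_of_ne (ne_of_mem_of_not_mem hx hn.1) _ _]
    simp only at hk
    rw [hk]

theorem exists_Psi (L : List (Bool × ℂ)) : ∃ v : ℂ, ∀ (L' : List (Bool × ℕ)) (z : ℕ → ℂ)
    (P : MvPolynomial ℕ ℂ), (L'.map Prod.snd).Nodup → relabel z L' = L → Represents L' P →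
    MvPolynomial.eval z P = v := by
  obtain ⟨L0, z0, hn, hz⟩ := exists_label L
  obtain ⟨P0, hP0⟩ := exists_represents L0 hn
  refine ⟨MvPolynomial.eval z0 P0, fun L' z P hn' hzw hP => ?_⟩
  obtain ⟨f, rfl⟩ := exists_relabel L0 L' hn (by
    have := congrArg (List.map Prod.fst) (hzw.trans hz.symm)
    simpa [relabel, Function.comp_def] using this.symm)
  rw [hP.unique hn' (hP0.rename f), MvPolynomial.eval_rename]
  exact hP0.eval_congr hn (by rw [← relabel_relabel, hzw, hz])

/-- The components of the inhomogeneous ground state, at arbitrary parameters. -/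
def Psi (L : List (Bool × ℂ)) : ℂ := (exists_Psi L).choose

theorem Psi_relabel {L : List (Bool × ℕ)} (hL : (L.map Prod.snd).Nodup) {P : MvPolynomial ℕ ℂ}
    (hP : Represents L P) (z : ℕ → ℂ) : Psi (relabel z L) = MvPolynomial.eval z P :=
  ((exists_Psi _).choose_spec L z P hL rfl hP).symm

theorem Psi_of_good {L : List (Bool × ℂ)} (h : Good (L.map Prod.snd)) : Psi L = psi L := by
  obtain ⟨L', z, hn, rfl⟩ := exists_label L
  obtain ⟨P, hP⟩ := exists_represents L' hn
  rw [Psi_relabel hn hP, hP z]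
  rwa [map_snd_relabel] at h

theorem Psi_cyc (s : Bool) (x : ℂ) (L : List (Bool × ℂ))
    (hc : 2 * ((s, x) :: L).countP (·.1) = L.length) :
    Psi (L ++ [(s, x)]) = Psi ((s, x) :: L) := by
  obtain ⟨L', z, hn, he⟩ := exists_label ((s, x) :: L)
  obtain ⟨⟨s', k⟩, M, rfl, hk, hM⟩ := List.map_eq_cons_iff.1 he
  obtain ⟨rfl, rfl⟩ := Prod.mk.inj hk
  change relabel z M = L at hM
  subst hM
  have hn' : ((M ++ [(s', k)]).map Prod.snd).Nodup :=
    ((List.perm_append_singleton _ _).map _).nodup_iff.2 hn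
  obtain ⟨P, hP⟩ := exists_represents _ hn
  obtain ⟨Q, hQ⟩ := exists_represents _ hn'
  have : P = Q := poly_ext _ hn _ _ fun w hw => by
    rw [hP w hw, hQ w (hw.perm (((List.perm_append_singleton _ _).map _).map _).symm)]
    rw [relabel_append, relabel_cons, relabel_cons, relabel_nil, psi_cyc]
    · simpa [map_snd_relabel] using hw
    · simpa [relabel, List.countP_cons, List.countP_map, Function.comp_def] using hc
  have h1 := Psi_relabel hn hP z
  have h2 := Psi_relabel hn' hQ z
  rw [relabel_append, relabel_cons, relabel_nil] at h2
  exact h2.trans (by rw [← this, ← h1]; rfl)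

/-- A linear relation between components at generic parameters extends to all parameters. -/
theorem exchange_extend {s t s₁ t₁ s₂ t₂ : Bool} {a b c d e f : ℂ}
    (h : ∀ (A B : List (Bool × ℂ)) (x y : ℂ),
      Good ((A ++ (true, x) :: (true, y) :: B).map Prod.snd) →
      (a * x + b * y) * psi (A ++ (s, y) :: (t, x) :: B) =
        (c * x + d * y) * psi (A ++ (s₁, x) :: (t₁, y) :: B) +
        (e * x + f * y) * psi (A ++ (s₂, x) :: (t₂, y) :: B))
    (A B : List (Bool × ℂ)) (x y : ℂ) :
    (a * x + b * y) * Psi (A ++ (s, y) :: (t, x) :: B) =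
      (c * x + d * y) * Psi (A ++ (s₁, x) :: (t₁, y) :: B) +
      (e * x + f * y) * Psi (A ++ (s₂, x) :: (t₂, y) :: B) := by
  obtain ⟨L', z, hn, he⟩ := exists_label (A ++ (true, x) :: (true, y) :: B)
  obtain ⟨A, M, rfl, rfl, hM⟩ := List.map_eq_append_iff.1 he
  obtain ⟨⟨b₁, i⟩, M, rfl, hk, hM⟩ := List.map_eq_cons_iff.1 hM
  obtain ⟨⟨b₂, j⟩, B, rfl, hk', rfl⟩ := List.map_eq_cons_iff.1 hM
  obtain ⟨rfl, rfl⟩ := Prod.mk.inj hk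
  obtain ⟨rfl, rfl⟩ := Prod.mk.inj hk'
  have h1 : ((A ++ (s₁, i) :: (t₁, j) :: B).map Prod.snd).Nodup := by simpa using hn
  have h2 : ((A ++ (s₂, i) :: (t₂, j) :: B).map Prod.snd).Nodup := by simpa using hn
  have p0 : ((A ++ (s, j) :: (t, i) :: B).map Prod.snd).Perm
      ((A ++ (s₁, i) :: (t₁, j) :: B).map Prod.snd) := by
    simp only [List.map_append, List.map_cons]
    exact List.Perm.append_left _ (List.Perm.swap _ _ _)
  have h0 := p0.nodup_iff.2 h1
  obtain ⟨P0, hP0⟩ := exists_represents _ h0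
  obtain ⟨P1, hP1⟩ := exists_represents _ h1
  obtain ⟨P2, hP2⟩ := exists_represents _ h2
  have key : (MvPolynomial.C a * MvPolynomial.X i + MvPolynomial.C b * MvPolynomial.X j) * P0 =
      (MvPolynomial.C c * MvPolynomial.X i + MvPolynomial.C d * MvPolynomial.X j) * P1 +
      (MvPolynomial.C e * MvPolynomial.X i + MvPolynomial.C f * MvPolynomial.X j) * P2 := by
    refine poly_ext _ h1 _ _ fun w hw => ?_
    simp only [map_add, map_mul, MvPolynomial.eval_X, MvPolynomial.eval_C]
    rw [hP0 w (hw.perm (p0.map _).symm), hP1 w hw, hP2 w (by simpa using hw)]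
    simp only [relabel_append, relabel_cons]
    exact h _ _ _ _ (by simpa [map_snd_relabel] using hw)
  have k := congrArg (MvPolynomial.eval z) key
  simp only [map_add, map_mul, MvPolynomial.eval_X, MvPolynomial.eval_C] at k
  rw [← Psi_relabel h0 hP0, ← Psi_relabel h1 hP1, ← Psi_relabel h2 hP2] at k
  simp only [relabel_append, relabel_cons] at k
  exact k

theorem Psi_up_dn (A B : List (Bool × ℂ)) (x y : ℂ) :
    (y - ω * x) * Psi (A ++ (true, y) :: (false, x) :: B) =
      (1 - ω) * x * Psi (A ++ (true, x) :: (false, y) :: B) +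
      ω ^ 2 * (x - y) * Psi (A ++ (false, x) :: (true, y) :: B) := by
  have := exchange_extend (s := true) (t := false) (s₁ := true) (t₁ := false) (s₂ := false)
    (t₂ := true) (a := -ω) (b := 1) (c := 1 - ω) (d := 0) (e := ω ^ 2) (f := -ω ^ 2)
    (fun A B x y h => by linear_combination psi_up_dn A B x y h) A B x y
  linear_combination this

theorem Psi_dn_up (A B : List (Bool × ℂ)) (x y : ℂ) :
    (y - ω * x) * Psi (A ++ (false, y) :: (true, x) :: B) =
      ω ^ 2 * (x - y) * Psi (A ++ (true, x) :: (false, y) :: B) +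
      (1 - ω) * y * Psi (A ++ (false, x) :: (true, y) :: B) := by
  have := exchange_extend (s := false) (t := true) (s₁ := true) (t₁ := false) (s₂ := false)
    (t₂ := true) (a := -ω) (b := 1) (c := ω ^ 2) (d := -ω ^ 2) (e := 0) (f := 1 - ω)
    (fun A B x y h => by linear_combination psi_dn_up A B x y h) A B x y
  linear_combination this

theorem Psi_same (A B : List (Bool × ℂ)) (s : Bool) (x y : ℂ) :
    (y - ω * x) * Psi (A ++ (s, y) :: (s, x) :: B) =
      (x - ω * y) * Psi (A ++ (s, x) :: (s, y) :: B) := by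
  have := exchange_extend (s := s) (t := s) (s₁ := s) (t₁ := s) (s₂ := s)
    (t₂ := s) (a := -ω) (b := 1) (c := 1) (d := -ω) (e := 0) (f := 0)
    (fun A B x y h => by linear_combination psi_same A B s x y h) A B x y
  linear_combination this

theorem Psi_extreme (D U : List ℂ) :
    Psi (spins false D ++ spins true U) = pre D * pre U * (-ω ^ 2) ^ (D.length * U.length) := by
  obtain ⟨L', z, hn, he⟩ := exists_label (spins false D ++ spins true U)
  obtain ⟨A, B, rfl, hA, hB⟩ := List.map_eq_append_iff.1 he
  have key : ∀ (s : Bool) (D : List ℂ) (A : List (Bool × ℕ)),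
      A.map (Prod.map id z) = spins s D → ∃ E, A = spins s E ∧ E.map z = D := by
    intro s D A h
    refine ⟨A.map Prod.snd, ?_, ?_⟩
    · have h1 := congrArg (List.map Prod.fst) h
      simp only [spins, List.map_map, Function.comp_def, Prod.map_fst, id] at h1 ⊢
      have h2 : ∀ p ∈ A, p = (s, p.2) := by
        intro p hp
        have : p.1 ∈ A.map (fun x => x.1) := List.mem_map_of_mem hp
        rw [h1, List.mem_map] at this
        obtain ⟨_, _, h3⟩ := this
        exact Prod.ext h3.symm rfl
      conv_lhs => rw [← List.map_id A]
      exact List.map_congr_left h2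
    · have h1 := congrArg (List.map Prod.snd) h
      rw [map_snd_spins] at h1
      simpa [Function.comp_def] using h1
  obtain ⟨D, rfl, rfl⟩ := key _ _ _ hA
  obtain ⟨U, rfl, rfl⟩ := key _ _ _ hB
  obtain ⟨P, hP⟩ := exists_represents _ hn
  obtain ⟨P₁, hP₁⟩ := exists_pre_poly D
  obtain ⟨P₂, hP₂⟩ := exists_pre_poly U
  rw [← relabel_spins, ← relabel_spins, ← relabel_append, Psi_relabel hn hP, ← hP₁, ← hP₂]
  have : P = P₁ * P₂ * MvPolynomial.C ((-ω ^ 2) ^ (D.length * U.length)) := by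
    refine poly_ext _ hn _ _ fun w hw => ?_
    rw [hP w hw, map_mul, map_mul, hP₁, hP₂, MvPolynomial.eval_C, relabel_append, relabel_spins,
      relabel_spins, psi_extreme _ _ (by simpa [map_snd_spins] using hw), List.length_map,
      List.length_map]
  rw [this, map_mul, map_mul, MvPolynomial.eval_C, List.length_map, List.length_map]

theorem exists_poly_Psi_head (s : Bool) (L : List (Bool × ℂ)) :
    ∃ p : Polynomial ℂ, ∀ t, Psi ((s, t) :: L) = p.eval t := by
  obtain ⟨L', z, hn, he⟩ := exists_label ((s, 0) :: L)
  obtain ⟨⟨b, i⟩, M, rfl, hk, hM⟩ := List.map_eq_cons_iff.1 he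
  obtain ⟨rfl, -⟩ := Prod.mk.inj hk
  change relabel z M = L at hM
  obtain ⟨P, hP⟩ := exists_represents _ hn
  refine ⟨MvPolynomial.aeval (fun k => if k = i then Polynomial.X else Polynomial.C (z k)) P,
    fun t => ?_⟩
  have h1 := Psi_relabel hn hP (Function.update z i t)
  rw [relabel_cons, Function.update_self, relabel_congr (z' := z) fun x hx =>
    Function.update_of_ne (ne_of_mem_of_not_mem hx (List.nodup_cons.1 hn).1) _ _, hM] at h1
  refine h1.trans ?_
  have : MvPolynomial.eval (Function.update z i t) = (Polynomial.evalRingHom t).comp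
      (MvPolynomial.aeval (R := ℂ) fun k =>
        if k = i then Polynomial.X else Polynomial.C (z k)).toRingHom := by
    refine MvPolynomial.ringHom_ext (fun r => ?_) fun k => ?_
    · simp
    · by_cases hk : k = i <;> simp [hk]
  rw [this]
  rfl

theorem continuous_Psi {X : Type*} [TopologicalSpace X] (L : List (Bool × (X → ℂ)))
    (h : ∀ f ∈ L.map Prod.snd, Continuous f) :
    Continuous fun t => Psi (relabel (fun f => f t) L) := by
  classical
  obtain ⟨L', z, hn, rfl⟩ := exists_label L
  obtain ⟨P, hP⟩ := exists_represents _ hn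
  set w : ℕ → X → ℂ := fun k => if k ∈ L'.map Prod.snd then z k else 0 with hw
  have hwz : relabel w L' = relabel z L' := relabel_congr fun k hk => if_pos hk
  simp only [← hwz, relabel_relabel, Psi_relabel hn hP]
  refine (MvPolynomial.continuous_eval P).comp (continuous_pi fun k => ?_)
  by_cases hk : k ∈ L'.map Prod.snd
  · have : Continuous (z k) := h _ (by rw [map_snd_relabel]; exact List.mem_map_of_mem hk)
    change Continuous (w k)
    rwa [show w k = z k from if_pos hk]
  · change Continuous (w k)
    rw [show w k = 0 from if_neg hk]
    exact continuous_const

/-- The word `a` with all parameters equal to one. -/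
def ones (a : List Bool) : List (Bool × ℂ) := a.map fun s => (s, 1)

theorem ones_cons (s : Bool) (a : List Bool) : ones (s :: a) = (s, 1) :: ones a := rfl

theorem ones_append (a b : List Bool) : ones (a ++ b) = ones a ++ ones b := List.map_append

theorem countP_ones (a : List Bool) : (ones a).countP (·.1) = a.count true := by
  simp [ones, List.countP_map, List.count, Function.comp_def]

/-- The homogeneous ground state. -/
def phi (a : List Bool) : ℂ := Psi (ones a)

/-- The derivative of a component with respect to the first parameter. -/
def phiDeriv : List Bool → ℂ
  | [] => 0
  | s :: a => deriv (fun t => Psi ((s, t) :: ones a)) 1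

theorem phi_rotate_one (a : List Bool) (h : 2 * a.count true + 1 = a.length) :
    phi (a.rotate 1) = phi a := by
  cases a with
  | nil => rfl
  | cons s a =>
    rw [List.rotate_cons_succ, List.rotate_zero, phi, phi, ones_append]
    refine Psi_cyc s 1 (ones a) ?_
    rw [← ones_cons, countP_ones]
    simp only [List.length_cons] at h
    simp [ones]; omega

/-- The action on the first bond of the local Hamiltonian density shifted by `3/4`. -/
def bond (v : List Bool → ℂ) : List Bool → ℂ
  | s :: t :: a => if s = t then v (s :: t :: a) else v (s :: t :: a) / 2 - v (t :: s :: a)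
  | _ => 0

/-- One if the word starts with `true`, and zero otherwise. -/
def headUp : List Bool → ℂ
  | true :: _ => 1
  | _ => 0

theorem phiDeriv_rotate (s t : Bool) (a : List Bool)
    (h : 2 * (s :: t :: a).count true + 1 = (s :: t :: a).length) :
    (1 - ω) * (phiDeriv ((s :: t :: a).rotate 1) - phiDeriv (s :: t :: a)) =
      -ω ^ 2 * bond phi (s :: t :: a) + (1 - ω) / 2 *
        (headUp (s :: t :: a) - headUp ((s :: t :: a).rotate 1)) * phi (s :: t :: a) := by
  have hfun : ∀ x, Psi ((t, x) :: ones (a ++ [s])) = Psi ((s, 1) :: (t, x) :: ones a) := by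
    intro x
    rw [ones_append]
    refine Psi_cyc s 1 ((t, x) :: ones a) ?_
    have := countP_ones a
    simp only [List.count_cons, List.length_cons] at h
    simp only [List.countP_cons, List.length_cons, this]
    simp [ones] at h ⊢
    omega
  have hrot : phiDeriv ((s :: t :: a).rotate 1) =
      deriv (fun x => Psi ((s, 1) :: (t, x) :: ones a)) 1 := by
    rw [List.rotate_cons_succ, List.rotate_zero, List.cons_append, phiDeriv]
    simp only [hfun]
  have hdiff : ∀ (s : Bool) (L : List (Bool × ℂ)),
      Differentiable ℂ (fun x => Psi ((s, x) :: L)) := by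
    intro s L
    obtain ⟨p, hp⟩ := exists_poly_Psi_head s L
    simp only [hp]
    exact p.differentiable
  have hdiff2 : DifferentiableAt ℂ (fun x => Psi ((s, 1) :: (t, x) :: ones a)) 1 := by
    have := (hdiff t (ones (a ++ [s]))).differentiableAt (x := 1)
    simpa only [hfun] using this
  rw [hrot, phiDeriv]
  set r := fun x => Psi ((s, 1) :: (t, x) :: ones a) with hr
  set p := fun x => Psi ((s, x) :: ones (t :: a)) with hp
  have hp1 := (hdiff s (ones (t :: a))).differentiableAt (x := 1)
  rw [← hp] at hp1
  have hL : HasDerivAt (fun x => (1 - ω * x) * r x) (-ω * r 1 + (1 - ω) * deriv r 1) 1 := by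
    have h1 := (((hasDerivAt_id (1 : ℂ)).const_mul ω).const_sub 1).mul hdiff2.hasDerivAt
    refine h1.congr_deriv ?_
    simp
  by_cases hst : s = t
  · subst hst
    have hR : HasDerivAt (fun x => (x - ω) * p x) (p 1 + (1 - ω) * deriv p 1) 1 := by
      have h1 := ((hasDerivAt_id (1 : ℂ)).sub_const ω).mul hp1.hasDerivAt
      refine h1.congr_deriv ?_
      simp
    have he : (fun x => (1 - ω * x) * r x) = fun x => (x - ω) * p x := by
      funext x
      have := Psi_same [] (ones a) s x 1
      simpa [hr, hp, ones_cons] using this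
    rw [he] at hL
    have h2 := hL.unique hR
    have h3 : r 1 = phi (s :: s :: a) := rfl
    have h4 : p 1 = phi (s :: s :: a) := rfl
    rw [h3, h4] at h2
    have h5 : headUp (s :: s :: a) = headUp ((s :: s :: a).rotate 1) := by
      cases s <;> rfl
    rw [h5, bond, if_pos rfl]
    linear_combination h2 + phi (s :: s :: a) * ω_rel
  · set p' := fun x => Psi ((t, x) :: ones (s :: a)) with hp'
    have hp1' := (hdiff t (ones (s :: a))).differentiableAt (x := 1)
    rw [← hp'] at hp1'
    have h3 : r 1 = phi (s :: t :: a) := rfl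
    have h4 : p 1 = phi (s :: t :: a) := rfl
    have h5 : p' 1 = phi (t :: s :: a) := rfl
    rw [bond, if_neg hst, ← h3, ← h5]
    cases s <;> cases t
    · exact absurd rfl hst
    · have hR : HasDerivAt (fun x => ω ^ 2 * (x - 1) * p' x + (1 - ω) * p x)
          (ω ^ 2 * p' 1 + (1 - ω) * deriv p 1) 1 := by
        have h1 := ((((hasDerivAt_id (1 : ℂ)).sub_const 1).const_mul (ω ^ 2)).mul
          hp1'.hasDerivAt).add (hp1.hasDerivAt.const_mul (1 - ω))
        refine h1.congr_deriv ?_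
        simp
      have he : (fun x => (1 - ω * x) * r x) =
          fun x => ω ^ 2 * (x - 1) * p' x + (1 - ω) * p x := by
        funext x
        have := Psi_dn_up [] (ones a) x 1
        simpa [hr, hp, hp', ones_cons] using this
      rw [he] at hL
      have h2 := hL.unique hR
      rw [List.rotate_cons_succ, List.rotate_zero, List.cons_append, headUp, headUp]
      · linear_combination h2 + r 1 / 2 * ω_rel
      · simp
    · have hR : HasDerivAt (fun x => (1 - ω) * x * p x + ω ^ 2 * (x - 1) * p' x)
          ((1 - ω) * p 1 + (1 - ω) * deriv p 1 + ω ^ 2 * p' 1) 1 := by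
        have h1 := (((hasDerivAt_id (1 : ℂ)).const_mul (1 - ω)).mul hp1.hasDerivAt).add
          ((((hasDerivAt_id (1 : ℂ)).sub_const 1).const_mul (ω ^ 2)).mul hp1'.hasDerivAt)
        refine h1.congr_deriv ?_
        simp
      have he : (fun x => (1 - ω * x) * r x) =
          fun x => (1 - ω) * x * p x + ω ^ 2 * (x - 1) * p' x := by
        funext x
        have := Psi_up_dn [] (ones a) x 1
        simpa [hr, hp, hp', ones_cons] using this
      rw [he] at hL
      have h2 := hL.unique hR
      rw [List.rotate_cons_succ, List.rotate_zero, List.cons_append, headUp, headUp]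
      · linear_combination h2 + r 1 / 2 * ω_rel + (1 - ω) * (h4.trans h3.symm)
      · simp
    · exact absurd rfl hst

theorem sum_bond_phi (n : ℕ) (hn : 1 ≤ n) (a : List Bool) (hl : a.length = 2 * n + 1)
    (hc : a.count true = n) : ∑ k ∈ Finset.range (2 * n + 1), bond phi (a.rotate k) = 0 := by
  have hphi : ∀ k, phi (a.rotate k) = phi a := by
    intro k
    induction k with
    | zero => rw [List.rotate_zero]
    | succ k ih =>
      rw [← List.rotate_rotate, phi_rotate_one, ih]
      rw [(List.rotate_perm a k).count_eq, List.length_rotate]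
      omega
  have key : ∀ k, -ω ^ 2 * bond phi (a.rotate k) =
      (1 - ω) * (phiDeriv (a.rotate (k + 1)) - phiDeriv (a.rotate k)) -
      (1 - ω) / 2 * phi a * (headUp (a.rotate k) - headUp (a.rotate (k + 1))) := by
    intro k
    have h1 : (a.rotate k).length = 2 * n + 1 := by rw [List.length_rotate, hl]
    have h2 : (a.rotate k).count true = n := by rw [(List.rotate_perm a k).count_eq, hc]
    have h3 := hphi k
    rw [← List.rotate_rotate]
    generalize a.rotate k = b at *
    obtain _ | ⟨s, _ | ⟨t, b⟩⟩ := b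
    · simp at h1
    · simp at h1; omega
    · have := phiDeriv_rotate s t b (by omega)
      rw [h3] at this
      linear_combination -this
  have hs := Finset.sum_congr (rfl : Finset.range (2 * n + 1) = _) fun k _ => key k
  rw [← Finset.mul_sum, Finset.sum_sub_distrib, ← Finset.mul_sum, ← Finset.mul_sum,
    Finset.sum_range_sub (fun k => phiDeriv (a.rotate k)),
    Finset.sum_range_sub' (fun k => headUp (a.rotate k)), ← hl, List.rotate_length,
    List.rotate_zero, sub_self, sub_self, mul_zero, mul_zero, sub_zero] at hs
  rw [← hl]
  exact (mul_eq_zero.1 hs).resolve_left (neg_ne_zero.2 (pow_ne_zero 2 ω_ne_zero))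

theorem pre_replicate_mul (n : ℕ) :
    pre (List.replicate (n + 1) 1) * pre (List.replicate n 1) = (1 - ω) ^ (n ^ 2) := by
  have h : ∀ m, pre (List.replicate (m + 1) 1) = (1 - ω) ^ m * pre (List.replicate m 1) := by
    intro m
    rw [List.replicate_succ, pre, List.map_replicate, List.prod_replicate, mul_one]
  induction n with
  | zero => simp [pre]
  | succ n ih =>
    rw [show (n + 1) ^ 2 = n ^ 2 + n + (n + 1) by ring, pow_add, pow_add, ← ih, h (n + 1), h n]
    ring

theorem phi_extreme (n : ℕ) :
    phi (List.replicate (n + 1) false ++ List.replicate n true) =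
      (1 - ω) ^ (n ^ 2) * ω ^ (2 * n * (n + 1)) := by
  have h := Psi_extreme (List.replicate (n + 1) 1) (List.replicate n 1)
  rw [pre_replicate_mul, List.length_replicate, List.length_replicate, neg_pow,
    Even.neg_one_pow (by rw [mul_comm]; exact Nat.even_mul_succ_self n), one_mul, ← pow_mul,
    mul_comm (n + 1) n, ← mul_assoc] at h
  rw [← h]
  simp [phi, ones, spins]

/-- Sum over all spin assignments to the sites in a list. -/
def sumB {α : Type*} : List α → (List (Bool × α) → ℂ) → ℂ
  | [], f => f []
  | x :: Z, f => sumB Z (fun L => f ((true, x) :: L)) + sumB Z (fun L => f ((false, x) :: L))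

theorem sumB_append {α : Type*} (Z Z' : List α) (f : List (Bool × α) → ℂ) :
    sumB (Z ++ Z') f = sumB Z fun L => sumB Z' fun M => f (L ++ M) := by
  induction Z generalizing f with
  | nil => rfl
  | cons x Z ih => simp only [List.cons_append, sumB, ih]

theorem sumB_congr {α : Type*} {Z : List α} {f g : List (Bool × α) → ℂ}
    (h : ∀ L, L.map Prod.snd = Z → f L = g L) : sumB Z f = sumB Z g := by
  induction Z generalizing f g with
  | nil => exact h [] rfl
  | cons x Z ih =>
    rw [sumB, sumB, ih fun L hL => h _ (by simp [hL]), ih fun L hL => h _ (by simp [hL])]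

theorem sumB_add {α : Type*} (Z : List α) (f g : List (Bool × α) → ℂ) :
    sumB Z (fun L => f L + g L) = sumB Z f + sumB Z g := by
  induction Z generalizing f g with
  | nil => rfl
  | cons x Z ih => simp only [sumB, ih]; ring

theorem sumB_const_mul {α : Type*} (Z : List α) (c : ℂ) (f : List (Bool × α) → ℂ) :
    sumB Z (fun L => c * f L) = c * sumB Z f := by
  induction Z generalizing f with
  | nil => rfl
  | cons x Z ih => simp only [sumB, ih]; ring

theorem sumB_zero {α : Type*} (Z : List α) : sumB Z (fun _ => 0) = 0 := by
  induction Z with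
  | nil => rfl
  | cons x Z ih => simp only [sumB, ih, add_zero]

theorem sumB_sum {α ι : Type*} (Z : List α) (s : Finset ι) (f : ι → List (Bool × α) → ℂ) :
    sumB Z (fun L => ∑ i ∈ s, f i L) = ∑ i ∈ s, sumB Z (f i) := by
  classical
  induction s using Finset.induction_on with
  | empty => simp [sumB_zero]
  | insert a s ha ih => simp only [Finset.sum_insert ha, sumB_add, ih]

/-- The product of the parameters of the up spins. -/
def upProd (L : List (Bool × ℂ)) : ℂ := (L.map fun p => if p.1 then p.2 else 1).prod

theorem upProd_append (A B : List (Bool × ℂ)) : upProd (A ++ B) = upProd A * upProd B := by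
  simp [upProd]

theorem upProd_cons (s : Bool) (x : ℂ) (B : List (Bool × ℂ)) :
    upProd ((s, x) :: B) = (if s then x else 1) * upProd B := by
  simp [upProd]

/-- The scalar product of two off-shell Bethe vectors. -/
def betheInner (Z : List ℂ) (W W' : Finset ℂ) : ℂ :=
  sumB Z fun L => bethe L W * bethe L.reverse W' * upProd L

theorem betheInner_swap (A B : List ℂ) (x y : ℂ) (W W' : Finset ℂ)
    (h : Good (A ++ x :: y :: B))
    (hW : W ⊆ (A ++ x :: y :: B).toFinset) (hW' : W' ⊆ (A ++ x :: y :: B).toFinset) :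
    betheInner (A ++ y :: x :: B) W W' = betheInner (A ++ x :: y :: B) W W' := by
  have g : ∀ V ⊆ (A ++ x :: y :: B).toFinset, ∀ w ∈ V, w ≠ ω * x ∧ w ≠ ω * y := by
    intro V hV w hw
    have := List.mem_toFinset.1 (hV hw)
    exact ⟨h.2 w this x (by simp), h.2 w this y (by simp)⟩
  have h1 : x - ω * y ≠ 0 := sub_ne_zero.2 (h.2 x (by simp) y (by simp))
  have h2 : y - ω * x ≠ 0 := sub_ne_zero.2 (h.2 y (by simp) x (by simp))
  unfold betheInner
  rw [sumB_append, sumB_append]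
  refine sumB_congr fun L _ => ?_
  simp only [sumB, ← sumB_add]
  refine sumB_congr fun M _ => ?_
  simp only [List.reverse_append, List.reverse_cons, List.append_assoc, List.cons_append,
    List.nil_append, upProd_append, upProd_cons, if_true, Bool.false_eq_true,
    if_false]
  have gW := g W hW
  have gW' : ∀ w ∈ W', w ≠ ω * y ∧ w ≠ ω * x := fun w hw => (g W' hW' w hw).symm
  rw [bethe_exchange_up_up L M x y W gW, bethe_exchange_dn_dn L M x y W,
    bethe_exchange_up_up M.reverse L.reverse y x W' gW',
    bethe_exchange_dn_dn M.reverse L.reverse y x W']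
  have e1 := bethe_exchange_up_dn L M x y W gW
  have e2 := bethe_exchange_dn_up L M x y W gW
  have f1 := bethe_exchange_up_dn M.reverse L.reverse y x W' gW'
  have f2 := bethe_exchange_dn_up M.reverse L.reverse y x W' gW'
  generalize bethe (L ++ (true, y) :: (false, x) :: M) W = a' at *
  generalize bethe (L ++ (false, y) :: (true, x) :: M) W = b' at *
  generalize bethe (L ++ (true, x) :: (false, y) :: M) W = a at *
  generalize bethe (L ++ (false, x) :: (true, y) :: M) W = b at *
  generalize bethe (M.reverse ++ (true, x) :: (false, y) :: L.reverse) W' = c' at *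
  generalize bethe (M.reverse ++ (false, x) :: (true, y) :: L.reverse) W' = d' at *
  generalize bethe (M.reverse ++ (true, y) :: (false, x) :: L.reverse) W' = c at *
  generalize bethe (M.reverse ++ (false, y) :: (true, x) :: L.reverse) W' = d at *
  have key : a' * d' * y + b' * c' * x = a * d * x + b * c * y := by
    apply mul_left_cancel₀ h1
    apply mul_left_cancel₀ h2
    have t1 : (x - ω * y) * a' * ((y - ω * x) * d') = ((1 - ω) * x * a + ω ^ 2 * (x - y) * b) *
      (ω ^ 2 * (y - x) * c + (1 - ω) * x * d) := by rw [e1, f2]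
    have t2 : (x - ω * y) * b' * ((y - ω * x) * c') = (ω ^ 2 * (x - y) * a + (1 - ω) * y * b) *
      ((1 - ω) * y * c + ω ^ 2 * (y - x) * d) := by rw [e2, f1]
    linear_combination y * t1 + x * t2 -
      (ω * x * (x - y) ^ 2 * a * d + ω * y * (x - y) ^ 2 * b * c) * ω_cube
  linear_combination upProd L * upProd M * key

theorem betheInner_perm {Z Z' : List ℂ} (p : Z.Perm Z') (h : Good Z) (W W' : Finset ℂ)
    (hW : W ⊆ Z.toFinset) (hW' : W' ⊆ Z.toFinset) :
    betheInner Z W W' = betheInner Z' W W' := by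
  suffices H : ∀ A : List ℂ, Good (A ++ Z) → W ⊆ (A ++ Z).toFinset → W' ⊆ (A ++ Z).toFinset →
      betheInner (A ++ Z) W W' = betheInner (A ++ Z') W W' from H [] h hW hW'
  clear h hW hW'
  induction p with
  | nil => intros; rfl
  | @cons x Z Z' p ih =>
    intro A h hW hW'
    rw [List.append_cons] at h hW hW' ⊢
    rw [ih (A ++ [x]) h hW hW', ← List.append_cons]
  | swap x y Z =>
    intro A h hW hW'
    exact (betheInner_swap A Z y x W W' h hW hW').symm
  | @trans Z₁ Z₂ Z₃ p q ih1 ih2 =>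
    intro A h hW hW'
    have hp := List.Perm.append_left A p
    rw [ih1 A h hW hW', ih2 A (h.perm hp) (by rwa [← List.toFinset_eq_of_perm _ _ hp])
      (by rwa [← List.toFinset_eq_of_perm _ _ hp])]

theorem bethe_append_up_eq_zero (L : List (Bool × ℂ)) (y : ℂ) (W : Finset ℂ)
    (hW : ∀ w ∈ W, w ∈ L.map Prod.snd) : bethe (L ++ [(true, y)]) W = 0 := by
  rw [bethe_append_up]
  refine Finset.sum_eq_zero fun m hm => ?_
  obtain ⟨p, hp, hpm⟩ := List.mem_map.1 (hW m hm)
  rw [List.prod_eq_zero (l := L.map fun p => bt m p.2), mul_zero, zero_mul, zero_mul]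
  exact List.mem_map.2 ⟨p, hp, by rw [hpm, bt_self]⟩

theorem betheInner_cons_mem {Z : List ℂ} {y : ℂ} {W : Finset ℂ} (hy : y ∈ W)
    (W' : Finset ℂ) :
    betheInner (y :: Z) W W' =
      y * sumB Z fun L => bethe ((true, y) :: L) W * bethe (L.reverse ++ [(true, y)]) W' * upProd L := by
  rw [betheInner, sumB, ← sumB_const_mul, ← sumB_add]
  refine sumB_congr fun L _ => ?_
  rw [bethe_dn, Finset.prod_eq_zero (f := fun w => bt w y) hy (bt_self y), List.reverse_cons, upProd_cons, if_pos rfl]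
  ring

theorem betheInner_eq_zero {Z : List ℂ} {W W' : Finset ℂ} (h : Good Z) (hW : W ⊆ Z.toFinset)
    (hW' : W' ⊆ Z.toFinset) {y : ℂ} (hy : y ∈ W) (hy' : y ∉ W') : betheInner Z W W' = 0 := by
  have p := List.perm_cons_erase (List.mem_toFinset.1 (hW hy))
  have hs := List.toFinset_eq_of_perm _ _ p
  rw [betheInner_perm p h W W' hW hW', betheInner_cons_mem hy,
    sumB_congr (g := fun _ => 0), sumB_zero, mul_zero]
  intro L hL
  rw [bethe_append_up_eq_zero, mul_zero, zero_mul]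
  intro w hw
  have h2 := hW' hw
  rw [hs, List.mem_toFinset, List.mem_cons] at h2
  rw [List.map_reverse, List.mem_reverse, hL]
  exact h2.resolve_left (ne_of_mem_of_not_mem hw hy')

theorem betheInner_self {Z : List ℂ} {W : Finset ℂ} (h : Good Z) (hW : W ⊆ Z.toFinset) :
    betheInner Z W W = ∏ w ∈ W, (w * ∏ x ∈ Z.toFinset \ W, bt w x) := by
  induction hn : Z.length generalizing Z W with
  | zero =>
    obtain rfl := List.length_eq_zero_iff.1 hn
    obtain rfl : W = ∅ := by simpa using hW
    simp [betheInner, sumB, bethe_nil, upProd]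
  | succ n ih =>
    rcases W.eq_empty_or_nonempty with rfl | ⟨y, hy⟩
    · obtain _ | ⟨x, Z⟩ := Z
      · simp at hn
      rw [Finset.prod_empty, betheInner, sumB, sumB_congr (g := fun _ => 0), sumB_zero, zero_add]
      · have := ih h.of_cons (W := ∅) (by simp) (by simpa using hn)
        rw [Finset.prod_empty] at this
        rw [← this]
        refine sumB_congr fun L _ => ?_
        rw [bethe_dn, Finset.prod_empty, List.reverse_cons, bethe_append_dn, upProd_cons, one_mul]
        simp
      · intro L _
        rw [bethe_up, Finset.sum_empty, zero_mul, zero_mul]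
    · have hyZ := List.mem_toFinset.1 (hW hy)
      have p := List.perm_cons_erase hyZ
      have hs := List.toFinset_eq_of_perm _ _ p
      have hg := h.perm p
      rw [betheInner_perm p h W W hW hW, betheInner_cons_mem hy, hs]
      rw [hs] at hW
      have hlen : (Z.erase y).length = n := by rw [List.length_erase_of_mem hyZ, hn]; rfl
      generalize Z.erase y = Y at *
      have hyY : y ∉ Y.toFinset := by simpa using (List.nodup_cons.1 hg.1).1
      have hWY : W.erase y ⊆ Y.toFinset := by
        rw [List.toFinset_cons, Finset.subset_insert_iff] at hW
        exact hW
      have hmem : ∀ j ∈ W, j ∈ y :: Y := fun j hj => List.mem_toFinset.1 (hW hj)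
      have hsplit : Y.toFinset \ W.erase y = (y :: Y).toFinset \ W := by
        ext a
        simp only [Finset.mem_sdiff, List.mem_toFinset, Finset.mem_erase, List.mem_cons]
        constructor
        · rintro ⟨h1, h2⟩
          exact ⟨Or.inr h1, fun h3 => h2 ⟨fun e => hyY (by rw [← e]; simpa using h1), h3⟩⟩
        · rintro ⟨h1, h2⟩
          exact ⟨h1.resolve_left fun e => h2 (e ▸ hy), fun h3 => h2 h3.2⟩
      have hup : ∀ L, bethe ((true, y) :: L) W = bethe L (W.erase y) := by
        intro L
        rw [bethe_up, Finset.sum_eq_single y]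
        · rw [gm_self (hg.ne_zero (by simp)), Finset.prod_congr rfl (g := fun _ => (1 : ℂ))]
          · simp
          · intro j hj
            have hj' := Finset.mem_erase.1 hj
            exact bt_mul_al (hg.2 j (hmem j hj'.2) y (by simp)) hj'.1
        · intro k hk hky
          rw [Finset.prod_eq_zero (Finset.mem_erase.2 ⟨hky.symm, hy⟩), mul_zero, zero_mul]
          rw [bt_self, zero_mul]
        · exact fun h' => absurd hy h'
      have hdn : ∀ L : List (Bool × ℂ), L.map Prod.snd = Y →
          bethe (L.reverse ++ [(true, y)]) W =
            (∏ x ∈ (y :: Y).toFinset \ W, bt y x) * bethe L.reverse (W.erase y) := by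
        intro L hL
        rw [bethe_append_up, Finset.sum_eq_single y]
        · have h1 : (L.reverse.map fun p => bt y p.2).prod = ∏ x ∈ Y.toFinset, bt y x := by
            rw [List.prod_toFinset _ (hg.of_cons).1, ← hL, List.map_map, List.map_reverse,
              List.prod_reverse]
            rfl
          rw [h1, gm_self (hg.ne_zero (by simp)), one_mul,
            ← Finset.prod_sdiff hWY, hsplit]
          have hone : ∏ j ∈ W.erase y, bt y j * al y j = 1 := by
            refine Finset.prod_eq_one fun j hj => ?_
            have hj' := Finset.mem_erase.1 hj
            exact bt_mul_al (hg.2 y (by simp) j (hmem j hj'.2)) hj'.1.symm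
          congr 1
          rw [mul_assoc, ← Finset.prod_mul_distrib, hone, mul_one]
        · intro m hm hmy
          have : m ∈ L.reverse.map Prod.snd := by
            rw [List.map_reverse, List.mem_reverse, hL]
            exact (List.mem_cons.1 (hmem m hm)).resolve_left hmy
          obtain ⟨q, hq, hqm⟩ := List.mem_map.1 this
          rw [List.prod_eq_zero (l := L.reverse.map fun p => bt m p.2), mul_zero, zero_mul, zero_mul]
          exact List.mem_map.2 ⟨q, hq, by rw [hqm, bt_self]⟩
        · exact fun h' => absurd hy h'
      rw [← Finset.mul_prod_erase W _ hy, mul_assoc]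
      congr 1
      rw [sumB_congr (g := fun L => (∏ x ∈ (y :: Y).toFinset \ W, bt y x) *
        (bethe L (W.erase y) * bethe L.reverse (W.erase y) * upProd L))]
      · rw [sumB_const_mul, ← betheInner, ih hg.of_cons hWY hlen, hsplit]
      · intro L hL
        rw [hup, hdn L hL]
        ring

theorem psiRat_eq_sum_powersetCard (L : List (Bool × ℂ)) :
    psiRat L = ∑ W ∈ (supp L).powersetCard (L.countP (·.1)), cf (supp L) W * bethe L W := by
  rw [psiRat, Finset.powersetCard_eq_filter, Finset.sum_filter]
  refine Finset.sum_congr rfl fun W _ => ?_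
  split_ifs with h
  · rfl
  · rw [bethe_eq_zero_of_card L W h, mul_zero]

/-- The inhomogeneous norm in the sector with `n` up spins. -/
def normSum (n : ℕ) (Z : List ℂ) : ℂ :=
  sumB Z fun L => if L.countP (·.1) = n then Psi L * Psi L.reverse * upProd L else 0

theorem normSum_eq (n : ℕ) {Z : List ℂ} (h : Good Z) :
    normSum n Z = pre Z * pre Z.reverse * ∑ W ∈ Z.toFinset.powersetCard n,
      cf Z.toFinset W ^ 2 * ∏ w ∈ W, (w * ∏ x ∈ Z.toFinset \ W, bt w x) := by
  have hps : ∀ {W}, W ∈ Z.toFinset.powersetCard n → W ⊆ Z.toFinset ∧ W.card = n :=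
    fun hW => Finset.mem_powersetCard.1 hW
  have h1 : normSum n Z = sumB Z fun L => pre Z * pre Z.reverse *
      ∑ W ∈ Z.toFinset.powersetCard n, ∑ W' ∈ Z.toFinset.powersetCard n,
        cf Z.toFinset W * cf Z.toFinset W' * (bethe L W * bethe L.reverse W' * upProd L) := by
    refine sumB_congr fun L hL => ?_
    have hr : L.reverse.map Prod.snd = Z.reverse := by rw [List.map_reverse, hL]
    have hs1 : supp L = Z.toFinset := by rw [supp, hL]
    have hs2 : supp L.reverse = Z.toFinset := by
      rw [supp, hr, List.toFinset_reverse]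
    split_ifs with hc
    · rw [Psi_of_good (hL ▸ h), Psi_of_good (hr ▸ h.perm (List.reverse_perm _).symm), psi, psi, hL,
        hr, psiRat_eq_sum_powersetCard, psiRat_eq_sum_powersetCard, hs1, hs2, List.countP_reverse,
        hc]
      have : ∀ a b c d e : ℂ, a * c * (b * d) * e = a * b * (c * d * e) := fun _ _ _ _ _ => by ring
      rw [this, Finset.sum_mul_sum, Finset.sum_mul]
      congr 1
      refine Finset.sum_congr rfl fun W _ => ?_
      rw [Finset.sum_mul]
      refine Finset.sum_congr rfl fun W' _ => ?_
      ring
    · rw [Finset.sum_eq_zero, mul_zero]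
      intro W hW
      refine Finset.sum_eq_zero fun W' _ => ?_
      rw [bethe_eq_zero_of_card L W (by rw [(hps hW).2]; exact Ne.symm hc)]
      ring
  rw [h1, sumB_const_mul, sumB_sum]
  congr 1
  refine Finset.sum_congr rfl fun W hW => ?_
  rw [sumB_sum, Finset.sum_eq_single W]
  · rw [sumB_const_mul, ← betheInner, betheInner_self h (hps hW).1, sq]
  · intro W' hW' hne
    rw [sumB_const_mul, ← betheInner]
    have hns : ¬ W ⊆ W' := fun hs => hne (Finset.eq_of_subset_of_card_le hs
      (by rw [(hps hW).2, (hps hW').2])).symm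
    obtain ⟨y, hy, hy'⟩ := Finset.not_subset.1 hns
    rw [betheInner_eq_zero h (hps hW).1 (hps hW').1 hy hy', mul_zero]
  · exact fun hmem => absurd hW hmem

/-! ### The norm as a symmetric polynomial -/

def pairW (x y : ℂ) : ℂ := (x - y) * (x - ω * y)

def disc (S : Finset ℂ) : ℂ := ∏ x ∈ S, ∏ y ∈ S.erase x, pairW x y

theorem prod_prod_erase_insert (g : ℂ → ℂ → ℂ) {t : ℂ} {S : Finset ℂ} (h : t ∉ S) :
    ∏ x ∈ insert t S, ∏ y ∈ (insert t S).erase x, g x y =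
      (∏ x ∈ S, ∏ y ∈ S.erase x, g x y) * ∏ y ∈ S, g t y * g y t := by
  have h1 : ∏ x ∈ S, ∏ y ∈ (insert t S).erase x, g x y =
      ∏ x ∈ S, (g x t * ∏ y ∈ S.erase x, g x y) := by
    refine Finset.prod_congr rfl fun x hx => ?_
    have hxt : t ≠ x := fun e => h (e ▸ hx)
    rw [Finset.erase_insert_of_ne hxt, Finset.prod_insert fun h' => h (Finset.mem_of_mem_erase h')]
  rw [Finset.prod_insert h, Finset.erase_insert h, h1, Finset.prod_mul_distrib,
    Finset.prod_mul_distrib]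
  ring

theorem disc_insert {t : ℂ} {S : Finset ℂ} (h : t ∉ S) :
    disc (insert t S) = disc S * ∏ y ∈ S, pairW t y * pairW y t :=
  prod_prod_erase_insert pairW h

def splitTerm (Y W : Finset ℂ) : ℂ :=
  disc W * disc (Y \ W) * ∏ w ∈ W, (w * ∏ x ∈ Y \ W, pairW x w)

def splitSum (n : ℕ) (Y : Finset ℂ) : ℂ := ∑ W ∈ Y.powersetCard n, splitTerm Y W

theorem splitTerm_insert_dn {t : ℂ} {Y W : Finset ℂ} (h : t ∉ Y) (hW : W ⊆ Y) :
    splitTerm (insert t Y) W = splitTerm Y W *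
      ((∏ x ∈ Y \ W, pairW t x * pairW x t) * ∏ w ∈ W, pairW t w) := by
  have htW : t ∉ W := fun h' => h (hW h')
  have h1 : ∏ w ∈ W, (w * ∏ x ∈ insert t (Y \ W), pairW x w) =
      (∏ w ∈ W, pairW t w) * ∏ w ∈ W, (w * ∏ x ∈ Y \ W, pairW x w) := by
    rw [← Finset.prod_mul_distrib]
    refine Finset.prod_congr rfl fun w _ => ?_
    rw [Finset.prod_insert (fun h' => h (Finset.sdiff_subset h'))]
    ring
  rw [splitTerm, splitTerm, Finset.insert_sdiff_of_notMem _ htW,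
    disc_insert (fun h' => h (Finset.sdiff_subset h')), h1]
  ring

theorem splitTerm_insert_up {t : ℂ} {Y V : Finset ℂ} (h : t ∉ Y) (hV : V ⊆ Y) :
    splitTerm (insert t Y) (insert t V) = splitTerm Y V *
      (t * (∏ v ∈ V, pairW t v * pairW v t) * ∏ x ∈ Y \ V, pairW x t) := by
  have htV : t ∉ V := fun h' => h (hV h')
  have h1 : insert t Y \ insert t V = Y \ V := by
    ext a
    simp only [Finset.mem_sdiff, Finset.mem_insert]
    constructor
    · rintro ⟨h1, h2⟩
      exact ⟨h1.resolve_left fun e => h2 (Or.inl e), fun h3 => h2 (Or.inr h3)⟩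
    · rintro ⟨h1, h2⟩
      exact ⟨Or.inr h1, fun h3 => h3.elim (fun e => h (e ▸ h1)) h2⟩
  rw [splitTerm, splitTerm, h1, disc_insert htV, Finset.prod_insert htV]
  ring

theorem sum_powersetCard_insert {t : ℂ} {Y : Finset ℂ} (h : t ∉ Y) (n : ℕ)
    (g : Finset ℂ → ℂ) :
    ∑ W ∈ (insert t Y).powersetCard (n + 1), g W =
      ∑ W ∈ Y.powersetCard (n + 1), g W + ∑ V ∈ Y.powersetCard n, g (insert t V) := by
  rw [Finset.powersetCard_succ_insert h, Finset.sum_union, Finset.sum_image]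
  · intro V hV V' hV' e
    have hn : ∀ {V}, V ∈ Y.powersetCard n → t ∉ V := fun hV h' =>
      h ((Finset.mem_powersetCard.1 hV).1 h')
    rw [← Finset.erase_insert (hn hV), ← Finset.erase_insert (hn hV'), e]
  · rw [Finset.disjoint_left]
    intro W hW hW'
    obtain ⟨V, -, rfl⟩ := Finset.mem_image.1 hW'
    exact h ((Finset.mem_powersetCard.1 hW).1 (Finset.mem_insert_self _ _))

theorem sum_powersetCard_insert_of_mem {s : ℂ} {Y : Finset ℂ} (n : ℕ)
    {g : Finset ℂ → ℂ} (hg : ∀ W, W ⊆ insert s Y → s ∈ W → g W = 0) :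
    ∑ W ∈ (insert s Y).powersetCard n, g W = ∑ W ∈ Y.powersetCard n, g W := by
  refine (Finset.sum_subset (Finset.powersetCard_mono (Finset.subset_insert s Y)) ?_).symm
  intro W hW hW'
  rw [Finset.mem_powersetCard] at hW hW'
  refine hg W hW.1 (by_contra fun hs => hW' ⟨fun a ha => ?_, hW.2⟩)
  exact (Finset.mem_insert.1 (hW.1 ha)).resolve_left fun e => hs (e ▸ ha)

theorem cube_sub_cube (s v : ℂ) : s ^ 3 - v ^ 3 = (s - v) * (ω * s - v) * (ω ^ 2 * s - v) := by
  have h3 := ω_cube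
  have h1 := ω_rel
  linear_combination (-(s ^ 3)) * h3 + (s ^ 2 * v * ω - s * v ^ 2) * h1

theorem splitSum_cube {n : ℕ} {s : ℂ} {Y : Finset ℂ} (hs : s ∉ Y) (ht : ω * s ∉ insert s Y)
    (hY : Y.card = 2 * n + 1) :
    splitSum (n + 1) (insert (ω * s) (insert s Y)) =
      3 * ω ^ 2 * s ^ 3 * (∏ y ∈ Y, (s ^ 3 - y ^ 3)) ^ 2 * splitSum n Y := by
  set t := ω * s with htd
  have h0 : pairW t s = 0 := by rw [pairW, htd]; ring
  rw [splitSum, sum_powersetCard_insert ht, Finset.sum_eq_zero, zero_add,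
    sum_powersetCard_insert_of_mem, splitSum, Finset.mul_sum]
  · refine Finset.sum_congr rfl fun V hV => ?_
    obtain ⟨hVY, hVc⟩ := Finset.mem_powersetCard.1 hV
    have hsV : s ∉ V := fun h => hs (hVY h)
    rw [splitTerm_insert_up ht (hVY.trans (Finset.subset_insert _ _)), splitTerm_insert_dn hs hVY,
      Finset.insert_sdiff_of_notMem _ hsV, Finset.prod_insert fun h => hs (Finset.sdiff_subset h)]
    have hv : (∏ v ∈ V, pairW t v * pairW v t) * ∏ v ∈ V, pairW s v =
        ω ^ (2 * n) * ∏ v ∈ V, (s ^ 3 - v ^ 3) ^ 2 := by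
      rw [← hVc, pow_mul, ← Finset.prod_const, ← Finset.prod_mul_distrib,
        ← Finset.prod_mul_distrib]
      refine Finset.prod_congr rfl fun v _ => ?_
      rw [cube_sub_cube, pairW, pairW, pairW, htd]
      have h3 := ω_cube
      have : s - ω * v = ω * (ω ^ 2 * s - v) := by linear_combination (-s) * h3
      rw [this]
      ring
    have hx : (∏ x ∈ Y \ V, pairW x t) * ∏ x ∈ Y \ V, pairW s x * pairW x s =
        ω ^ (n + 1) * ∏ x ∈ Y \ V, (s ^ 3 - x ^ 3) ^ 2 := by
      have hc : (Y \ V).card = n + 1 := by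
        rw [Finset.card_sdiff_of_subset hVY]; omega
      rw [← hc, ← Finset.prod_const, ← Finset.prod_mul_distrib,
        ← Finset.prod_mul_distrib]
      refine Finset.prod_congr rfl fun v _ => ?_
      rw [cube_sub_cube, pairW, pairW, pairW, htd]
      have h3 := ω_cube
      have : s - ω * v = ω * (ω ^ 2 * s - v) := by linear_combination (-s) * h3
      rw [this]
      ring
    rw [← Finset.prod_pow, ← Finset.prod_sdiff hVY]
    have hst : t * pairW s t * (ω ^ (2 * n) * ω ^ (n + 1)) = 3 * ω ^ 2 * s ^ 3 := by
      have h3 : (ω ^ 3) ^ n = 1 := by rw [ω_cube, one_pow]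
      have : ω ^ (2 * n) * ω ^ (n + 1) = ω * (ω ^ 3) ^ n := by rw [← pow_mul]; ring
      rw [this, h3, pairW, htd]
      have h1 := ω_rel
      linear_combination (s ^ 3 * ω ^ 2 * (ω - 2)) * h1
    rw [← hst]
    linear_combination (splitTerm Y V * t * pairW s t) *
      ((∏ x ∈ Y \ V, pairW x t) * (∏ x ∈ Y \ V, pairW s x * pairW x s) * hv +
      ω ^ (2 * n) * (∏ v ∈ V, (s ^ 3 - v ^ 3) ^ 2) * hx)
  · intro W hW hsW
    rw [splitTerm_insert_up ht hW, Finset.prod_eq_zero hsW]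
    · ring
    · rw [h0, zero_mul]
  · intro W hW
    have hW' := (Finset.mem_powersetCard.1 hW).1
    rw [splitTerm_insert_dn ht hW']
    by_cases hsW : s ∈ W
    · rw [Finset.prod_eq_zero (s := W) hsW h0]; ring
    · rw [Finset.prod_eq_zero (s := insert s Y \ W)
        (Finset.mem_sdiff.2 ⟨Finset.mem_insert_self _ _, hsW⟩)]
      · ring
      · rw [h0, zero_mul]

/-! ### Interpolation -/

def PolyLe (d : ℕ) (f : ℂ → ℂ) : Prop :=
  ∃ p : Polynomial ℂ, p.natDegree ≤ d ∧ ∀ t, p.eval t = f t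

theorem PolyLe.mono {d e : ℕ} {f : ℂ → ℂ} (h : PolyLe d f) (hde : d ≤ e) : PolyLe e f := by
  obtain ⟨p, hp, hf⟩ := h
  exact ⟨p, hp.trans hde, hf⟩

theorem polyLe_const (c : ℂ) : PolyLe 0 fun _ => c :=
  ⟨Polynomial.C c, by simp, by simp⟩

theorem polyLe_affine (a b : ℂ) : PolyLe 1 fun t => a * t + b :=
  ⟨Polynomial.C a * Polynomial.X + Polynomial.C b, Polynomial.natDegree_linear_le, by simp⟩

theorem polyLe_pow (k : ℕ) : PolyLe k fun t => t ^ k :=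
  ⟨Polynomial.X ^ k, Polynomial.natDegree_X_pow_le k, by simp⟩

theorem PolyLe.mul {d e : ℕ} {f g : ℂ → ℂ} (hf : PolyLe d f) (hg : PolyLe e g) :
    PolyLe (d + e) fun t => f t * g t := by
  obtain ⟨p, hp, hpf⟩ := hf
  obtain ⟨r, hr, hrg⟩ := hg
  exact ⟨p * r, Polynomial.natDegree_mul_le_of_le hp hr, fun t => by
    rw [Polynomial.eval_mul, hpf, hrg]⟩

theorem PolyLe.add {d : ℕ} {f g : ℂ → ℂ} (hf : PolyLe d f) (hg : PolyLe d g) :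
    PolyLe d fun t => f t + g t := by
  obtain ⟨p, hp, hpf⟩ := hf
  obtain ⟨r, hr, hrg⟩ := hg
  exact ⟨p + r, Polynomial.natDegree_add_le_of_degree_le hp hr, fun t => by
    rw [Polynomial.eval_add, hpf, hrg]⟩

theorem polyLe_sum {ι : Type*} (s : Finset ι) {d : ℕ} {f : ι → ℂ → ℂ}
    (h : ∀ i ∈ s, PolyLe d (f i)) : PolyLe d fun t => ∑ i ∈ s, f i t := by
  classical
  induction s using Finset.induction_on with
  | empty => simpa using (polyLe_const 0).mono (Nat.zero_le d)
  | insert a s ha ih =>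
    simp only [Finset.sum_insert ha]
    exact (h a (by simp)).add (ih fun i hi => h i (by simp [hi]))

theorem polyLe_prod {ι : Type*} (s : Finset ι) {d : ℕ} {f : ι → ℂ → ℂ}
    (h : ∀ i ∈ s, PolyLe d (f i)) : PolyLe (s.card * d) fun t => ∏ i ∈ s, f i t := by
  classical
  induction s using Finset.induction_on with
  | empty => simpa using polyLe_const 1
  | insert a s ha ih =>
    simp only [Finset.prod_insert ha]
    rw [Finset.card_insert_of_notMem ha, add_mul, one_mul, add_comm]
    exact (h a (by simp)).mul (ih fun i hi => h i (by simp [hi]))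

theorem PolyLe.eq_of_card {d : ℕ} {f g : ℂ → ℂ} (hf : PolyLe d f) (hg : PolyLe d g)
    (S : Finset ℂ) (hS : d < S.card) (h : ∀ t ∈ S, f t = g t) (t : ℂ) : f t = g t := by
  obtain ⟨p, hp, hpf⟩ := hf
  obtain ⟨r, hr, hrg⟩ := hg
  have : p = r := Polynomial.eq_of_natDegree_lt_card_of_eval_eq' p r S
    (fun t ht => by rw [hpf, hrg, h t ht]) (max_lt (hp.trans_lt hS) (hr.trans_lt hS))
  rw [← hpf, ← hrg, this]

theorem PolyLe.exists_quotient {d : ℕ} {f : ℂ → ℂ} (hf : PolyLe d f) (S : Finset ℂ)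
    (h : ∀ t ∈ S, f t = 0) :
    ∃ g, PolyLe (d - S.card) g ∧ ∀ t, f t = (∏ y ∈ S, (t - y)) * g t := by
  obtain ⟨p, hp, hpf⟩ := hf
  have hdvd : ∏ y ∈ S, (Polynomial.X - Polynomial.C y) ∣ p := by
    refine Finset.prod_dvd_of_coprime (fun a _ b _ hab => ?_) fun y hy => ?_
    · exact Polynomial.pairwise_coprime_X_sub_C Function.injective_id hab
    · rw [Polynomial.dvd_iff_isRoot, Polynomial.IsRoot, hpf, h y hy]
  obtain ⟨r, rfl⟩ := hdvd
  refine ⟨fun t => r.eval t, ⟨r, ?_, fun _ => rfl⟩, fun t => ?_⟩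
  · rcases eq_or_ne r 0 with rfl | hr
    · simp
    · rw [Polynomial.natDegree_mul
        (Finset.prod_ne_zero_iff.2 fun y _ => Polynomial.X_sub_C_ne_zero y) hr,
        Polynomial.natDegree_prod _ _ fun y _ => Polynomial.X_sub_C_ne_zero y] at hp
      simp only [Polynomial.natDegree_X_sub_C, Finset.sum_const, smul_eq_mul, mul_one] at hp
      omega
  · rw [← hpf, Polynomial.eval_mul, Polynomial.eval_prod]
    simp

def quotDn (Y W : Finset ℂ) (t : ℂ) : ℂ := splitTerm Y W *
  ((∏ x ∈ Y \ W, ((x - t) * (t - ω * x) * (x - ω * t))) * ∏ w ∈ W, (t - ω * w))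

def quotUp (Y V : Finset ℂ) (t : ℂ) : ℂ := splitTerm Y V *
  (t * (∏ v ∈ V, ((v - t) * (t - ω * v) * (v - ω * t))) * ∏ x ∈ Y \ V, (-(x - ω * t)))

def splitQuot (n : ℕ) (Y : Finset ℂ) (t : ℂ) : ℂ :=
  ∑ W ∈ Y.powersetCard (n + 1), quotDn Y W t + ∑ V ∈ Y.powersetCard n, quotUp Y V t

theorem splitSum_insert (n : ℕ) {t : ℂ} {Y : Finset ℂ} (h : t ∉ Y) :
    splitSum (n + 1) (insert t Y) = (∏ y ∈ Y, (t - y)) * splitQuot n Y t := by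
  rw [splitSum, sum_powersetCard_insert h, splitQuot, mul_add, Finset.mul_sum, Finset.mul_sum]
  congr 1 <;> refine Finset.sum_congr rfl fun W hW => ?_ <;>
    have hWY := (Finset.mem_powersetCard.1 hW).1
  · rw [splitTerm_insert_dn h hWY, quotDn, ← Finset.prod_sdiff hWY]
    simp only [pairW, Finset.prod_mul_distrib]
    ring
  · rw [splitTerm_insert_up h hWY, quotUp, ← Finset.prod_sdiff hWY]
    have : ∏ x ∈ Y \ W, pairW x t = (∏ x ∈ Y \ W, (t - x)) * ∏ x ∈ Y \ W, (-(x - ω * t)) := by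
      rw [← Finset.prod_mul_distrib]
      exact Finset.prod_congr rfl fun x _ => by rw [pairW]; ring
    rw [this]
    simp only [pairW, Finset.prod_mul_distrib]
    ring

theorem polyLe_splitQuot (n : ℕ) {Y : Finset ℂ} (hY : Y.card = 2 * n + 2) :
    PolyLe (4 * n + 4) (splitQuot n Y) := by
  have a1 : ∀ x : ℂ, PolyLe 1 fun t => x - t := fun x => by
    convert polyLe_affine (-1) x using 2; ring
  have a2 : ∀ x : ℂ, PolyLe 1 fun t => t - ω * x := fun x => by
    convert polyLe_affine 1 (-(ω * x)) using 2; ring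
  have a3 : ∀ x : ℂ, PolyLe 1 fun t => x - ω * t := fun x => by
    convert polyLe_affine (-ω) x using 2; ring
  have a4 : ∀ x : ℂ, PolyLe 1 fun t => -(x - ω * t) := fun x => by
    convert polyLe_affine ω (-x) using 2; ring
  refine (polyLe_sum _ fun W hW => ?_).add (polyLe_sum _ fun W hW => ?_)
  all_goals
    obtain ⟨hWY, hWc⟩ := Finset.mem_powersetCard.1 hW
    have hc := Finset.card_sdiff_of_subset hWY
  · refine ((polyLe_const _).mul ((polyLe_prod _ fun x _ => ((a1 x).mul (a2 x)).mul (a3 x)).mul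
      (polyLe_prod _ fun x _ => a2 x))).mono ?_
    omega
  · have hid : PolyLe 1 fun t => t := by simpa using polyLe_pow 1
    refine ((polyLe_const _).mul ((hid.mul
      (polyLe_prod _ fun x _ => ((a1 x).mul (a2 x)).mul (a3 x))).mul
      (polyLe_prod _ fun x _ => a4 x))).mono ?_
    omega

theorem splitQuot_self (n : ℕ) {s : ℂ} {Y : Finset ℂ} (hs : s ∉ Y) :
    splitQuot n (insert s Y) s = 0 := by
  rw [splitQuot, sum_powersetCard_insert hs, Finset.sum_eq_zero, zero_add,
    sum_powersetCard_insert_of_mem, ← Finset.sum_add_distrib]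
  · refine Finset.sum_eq_zero fun V hV => ?_
    have hVY := (Finset.mem_powersetCard.1 hV).1
    have hsV : s ∉ V := fun h => hs (hVY h)
    have hsX : s ∉ Y \ V := fun h => hs (Finset.sdiff_subset h)
    have h1 : insert s Y \ insert s V = Y \ V := by
      rw [Finset.insert_sdiff_insert, Finset.sdiff_insert_of_notMem hs]
    rw [quotDn, quotUp, splitTerm_insert_up hs hVY, splitTerm_insert_dn hs hVY, h1,
      Finset.insert_sdiff_of_notMem _ hsV, Finset.prod_insert hsV, Finset.prod_insert hsX]
    have h2 : (∏ x ∈ Y \ V, pairW s x * pairW x s) * ∏ x ∈ Y \ V, (-(x - ω * s)) =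
        (∏ x ∈ Y \ V, pairW x s) * ∏ x ∈ Y \ V, (x - s) * (s - ω * x) * (x - ω * s) := by
      rw [← Finset.prod_mul_distrib, ← Finset.prod_mul_distrib]
      exact Finset.prod_congr rfl fun x _ => by rw [pairW, pairW]; ring
    have h3 : (∏ v ∈ V, pairW s v) * ∏ v ∈ V, ((v - s) * (s - ω * v) * (v - ω * s)) =
        (∏ v ∈ V, pairW s v * pairW v s) * ∏ v ∈ V, (s - ω * v) := by
      rw [← Finset.prod_mul_distrib, ← Finset.prod_mul_distrib]
      exact Finset.prod_congr rfl fun x _ => by rw [pairW, pairW]; ring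
    linear_combination (-(splitTerm Y V * s * (s - ω * s))) *
      ((∏ v ∈ V, pairW s v) * (∏ v ∈ V, ((v - s) * (s - ω * v) * (v - ω * s))) * h2 +
      (∏ x ∈ Y \ V, pairW x s) * (∏ x ∈ Y \ V, (x - s) * (s - ω * x) * (x - ω * s)) * h3)
  · intro V hV hsV
    rw [quotUp, Finset.prod_eq_zero hsV]
    · ring
    · rw [sub_self]; ring
  · intro W hW
    have hsW : s ∈ insert s Y \ W := Finset.mem_sdiff.2 ⟨Finset.mem_insert_self _ _,
      fun h => hs ((Finset.mem_powersetCard.1 hW).1 h)⟩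
    rw [quotDn, Finset.prod_eq_zero hsW]
    · ring
    · rw [sub_self]; ring

/-! ### Generalised Vandermonde determinants -/

def expDet (e : ℕ → ℕ) (N : ℕ) (z : Fin N → ℂ) : ℂ :=
  (Matrix.of fun i j : Fin N => z i ^ e j).det

theorem expDet_comp (e : ℕ → ℕ) {N : ℕ} (z : Fin N → ℂ) (σ : Equiv.Perm (Fin N)) :
    expDet e N (z ∘ σ) = Equiv.Perm.sign σ * expDet e N z :=
  Matrix.det_permute σ (Matrix.of fun i j : Fin N => z i ^ e j)

theorem expDet_cons_self (e : ℕ → ℕ) {N : ℕ} (y : Fin N → ℂ) (i : Fin N) :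
    expDet e (N + 1) (Fin.cons (y i) y) = 0 := by
  refine Matrix.det_zero_of_row_eq (Fin.succ_ne_zero i).symm ?_
  ext j
  simp

theorem polyLe_expDet {e : ℕ → ℕ} (he : Monotone e) {N : ℕ} (y : Fin N → ℂ) :
    PolyLe (e N) fun t => expDet e (N + 1) (Fin.cons t y) := by
  have : (fun t => expDet e (N + 1) (Fin.cons t y)) = fun t => ∑ j : Fin (N + 1),
      (-1) ^ (j : ℕ) * t ^ e j *
        (Matrix.of fun (i : Fin N) (k : Fin N) => y i ^ e (j.succAbove k)).det := by
    funext t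
    rw [expDet, Matrix.det_succ_row_zero]
    refine Finset.sum_congr rfl fun j _ => ?_
    congr 1
  rw [this]
  refine polyLe_sum _ fun j _ => ?_
  exact (((polyLe_const _).mul (polyLe_pow (e j))).mul (polyLe_const _)).mono
    (by simpa using he (Nat.le_of_lt_succ j.2))

theorem expDet_cube {e : ℕ → ℕ} (he : ∀ j, e (j + 2) = e j + 3) {N : ℕ} {a b s : ℂ}
    (ha : a ^ 3 = s) (hb : b ^ 3 = s) (y : Fin N → ℂ) :
    expDet e (N + 2) (Fin.cons a (Fin.cons b y)) =
      (a ^ e 0 * b ^ e 1 - a ^ e 1 * b ^ e 0) * (∏ i, (y i ^ 3 - s)) * expDet e N y := by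
  set z : Fin (N + 2) → ℂ := Fin.cons a (Fin.cons b y) with hz
  have hz0 : z 0 = a := rfl
  have hz1 : z 1 = b := rfl
  have hz2 : ∀ i : Fin N, z i.succ.succ = y i := fun i => rfl
  set T : Matrix (Fin (N + 2)) (Fin (N + 2)) ℂ :=
    Matrix.of fun k j => (if k = j then 1 else 0) - if k.val + 2 = j.val then s else 0 with hT
  have hTdet : T.det = 1 := by
    rw [Matrix.det_of_isUpperTriangular]
    · simp [hT]
    · intro i j hij
      have : j < i := hij
      have h1 : i ≠ j := this.ne'
      have h2 : i.val + 2 ≠ j.val := by omega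
      simp [hT, h1, h2]
  set M : Matrix (Fin (N + 2)) (Fin (N + 2)) ℂ := Matrix.of fun i j => z i ^ e j with hM
  have hMT : ∀ i j, (M * T) i j = z i ^ e j - ∑ k : Fin (N + 2),
      if k.val + 2 = j.val then z i ^ e k * s else 0 := by
    intro i j
    simp [Matrix.mul_apply, hM, hT, mul_sub, Finset.sum_sub_distrib]
  have hc0 : ∀ i, (M * T) i 0 = z i ^ e 0 := by
    intro i; simp [hMT]
  have hc1 : ∀ i, (M * T) i (Fin.succ 0) = z i ^ e 1 := by
    intro i; simp [hMT]
  have hc2 : ∀ i (j : Fin N), (M * T) i j.succ.succ = (z i ^ 3 - s) * z i ^ e j := by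
    intro i j
    rw [hMT, Finset.sum_eq_single j.castSucc.castSucc]
    · simp [he, pow_add]; ring
    · intro k _ hk
      rw [if_neg]
      intro h
      exact hk (Fin.ext (by simpa using h))
    · simp
  have hdet : expDet e (N + 2) z = (M * T).det := by
    rw [Matrix.det_mul, hTdet, mul_one]; rfl
  have hsub : (Matrix.of fun i j : Fin N => (y i ^ 3 - s) * y i ^ e j).det =
      (∏ i, (y i ^ 3 - s)) * expDet e N y :=
    Matrix.det_mul_column _ _
  have hr0 : ∀ j : Fin N, (M * T) 0 j.succ.succ = 0 := fun j => by
    rw [hc2, hz0, ha, sub_self, zero_mul]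
  have hr1 : ∀ j : Fin N, (M * T) (Fin.succ 0) j.succ.succ = 0 := fun j => by
    rw [hc2]; change (b ^ 3 - s) * _ = 0; rw [hb, sub_self, zero_mul]
  rw [hdet, Matrix.det_succ_row_zero, Fin.sum_univ_succ, Fin.sum_univ_succ,
    Finset.sum_eq_zero fun j _ => by rw [hr0]; ring, Matrix.det_succ_row_zero,
    Fin.sum_univ_succ, Finset.sum_eq_zero, Matrix.det_succ_row_zero,
    Fin.sum_univ_succ, Finset.sum_eq_zero, hc0, hc1]
  · have e1 : (((M * T).submatrix Fin.succ (Fin.succAbove 0)).submatrix Fin.succ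
        (Fin.succAbove 0)) = Matrix.of fun i j : Fin N => (y i ^ 3 - s) * y i ^ e j := by
      ext i j
      exact hc2 i.succ.succ j
    have e2 : (((M * T).submatrix Fin.succ (Fin.succAbove (Fin.succ 0))).submatrix Fin.succ
        (Fin.succAbove 0)) = Matrix.of fun i j : Fin N => (y i ^ 3 - s) * y i ^ e j := by
      ext i j
      simp only [Matrix.submatrix_apply, Fin.zero_succAbove, Fin.succ_succAbove_succ]
      exact hc2 i.succ.succ j
    rw [e1, e2, hsub]
    have v1 : (M * T).submatrix Fin.succ (Fin.succAbove 0) 0 0 = b ^ e 1 := hc1 (Fin.succ 0)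
    have v2 : (M * T).submatrix Fin.succ (Fin.succAbove (Fin.succ 0)) 0 0 = b ^ e 0 := by
      simp only [Matrix.submatrix_apply]
      exact hc0 (Fin.succ 0)
    rw [v1, v2, hz0]
    simp
    ring
  · intro j _
    have : (M * T).submatrix Fin.succ (Fin.succAbove (Fin.succ 0)) 0 j.succ = 0 := by
      simp only [Matrix.submatrix_apply, Fin.zero_succAbove, Fin.succ_succAbove_succ]
      exact hr1 j
    rw [this]; ring
  · intro j _
    have : (M * T).submatrix Fin.succ (Fin.succAbove 0) 0 j.succ = 0 := hr1 j
    rw [this]; ring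

/-- The exponents `0, 1, 3, 4, 6, …`. -/
def expLow (j : ℕ) : ℕ := 3 * j / 2

/-- The exponents `0, 2, 3, 5, 6, …`. -/
def expHigh (j : ℕ) : ℕ := (3 * j + 1) / 2

def detProd (N : ℕ) (z : Fin N → ℂ) : ℂ := expDet expLow N z * expDet expHigh N z

theorem detProd_comp {N : ℕ} (z : Fin N → ℂ) (σ : Equiv.Perm (Fin N)) :
    detProd N (z ∘ σ) = detProd N z := by
  rw [detProd, detProd, expDet_comp, expDet_comp]
  rcases Int.units_eq_one_or (Equiv.Perm.sign σ) with h | h <;> rw [h] <;> simp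

theorem detProd_cube {N : ℕ} {a b : ℂ} (h : a = ω * b ∨ b = ω * a) (y : Fin N → ℂ) :
    detProd (N + 2) (Fin.cons a (Fin.cons b y)) =
      3 * b ^ 3 * (∏ i, (b ^ 3 - y i ^ 3)) ^ 2 * detProd N y := by
  have h3 := ω_cube
  have hab : a ^ 3 = b ^ 3 := by
    rcases h with rfl | rfl <;> rw [mul_pow, h3, one_mul]
  have hp : (∏ i, (y i ^ 3 - b ^ 3)) ^ 2 = (∏ i, (b ^ 3 - y i ^ 3)) ^ 2 := by
    rw [← Finset.prod_pow, ← Finset.prod_pow]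
    exact Finset.prod_congr rfl fun i _ => by ring
  rw [detProd, expDet_cube (fun j => by simp only [expLow]; omega) hab rfl,
    expDet_cube (fun j => by simp only [expHigh]; omega) hab rfl, detProd, ← hp]
  have h01 : expLow 0 = 0 := rfl
  have h02 : expLow 1 = 1 := rfl
  have h03 : expHigh 0 = 0 := rfl
  have h04 : expHigh 1 = 2 := rfl
  rw [h01, h02, h03, h04]
  have hw := ω_rel
  have key : (b - a) * (b ^ 2 - a ^ 2) = 3 * b ^ 3 := by
    have : a * b ^ 2 + a ^ 2 * b = - b ^ 3 := by
      rcases h with rfl | rfl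
      · linear_combination b ^ 3 * hw
      · linear_combination a ^ 3 * hw + a ^ 3 * h3
    linear_combination hab - this
  linear_combination (∏ i, (y i ^ 3 - b ^ 3)) ^ 2 * expDet expLow N y * expDet expHigh N y * key

theorem univ_image_cons {N : ℕ} (t : ℂ) (y : Fin N → ℂ) :
    Finset.univ.image (Fin.cons t y : Fin (N + 1) → ℂ) = insert t (Finset.univ.image y) := by
  ext a
  simp [Fin.exists_fin_succ, eq_comm]

theorem univ_image_comp_perm {N : ℕ} (z : Fin N → ℂ) (σ : Equiv.Perm (Fin N)) :
    Finset.univ.image (z ∘ σ) = Finset.univ.image z := by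
  rw [← Finset.image_image]
  congr 1
  exact Finset.image_univ_of_surjective σ.surjective

theorem expLow_mono : Monotone expLow := fun a b h => by simp only [expLow]; omega

theorem expHigh_mono : Monotone expHigh := fun a b h => by simp only [expHigh]; omega

theorem ω_pow_injective {k l : ℕ} (hk : k < 3) (hl : l < 3) (h : ω ^ k = ω ^ l) : k = l := by
  have h1 := one_sub_ω_ne_zero
  have h0 := ω_ne_zero
  have h3 := ω_rel
  have h4 : ω ≠ 1 := fun e => h1 (by rw [e, sub_self])
  have h5 : ω ^ 2 ≠ 1 := fun e => by
    apply h1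
    have : ω = -2 := by linear_combination h3 - e
    rw [this] at e; norm_num at e
  have h6 : ω ^ 2 ≠ ω := fun e => h4 (mul_left_cancel₀ h0 (by rw [← sq, e, mul_one]))
  interval_cases k <;> interval_cases l <;> first
    | rfl
    | (exfalso
       simp only [pow_zero, pow_one] at h
       first
         | exact h4 h | exact h4 h.symm | exact h5 h | exact h5 h.symm | exact h6 h
         | exact h6 h.symm)

theorem splitSum_eq_of_cube {n : ℕ} {a b : ℂ} (h : a = ω * b ∨ b = ω * a) (hb : b ≠ 0)
    {y : Fin (2 * n + 1) → ℂ} (hy : Function.Injective fun i => y i ^ 3)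
    (hby : ∀ i, y i ^ 3 ≠ b ^ 3)
    (ih : splitSum n (Finset.univ.image y) = ω ^ (2 * n) * detProd (2 * n + 1) y) :
    splitSum (n + 1) (insert a (insert b (Finset.univ.image y))) =
      ω ^ (2 * n + 2) * detProd (2 * n + 1 + 2) (Fin.cons a (Fin.cons b y)) := by
  have h3 := ω_cube
  have hab : a ^ 3 = b ^ 3 := by
    rcases h with rfl | rfl <;> rw [mul_pow, h3, one_mul]
  have hne : a ≠ b := by
    rintro rfl
    have : a = ω * a := by tauto
    exact one_sub_ω_ne_zero ((mul_eq_zero.1 (by linear_combination this : (1 - ω) * a = 0)).resolve_right hb)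
  have hm : ∀ c : ℂ, c ^ 3 = b ^ 3 → c ∉ Finset.univ.image y := by
    intro c hc hc'
    obtain ⟨i, -, rfl⟩ := Finset.mem_image.1 hc'
    exact hby i hc
  have hcard : (Finset.univ.image y).card = 2 * n + 1 := by
    rw [Finset.card_image_of_injective _ fun i j hij => hy (by simp [hij])]; simp
  have hprod : ∏ x ∈ Finset.univ.image y, (b ^ 3 - x ^ 3) = ∏ i, (b ^ 3 - y i ^ 3) :=
    Finset.prod_image fun i _ j _ hij => hy (by simp [hij])
  have key : splitSum (n + 1) (insert a (insert b (Finset.univ.image y))) =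
      3 * ω ^ 2 * b ^ 3 * (∏ x ∈ Finset.univ.image y, (b ^ 3 - x ^ 3)) ^ 2 *
        splitSum n (Finset.univ.image y) := by
    rcases h with rfl | rfl
    · exact splitSum_cube (hm b rfl) (by
        rw [Finset.mem_insert, not_or]; exact ⟨hne, hm _ hab⟩) hcard
    · rw [Finset.insert_comm, ← hab]
      exact splitSum_cube (hm a hab) (by
        rw [Finset.mem_insert, not_or]; exact ⟨hne.symm, hm _ rfl⟩) hcard
  rw [key, hprod, ih, detProd_cube h]
  ring

theorem splitSum_eq_detProd (n : ℕ) : ∀ z : Fin (2 * n + 1) → ℂ, (∀ i, z i ≠ 0) →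
    (Function.Injective fun i => z i ^ 3) →
    splitSum n (Finset.univ.image z) = ω ^ (2 * n) * detProd (2 * n + 1) z := by
  induction n with
  | zero =>
    intro z _ _
    simp [splitSum, splitTerm, disc, detProd, expDet, expLow, expHigh]
  | succ n ih =>
    intro z hz0 hz
    have h3 := ω_cube
    set y : Fin (2 * n + 2) → ℂ := Fin.tail z with hy
    have hzy : z = Fin.cons (z 0) y := (Fin.cons_self_tail z).symm
    have hy0 : ∀ i, y i ≠ 0 := fun i => hz0 _
    have hyi : Function.Injective fun i => y i ^ 3 := fun i j hij => Fin.succ_injective _ (hz hij)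
    have hyi' : Function.Injective y := fun i j hij => hyi (by simp [hij])
    set Y := Finset.univ.image y with hY
    have hYc : Y.card = 2 * n + 2 := by
      rw [hY, Finset.card_image_of_injective _ hyi']; simp
    have hzero : ∀ e : ℕ → ℕ, ∀ t ∈ Y, expDet e (2 * n + 2 + 1) (Fin.cons t y) = 0 := by
      intro e t ht
      obtain ⟨i, -, rfl⟩ := Finset.mem_image.1 ht
      exact expDet_cons_self e y i
    obtain ⟨g, hg, hgf⟩ := (polyLe_expDet expLow_mono y).exists_quotient Y (hzero expLow)
    obtain ⟨g', hg', hgf'⟩ := (polyLe_expDet expHigh_mono y).exists_quotient Y (hzero expHigh)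
    have hd : expLow (2 * n + 2) = 3 * n + 3 := by simp only [expLow]; omega
    have hd' : expHigh (2 * n + 2) = 3 * n + 3 := by simp only [expHigh]; omega
    have hdet : ∀ t, detProd (2 * n + 2 + 1) (Fin.cons t y) =
        (∏ x ∈ Y, (t - x)) * ((∏ x ∈ Y, (t - x)) * (g t * g' t)) := by
      intro t
      rw [detProd, hgf, hgf']; ring
    have hR : PolyLe (4 * n + 4) fun t =>
        ω ^ (2 * n + 2) * ((∏ x ∈ Y, (t - x)) * (g t * g' t)) := by
      have a1 : ∀ x : ℂ, PolyLe 1 fun t => t - x := fun x => by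
        convert polyLe_affine 1 (-x) using 2; ring
      refine ((polyLe_const _).mul ((polyLe_prod Y fun x _ => a1 x).mul (hg.mul hg'))).mono ?_
      omega
    have hinjω : ∀ k l : ℕ, k < 3 → l < 3 → ∀ a ∈ Y, ∀ b ∈ Y, ω ^ k * a = ω ^ l * b →
        k = l ∧ a = b := by
      intro k l hk hl a ha b hb hab
      obtain ⟨i, -, rfl⟩ := Finset.mem_image.1 ha
      obtain ⟨j, -, rfl⟩ := Finset.mem_image.1 hb
      have hc : ∀ k : ℕ, (ω ^ k) ^ 3 = 1 := fun k => by rw [pow_right_comm, h3, one_pow]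
      have : i = j := hyi (by
        have := congrArg (· ^ 3) hab
        simpa [mul_pow, hc] using this)
      subst this
      exact ⟨ω_pow_injective hk hl (mul_right_cancel₀ (hy0 i) hab), rfl⟩
    have hcons : ∀ i, ∃ y' : Fin (2 * n + 1) → ℂ, Y = insert (y i) (Finset.univ.image y') ∧
        (∀ j, y' j ≠ 0) ∧ (Function.Injective fun j => y' j ^ 3) ∧ (∀ j, y' j ^ 3 ≠ y i ^ 3) ∧
        ∀ t, detProd (2 * n + 1 + 2) (Fin.cons t (Fin.cons (y i) y')) =
          detProd (2 * n + 2 + 1) (Fin.cons t y) := by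
      intro i
      set σ := Equiv.swap 0 i with hσ
      have hyσ : y ∘ σ = Fin.cons (y i) (Fin.tail (y ∘ σ)) := by
        conv_lhs => rw [← Fin.cons_self_tail (y ∘ σ)]
        simp [hσ]
      refine ⟨Fin.tail (y ∘ σ), ?_, fun j => hy0 _, fun j k hjk => ?_, fun j hj => ?_, fun t => ?_⟩
      · rw [← univ_image_cons, ← hyσ, univ_image_comp_perm]
      · exact Fin.succ_injective _ (σ.injective (hyi hjk))
      · have : σ j.succ = i := hyi hj
        rw [hσ, Equiv.swap_apply_eq_iff, Equiv.swap_apply_right] at this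
        exact Fin.succ_ne_zero _ this
      · rw [← hyσ, ← detProd_comp (Fin.cons t y) (Equiv.swap (Fin.succ 0) (Fin.succ i))]
        congr 1
        funext j
        refine Fin.cases ?_ (fun j => ?_) j
        · rw [Function.comp_apply, Equiv.swap_apply_of_ne_of_ne (Fin.succ_ne_zero _).symm
            (Fin.succ_ne_zero _).symm]
          rfl
        · rw [Function.comp_apply, (Fin.succ_injective _).swap_apply]
          rfl
    have hoff : ∀ k : ℕ, k < 3 → k ≠ 0 → ∀ x ∈ Y, ω ^ k * x ∉ Y := fun k hk hk0 x hx hx' =>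
      hk0 (hinjω k 0 hk (by norm_num) x hx _ hx' (by rw [pow_zero, one_mul])).1
    have hval : ∀ t, t ∉ Y → (∃ x ∈ Y, t = ω * x ∨ x = ω * t) →
        splitQuot n Y t = ω ^ (2 * n + 2) * ((∏ x ∈ Y, (t - x)) * (g t * g' t)) := by
      rintro t ht ⟨x, hx, hxt⟩
      obtain ⟨i, -, rfl⟩ := Finset.mem_image.1 hx
      obtain ⟨y', hYy, hy'0, hy'i, hy'n, hE⟩ := hcons i
      have hp : ∏ x ∈ Y, (t - x) ≠ 0 := Finset.prod_ne_zero_iff.2 fun x hx h =>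
        ht ((sub_eq_zero.1 h) ▸ hx)
      apply mul_left_cancel₀ hp
      rw [← splitSum_insert n ht, hYy, splitSum_eq_of_cube hxt (hy0 i) hy'i hy'n
        (ih y' hy'0 hy'i), hE, hdet, ← hYy]
      ring
    have hall := (polyLe_splitQuot n hYc).eq_of_card hR
      (Y ∪ (Y.image (ω ^ 1 * ·) ∪ Y.image (ω ^ 2 * ·))) (by
        have hci : ∀ k, k < 3 → (Y.image (ω ^ k * ·)).card = 2 * n + 2 := fun k hk => by
          rw [Finset.card_image_of_injective, hYc]
          exact mul_right_injective₀ (pow_ne_zero _ ω_ne_zero)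
        rw [Finset.card_union_of_disjoint, Finset.card_union_of_disjoint, hYc, hci 1 (by norm_num),
          hci 2 (by norm_num)]
        · omega
        · rw [Finset.disjoint_left]
          intro a ha hb
          obtain ⟨u, hu, rfl⟩ := Finset.mem_image.1 ha
          obtain ⟨v, hv, huv⟩ := Finset.mem_image.1 hb
          have := (hinjω 2 1 (by norm_num) (by norm_num) v hv u hu huv).1
          omega
        · rw [Finset.disjoint_left]
          intro a ha hb
          rcases Finset.mem_union.1 hb with hb | hb <;>
            obtain ⟨v, hv, rfl⟩ := Finset.mem_image.1 hb
          · exact hoff 1 (by norm_num) (by norm_num) v hv ha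
          · exact hoff 2 (by norm_num) (by norm_num) v hv ha) (by
        intro t ht
        rcases Finset.mem_union.1 ht with ht | ht
        · rw [Finset.prod_eq_zero ht (sub_self t), zero_mul, mul_zero, ← Finset.insert_erase ht,
            splitQuot_self n (Finset.notMem_erase t Y)]
        · rcases Finset.mem_union.1 ht with ht | ht <;>
            obtain ⟨v, hv, rfl⟩ := Finset.mem_image.1 ht
          · exact hval _ (hoff 1 (by norm_num) (by norm_num) v hv) ⟨v, hv, Or.inl (by rw [pow_one])⟩
          · refine hval _ (hoff 2 (by norm_num) (by norm_num) v hv) ⟨v, hv, Or.inr ?_⟩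
            rw [← mul_assoc, ← pow_succ', h3, one_mul])
    have hz0Y : z 0 ∉ Y := by
      intro h
      obtain ⟨i, -, hi⟩ := Finset.mem_image.1 h
      exact Fin.succ_ne_zero i (hz (by simp only [← hi]; rfl))
    conv_lhs => rw [hzy]
    conv_rhs => rw [hzy]
    rw [show Finset.univ.image (Fin.cons (z 0) y : Fin (2 * (n + 1) + 1) → ℂ) = insert (z 0) Y from
      univ_image_cons (z 0) y, splitSum_insert n hz0Y, hall]
    refine Eq.trans ?_ (congrArg (ω ^ (2 * (n + 1)) * ·) (hdet (z 0))).symm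
    ring

/-! ### The homogeneous norm -/

theorem pre_mul_pre_reverse {Z : List ℂ} (h : Z.Nodup) :
    pre Z * pre Z.reverse = ∏ x ∈ Z.toFinset, ∏ y ∈ Z.toFinset.erase x, (x - ω * y) := by
  induction Z with
  | nil => simp [pre]
  | cons z t ih =>
    have ht := (List.nodup_cons.1 h).2
    have hz : z ∉ t.toFinset := fun h' => (List.nodup_cons.1 h).1 (List.mem_toFinset.1 h')
    rw [List.toFinset_cons, prod_prod_erase_insert _ hz, ← ih ht, List.reverse_cons, pre_append,
      pre, Finset.prod_mul_distrib, List.prod_toFinset _ ht, List.prod_toFinset _ ht,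
      List.map_reverse, List.prod_reverse]
    simp [pre]
    ring

theorem disc_eq_of_subset {Z W : Finset ℂ} (h : W ⊆ Z) :
    disc Z = disc W * disc (Z \ W) * ∏ w ∈ W, ∏ x ∈ Z \ W, pairW w x * pairW x w := by
  have h1 : ∏ x ∈ Z \ W, ∏ y ∈ Z.erase x, pairW x y =
      (∏ x ∈ Z \ W, ∏ y ∈ W, pairW x y) * disc (Z \ W) := by
    rw [disc, ← Finset.prod_mul_distrib]
    refine Finset.prod_congr rfl fun x hx => ?_
    have hW : W ⊆ Z.erase x := fun a ha => Finset.mem_erase.2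
      ⟨fun e => (Finset.mem_sdiff.1 hx).2 (e ▸ ha), h ha⟩
    rw [← Finset.prod_sdiff hW, Finset.erase_sdiff_comm, mul_comm]
  have h2 : ∏ x ∈ W, ∏ y ∈ Z.erase x, pairW x y =
      (∏ x ∈ W, ∏ y ∈ Z \ W, pairW x y) * disc W := by
    rw [disc, ← Finset.prod_mul_distrib]
    refine Finset.prod_congr rfl fun x hx => ?_
    rw [← Finset.prod_sdiff (Finset.erase_subset_erase x h)]
    congr 1
    refine Finset.prod_congr ?_ fun _ _ => rfl
    ext a
    simp only [Finset.mem_sdiff, Finset.mem_erase]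
    constructor
    · rintro ⟨⟨h1, h2⟩, h3⟩
      exact ⟨h2, fun h4 => h3 ⟨h1, h4⟩⟩
    · rintro ⟨h1, h2⟩
      exact ⟨⟨fun e => h2 (e ▸ hx), h1⟩, fun h3 => h2 h3.2⟩
  rw [disc, ← Finset.prod_sdiff h, h1, h2, Finset.prod_comm (s := Z \ W)]
  simp only [Finset.prod_mul_distrib]
  ring

theorem normSum_mul_vandermonde (n : ℕ) {Z : List ℂ} (h : Good Z) (hl : Z.length = 2 * n + 1) :
    normSum n Z * ∏ x ∈ Z.toFinset, ∏ y ∈ Z.toFinset.erase x, (x - y) =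
      ω ^ (2 * (n * (n + 1))) * splitSum n Z.toFinset := by
  have hdisc : pre Z * pre Z.reverse * ∏ x ∈ Z.toFinset, ∏ y ∈ Z.toFinset.erase x, (x - y) =
      disc Z.toFinset := by
    rw [pre_mul_pre_reverse h.1, disc]
    simp only [pairW, Finset.prod_mul_distrib]
    ring
  rw [normSum_eq n h, splitSum, mul_right_comm, hdisc, Finset.mul_sum, Finset.mul_sum]
  refine Finset.sum_congr rfl fun W hW => ?_
  obtain ⟨hWZ, hWc⟩ := Finset.mem_powersetCard.1 hW
  have hXc : (Z.toFinset \ W).card = n + 1 := by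
    rw [Finset.card_sdiff_of_subset hWZ, List.toFinset_card_of_nodup h.1]; omega
  have hcf : cf Z.toFinset W = ∏ w ∈ W, ∏ x ∈ Z.toFinset \ W, (x - w)⁻¹ := Finset.prod_comm
  have key : (∏ w ∈ W, ∏ x ∈ Z.toFinset \ W, pairW w x * pairW x w) *
      (cf Z.toFinset W ^ 2 * ∏ w ∈ W, ∏ x ∈ Z.toFinset \ W, bt w x) =
      ω ^ (2 * (n * (n + 1))) * ∏ w ∈ W, ∏ x ∈ Z.toFinset \ W, pairW x w := by
    have hω : ω ^ (2 * (n * (n + 1))) = ∏ w ∈ W, ∏ x ∈ Z.toFinset \ W, ω ^ 2 := by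
      rw [Finset.prod_const, Finset.prod_const, hWc, hXc, ← pow_mul, ← pow_mul]
      ring_nf
    rw [hω, hcf, ← Finset.prod_pow]
    simp only [← Finset.prod_pow, ← Finset.prod_mul_distrib]
    refine Finset.prod_congr rfl fun w hw => Finset.prod_congr rfl fun x hx => ?_
    have hw' := List.mem_toFinset.1 (hWZ hw)
    have hx' := List.mem_toFinset.1 (Finset.sdiff_subset hx)
    have h1 : x - w ≠ 0 := fun e => (Finset.mem_sdiff.1 hx).2 (sub_eq_zero.1 e ▸ hw)
    have h2 : w - ω * x ≠ 0 := fun e => h.2 w hw' x hx' (sub_eq_zero.1 e)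
    have h3 : (w - ω * x) * bt w x = ω ^ 2 * (w - x) := by rw [bt]; exact mul_div_cancel₀ _ h2
    have h4 : (x - w) ^ 2 * (x - w)⁻¹ ^ 2 = 1 := by rw [← mul_pow, mul_inv_cancel₀ h1, one_pow]
    rw [pairW, pairW]
    linear_combination (-((x - w) ^ 2 * (x - w)⁻¹ ^ 2 * (x - ω * w))) * h3 +
      ω ^ 2 * (x - w) * (x - ω * w) * h4
  rw [disc_eq_of_subset hWZ, splitTerm, Finset.prod_mul_distrib, Finset.prod_mul_distrib]
  linear_combination disc W * disc (Z.toFinset \ W) * (∏ w ∈ W, w) * key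

theorem sumB_map {α β : Type*} (g : α → β) (Z : List α) (f : List (Bool × β) → ℂ) :
    sumB (Z.map g) f = sumB Z fun L => f (relabel g L) := by
  induction Z generalizing f with
  | nil => rfl
  | cons x Z ih => simp only [List.map_cons, sumB, ih, relabel_cons]

theorem continuous_sumB {α X : Type*} [TopologicalSpace X] (Z : List α)
    (f : X → List (Bool × α) → ℂ) (h : ∀ L, L.map Prod.snd = Z → Continuous fun t => f t L) :
    Continuous fun t => sumB Z (f t) := by
  induction Z generalizing f with
  | nil => exact h [] rfl
  | cons x Z ih =>
    exact (ih _ fun L hL => h _ (by simp [hL])).add (ih _ fun L hL => h _ (by simp [hL]))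

theorem relabel_reverse {α β : Type*} (g : α → β) (L : List (Bool × α)) :
    relabel g L.reverse = (relabel g L).reverse := List.map_reverse

theorem continuous_normSum {X : Type*} [TopologicalSpace X] (n : ℕ) (Z : List (X → ℂ))
    (h : ∀ f ∈ Z, Continuous f) : Continuous fun t => normSum n (Z.map fun f => f t) := by
  simp only [normSum, sumB_map]
  refine continuous_sumB Z _ fun L hL => ?_
  have hc : ∀ t : X, (relabel (fun f : X → ℂ => f t) L).countP (·.1) = L.countP (·.1) := fun t => by
    rw [relabel, List.countP_map]; rfl
  simp only [hc, ← relabel_reverse]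
  split_ifs with hcn
  · refine ((continuous_Psi L fun f hf => h f (hL ▸ hf)).mul (continuous_Psi _ fun f hf => ?_)).mul ?_
    · rw [List.map_reverse, List.mem_reverse, hL] at hf
      exact h f hf
    · clear hc hcn
      induction L generalizing Z with
      | nil => exact continuous_const
      | cons p L ih =>
        obtain ⟨s, f⟩ := p
        subst hL
        simp only [relabel_cons, upProd_cons]
        refine Continuous.mul ?_ (ih _ (fun f hf => h f (by simp at hf ⊢; exact Or.inr hf)) rfl)
        cases s
        · exact continuous_const
        · exact h f (by simp)
  · exact continuous_const

/-- The Vandermonde product of a sequence. -/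
def vdm (u : ℕ → ℂ) (N : ℕ) : ℂ := ∏ j ∈ Finset.range N, ∏ i ∈ Finset.range j, (u j - u i)

theorem vdm_succ (u : ℕ → ℂ) (N : ℕ) :
    vdm u (N + 1) = vdm u N * ∏ i ∈ Finset.range N, (u N - u i) := Finset.prod_range_succ _ _

theorem prod_Ioi_eq (f : ℕ → ℕ → ℂ) (N : ℕ) :
    ∏ i : Fin N, ∏ j ∈ Finset.Ioi i, f j i = ∏ j ∈ Finset.range N, ∏ i ∈ Finset.range j, f j i := by
  rw [Finset.prod_comm' (t' := Finset.univ) (s' := fun j => Finset.Iio j) (by simp),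
    ← Fin.prod_univ_eq_prod_range (fun j => ∏ i ∈ Finset.range j, f j i)]
  refine Finset.prod_congr rfl fun j _ => ?_
  rw [← Nat.Iio_eq_range, ← Fin.map_valEmbedding_Iio, Finset.prod_map]
  rfl

theorem expDet_geom (e : ℕ → ℕ) (N : ℕ) (t : ℂ) :
    expDet e N (fun i => t ^ (i : ℕ)) = vdm (fun j => t ^ e j) N := by
  have : (Matrix.of fun i j : Fin N => (t ^ (i : ℕ)) ^ e j) =
      (Matrix.vandermonde fun j : Fin N => t ^ e j).transpose := by
    ext i j
    simp [Matrix.vandermonde, ← pow_mul, mul_comm]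
  rw [expDet, this, Matrix.det_transpose, Matrix.det_vandermonde,
    prod_Ioi_eq (fun j i => t ^ e j - t ^ e i), vdm]

/-- The `q`-integer. -/
def geom (t : ℂ) (a : ℕ) : ℂ := ∑ i ∈ Finset.range a, t ^ i

theorem vdm_pow (e : ℕ → ℕ) (N : ℕ) (t : ℂ) :
    vdm (fun j => t ^ e j) N = (t - 1) ^ (∑ j ∈ Finset.range N, j) * vdm (fun j => geom t (e j)) N := by
  rw [vdm, vdm, ← Finset.prod_pow_eq_pow_sum, ← Finset.prod_mul_distrib]
  refine Finset.prod_congr rfl fun j _ => ?_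
  conv_rhs => rw [← Finset.card_range j, ← Finset.prod_const, Finset.card_range,
    ← Finset.prod_mul_distrib]
  refine Finset.prod_congr rfl fun i _ => ?_
  have h := mul_geom_sum t (e j)
  have h' := mul_geom_sum t (e i)
  rw [geom, geom]
  linear_combination h' - h

theorem continuous_vdm_geom (e : ℕ → ℕ) (N : ℕ) :
    Continuous fun t : ℝ => vdm (fun j => geom t (e j)) N := by
  unfold vdm geom
  fun_prop

theorem good_geom {t : ℝ} (ht : 1 < t) (N : ℕ) :
    Good ((List.range N).map fun i => (t : ℂ) ^ i) := by
  have hinj : ∀ i j : ℕ, ((t : ℂ) ^ i) ^ 3 = ((t : ℂ) ^ j) ^ 3 → i = j := by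
    intro i j h
    rw [← pow_mul, ← pow_mul] at h
    have := pow_right_injective₀ (zero_lt_one.trans ht) ht.ne' (by exact_mod_cast h :
      t ^ (i * 3) = t ^ (j * 3))
    omega
  refine ⟨List.Nodup.map_on (fun i _ j _ h => hinj i j (by rw [h])) List.nodup_range, ?_⟩
  intro x hx y hy h
  obtain ⟨i, -, rfl⟩ := List.mem_map.1 hx
  obtain ⟨j, -, rfl⟩ := List.mem_map.1 hy
  have hij : i = j := hinj i j (by rw [h, mul_pow, ω_cube, one_mul])
  subst hij
  have ht0 : (t : ℂ) ^ i ≠ 0 := pow_ne_zero _ (by exact_mod_cast (zero_lt_one.trans ht).ne')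
  exact one_sub_ω_ne_zero ((mul_eq_zero.1 (by linear_combination h : (1 - ω) * (t : ℂ) ^ i = 0)).resolve_right ht0)

theorem normSum_geom (n : ℕ) {t : ℝ} (ht : 1 < t) :
    normSum n ((List.range (2 * n + 1)).map fun i => (t : ℂ) ^ i) *
        ((-1) ^ n * vdm (fun j => geom t j) (2 * n + 1) ^ 2) =
      ω ^ (2 * (n * (n + 1)) + 2 * n) * (vdm (fun j => geom t (expLow j)) (2 * n + 1) *
        vdm (fun j => geom t (expHigh j)) (2 * n + 1)) := by
  have hg := good_geom ht (2 * n + 1)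
  have ht1 : (t : ℂ) - 1 ≠ 0 := sub_ne_zero.2 (by exact_mod_cast ht.ne')
  set z : Fin (2 * n + 1) → ℂ := fun i => (t : ℂ) ^ (i : ℕ) with hz
  have hinj3 : Function.Injective fun i => z i ^ 3 := by
    intro i j h
    simp only [hz, ← pow_mul] at h
    have := pow_right_injective₀ (zero_lt_one.trans ht) ht.ne' (by exact_mod_cast h :
      t ^ (i.val * 3) = t ^ (j.val * 3))
    exact Fin.ext (by omega)
  have hinj : Function.Injective z := fun i j h => hinj3 (by simp [h])
  have hset : ((List.range (2 * n + 1)).map fun i => (t : ℂ) ^ i).toFinset =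
      Finset.univ.image z := by
    ext a
    simp only [List.mem_toFinset, List.mem_map, List.mem_range, Finset.mem_image, Finset.mem_univ,
      true_and, hz]
    exact ⟨fun ⟨i, hi, h⟩ => ⟨⟨i, hi⟩, h⟩, fun ⟨i, h⟩ => ⟨i, i.2, h⟩⟩
  have hV : ∏ x ∈ Finset.univ.image z, ∏ y ∈ (Finset.univ.image z).erase x, (x - y) =
      (-1) ^ n * vdm (fun j => (t : ℂ) ^ j) (2 * n + 1) ^ 2 := by
    have h1 : ∏ x ∈ Finset.univ.image z, ∏ y ∈ (Finset.univ.image z).erase x, (x - y) =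
        ∏ i, ∏ j ∈ ({i}ᶜ : Finset (Fin (2 * n + 1))), (z i - z j) := by
      rw [Finset.prod_image fun i _ j _ h => hinj h]
      refine Finset.prod_congr rfl fun i _ => ?_
      rw [← Finset.image_erase hinj, Finset.prod_image fun i _ j _ h => hinj h,
        ← show ({i} : Finset _)ᶜ = Finset.univ.erase i by ext; simp]
    rw [h1, ← Finset.prod_prod_Ioi_mul_eq_prod_prod_off_diag (fun j i => z i - z j),
      prod_Ioi_eq (fun j i => ((t : ℂ) ^ i - t ^ j) * (t ^ j - t ^ i)), vdm]
    have hs : ∑ j ∈ Finset.range (2 * n + 1), j = n * (2 * n + 1) := by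
      have := Finset.sum_range_id_mul_two (2 * n + 1)
      rw [Nat.add_sub_cancel] at this
      linarith
    have hneg : ((-1 : ℂ)) ^ n = ∏ j ∈ Finset.range (2 * n + 1), ∏ i ∈ Finset.range j, (-1 : ℂ) := by
      simp only [Finset.prod_const, Finset.card_range]
      rw [Finset.prod_pow_eq_pow_sum, hs, mul_add, mul_one, pow_add]
      have : n * (2 * n) = 2 * (n * n) := by ring
      rw [this, pow_mul]
      simp
    rw [hneg, ← Finset.prod_pow, ← Finset.prod_mul_distrib]
    refine Finset.prod_congr rfl fun j _ => ?_
    rw [← Finset.prod_pow, ← Finset.prod_mul_distrib]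
    exact Finset.prod_congr rfl fun i _ => by ring
  have key := normSum_mul_vandermonde n hg (by simp)
  rw [hset, hV, splitSum_eq_detProd n z (fun i => pow_ne_zero _
    (by exact_mod_cast (zero_lt_one.trans ht).ne')) hinj3, detProd, hz, expDet_geom, expDet_geom,
    vdm_pow, vdm_pow expLow, vdm_pow expHigh] at key
  have hp := pow_ne_zero ((∑ j ∈ Finset.range (2 * n + 1), j) * 2) ht1
  apply mul_right_cancel₀ hp
  rw [pow_mul, pow_add]
  linear_combination key

theorem normSum_one (n : ℕ) :
    normSum n (List.replicate (2 * n + 1) 1) *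
        ((-1) ^ n * vdm (fun j => (j : ℂ)) (2 * n + 1) ^ 2) =
      ω ^ (2 * (n * (n + 1)) + 2 * n) * (vdm (fun j => (expLow j : ℂ)) (2 * n + 1) *
        vdm (fun j => (expHigh j : ℂ)) (2 * n + 1)) := by
  have hgeom : ∀ a, geom ((1 : ℝ) : ℂ) a = a := fun a => by simp [geom]
  have hc : Continuous fun t : ℝ => normSum n ((List.range (2 * n + 1)).map fun i => (t : ℂ) ^ i) := by
    have := continuous_normSum n ((List.range (2 * n + 1)).map fun (i : ℕ) (t : ℝ) => (t : ℂ) ^ i)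
      (fun f hf => by
        obtain ⟨i, -, rfl⟩ := List.mem_map.1 hf
        fun_prop)
    simpa [List.map_map, Function.comp_def] using this
  have hE : Set.EqOn (fun t : ℝ => normSum n ((List.range (2 * n + 1)).map fun i => (t : ℂ) ^ i) *
        ((-1) ^ n * vdm (fun j => geom t j) (2 * n + 1) ^ 2))
      (fun t : ℝ => ω ^ (2 * (n * (n + 1)) + 2 * n) *
        (vdm (fun j => geom t (expLow j)) (2 * n + 1) *
        vdm (fun j => geom t (expHigh j)) (2 * n + 1))) (Set.Ioi 1) :=
    fun t ht => normSum_geom n ht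
  have h := hE.closure (hc.mul (continuous_const.mul ((continuous_vdm_geom id _).pow 2)))
    (continuous_const.mul ((continuous_vdm_geom expLow _).mul (continuous_vdm_geom expHigh _)))
  rw [closure_Ioi] at h
  have := h (Set.self_mem_Ici (a := (1 : ℝ)))
  simp only [hgeom] at this
  rw [← this]
  simp

theorem prod_range_two_mul (f : ℕ → ℂ) (m : ℕ) :
    ∏ i ∈ Finset.range (2 * m), f i = ∏ k ∈ Finset.range m, f (2 * k) * f (2 * k + 1) := by
  induction m with
  | zero => rfl
  | succ m ih =>
    rw [show 2 * (m + 1) = 2 * m + 1 + 1 by ring, Finset.prod_range_succ, Finset.prod_range_succ, ih,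
      Finset.prod_range_succ]
    ring

theorem expLow_even (k : ℕ) : expLow (2 * k) = 3 * k := by simp only [expLow]; omega
theorem expLow_odd (k : ℕ) : expLow (2 * k + 1) = 3 * k + 1 := by simp only [expLow]; omega
theorem expHigh_even (k : ℕ) : expHigh (2 * k) = 3 * k := by simp only [expHigh]; omega
theorem expHigh_odd (k : ℕ) : expHigh (2 * k + 1) = 3 * k + 2 := by simp only [expHigh]; omega

theorem vdm_add_two (u : ℕ → ℂ) (n : ℕ) :
    vdm u (2 * (n + 1) + 1) = vdm u (2 * n + 1) *
      ((u (2 * n + 1) - u (2 * n)) *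
        (∏ k ∈ Finset.range n, (u (2 * n + 1) - u (2 * k)) * (u (2 * n + 1) - u (2 * k + 1))) *
        ∏ k ∈ Finset.range (n + 1),
          (u (2 * (n + 1)) - u (2 * k)) * (u (2 * (n + 1)) - u (2 * k + 1))) := by
  rw [vdm_succ, prod_range_two_mul, show 2 * (n + 1) = 2 * n + 1 + 1 by ring, vdm_succ,
    Finset.prod_range_succ, prod_range_two_mul]
  ring

theorem prod_range_reflect_sub (n : ℕ) (a b : ℂ) :
    ∏ k ∈ Finset.range n, (3 * (n : ℂ) + a - 3 * k) * (3 * (n : ℂ) + b - 3 * k) =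
      ∏ k ∈ Finset.range n, (3 * (k : ℂ) + 3 + a) * (3 * (k : ℂ) + 3 + b) := by
  rw [← Finset.prod_range_reflect]
  refine Finset.prod_congr rfl fun k hk => ?_
  have hk' : k < n := Finset.mem_range.1 hk
  have : ((n - 1 - k : ℕ) : ℂ) = n - 1 - k := by
    rw [Nat.sub_sub, Nat.cast_sub (by omega)]; push_cast; ring
  rw [this]
  ring

theorem factorial_prod (n : ℕ) (a b c d : ℂ)
    (h0 : (3 + c) * (3 + d) = 6)
    (h : ∀ m : ℂ, (3 * m + 3 + a) * (3 * m + 3 + b) * ((3 * (m + 1) + 3 + c) * (3 * (m + 1) + 3 + d)) =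
      (3 * m + 4) * (3 * m + 5) * (3 * m + 6) * (3 * (m + 1))) :
    (∏ k ∈ Finset.range n, (3 * (k : ℂ) + 3 + a) * (3 * (k : ℂ) + 3 + b)) *
      ∏ k ∈ Finset.range (n + 1), (3 * (k : ℂ) + 3 + c) * (3 * (k : ℂ) + 3 + d) =
      ((3 * n + 3).factorial : ℂ) * 3 ^ n * n.factorial := by
  induction n with
  | zero => simp [h0, Nat.factorial]
  | succ n ih =>
    rw [Finset.prod_range_succ, Finset.prod_range_succ _ (n + 1),
      show 3 * (n + 1) + 3 = 3 * n + 3 + 1 + 1 + 1 by ring, Nat.factorial_succ, Nat.factorial_succ,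
      Nat.factorial_succ, Nat.factorial_succ n]
    have := h n
    push_cast
    linear_combination (∏ k ∈ Finset.range n, (3 * (k : ℂ) + 3 + a) * (3 * (k : ℂ) + 3 + b)) *
      (∏ k ∈ Finset.range (n + 1), (3 * (k : ℂ) + 3 + c) * (3 * (k : ℂ) + 3 + d)) * this +
      (3 * (n : ℂ) + 4) * (3 * n + 5) * (3 * n + 6) * (3 * (n + 1)) * ih

theorem vdm_expLow_add_two (n : ℕ) :
    vdm (fun j => (expLow j : ℂ)) (2 * (n + 1) + 1) = vdm (fun j => (expLow j : ℂ)) (2 * n + 1) *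
      (((3 * n + 3).factorial : ℂ) * 3 ^ n * n.factorial) := by
  rw [vdm_add_two, ← factorial_prod n 1 0 0 (-1) (by norm_num) (fun m => by ring)]
  simp only [expLow_even, expLow_odd]
  have h1 := prod_range_reflect_sub n 1 0
  have h2 := prod_range_reflect_sub (n + 1) 0 (-1)
  rw [← h1, ← h2]
  push_cast
  have e : (3 * (n : ℂ) + 1 - 3 * n) = 1 := by ring
  rw [e, one_mul]
  congr 2 <;> refine Finset.prod_congr rfl fun k _ => by ring

theorem vdm_expHigh_add_two (n : ℕ) :
    vdm (fun j => (expHigh j : ℂ)) (2 * (n + 1) + 1) = vdm (fun j => (expHigh j : ℂ)) (2 * n + 1) *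
      (((3 * n + 3).factorial : ℂ) * 3 ^ n * n.factorial) := by
  have h1 := prod_range_reflect_sub n 2 0
  have h2 := prod_range_reflect_sub (n + 1) 0 (-2)
  have h3 : 2 * ((∏ k ∈ Finset.range n, (3 * (k : ℂ) + 3 + 2) * (3 * (k : ℂ) + 3 + 0)) *
      ∏ k ∈ Finset.range (n + 1), (3 * (k : ℂ) + 3 + 0) * (3 * (k : ℂ) + 3 + -2)) =
      ((3 * n + 3).factorial : ℂ) * 3 ^ n * n.factorial := by
    induction n with
    | zero => simp [Nat.factorial]; norm_num
    | succ n ih =>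
      rw [Finset.prod_range_succ, Finset.prod_range_succ _ (n + 1),
        show 3 * (n + 1) + 3 = 3 * n + 3 + 1 + 1 + 1 by ring, Nat.factorial_succ, Nat.factorial_succ,
        Nat.factorial_succ, Nat.factorial_succ n]
      have := ih (prod_range_reflect_sub n 2 0) (prod_range_reflect_sub (n + 1) 0 (-2))
      push_cast
      linear_combination (3 * (n : ℂ) + 4) * (3 * n + 5) * (3 * n + 6) * (3 * (n + 1)) * this
  rw [vdm_add_two, ← h3]
  simp only [expHigh_even, expHigh_odd]
  rw [← h1, ← h2]
  push_cast
  have e : (3 * (n : ℂ) + 2 - 3 * n) = 2 := by ring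
  rw [e, mul_assoc 2]
  congr 3 <;> refine Finset.prod_congr rfl fun k _ => by ring

theorem prod_range_sub_eq_factorial (m : ℕ) :
    ∏ i ∈ Finset.range m, ((m : ℂ) - i) = m.factorial := by
  rw [← Finset.prod_range_reflect, ← Finset.prod_range_add_one_eq_factorial, Nat.cast_prod]
  refine Finset.prod_congr rfl fun k hk => ?_
  have hk' : k < m := Finset.mem_range.1 hk
  rw [Nat.sub_sub, Nat.cast_sub (by omega)]
  push_cast
  ring

theorem vdm_id_add_two (n : ℕ) :
    vdm (fun j => (j : ℂ)) (2 * (n + 1) + 1) = vdm (fun j => (j : ℂ)) (2 * n + 1) *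
      (((2 * n + 1).factorial : ℂ) * (2 * n + 2).factorial) := by
  rw [vdm_succ, show 2 * (n + 1) = 2 * n + 1 + 1 by ring, vdm_succ,
    prod_range_sub_eq_factorial (2 * n + 1 + 1), prod_range_sub_eq_factorial (2 * n + 1)]
  ring

/-- The inverse of the number of half-turn symmetric alternating sign matrices. -/
def invHT (n : ℕ) : ℂ := ∏ j ∈ Finset.Icc 1 n,
  (((2*j-1).factorial : ℂ)^2 * ((2*j).factorial : ℂ)^2) /
    (((j-1).factorial : ℂ) * ((j).factorial : ℂ) * ((3*j-1).factorial : ℂ) *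
      ((3*j).factorial : ℂ))

theorem vdm_mul_invHT (n : ℕ) :
    vdm (fun j => (expLow j : ℂ)) (2 * n + 1) * vdm (fun j => (expHigh j : ℂ)) (2 * n + 1) *
      invHT n = 3 ^ (n ^ 2) * vdm (fun j => (j : ℂ)) (2 * n + 1) ^ 2 := by
  induction n with
  | zero => simp [vdm, invHT]
  | succ n ih =>
    have hI : invHT (n + 1) = invHT n * ((((2 * n + 1).factorial : ℂ) ^ 2 *
        ((2 * n + 2).factorial : ℂ) ^ 2) / ((n.factorial : ℂ) * ((n + 1).factorial : ℂ) *
        ((3 * n + 2).factorial : ℂ) * ((3 * n + 3).factorial : ℂ))) := by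
      rw [invHT, Finset.prod_Icc_succ_top (by omega), ← invHT]
      rfl
    have f1 : ((3 * n + 3).factorial : ℂ) = 3 * (n + 1) * (3 * n + 2).factorial := by
      rw [Nat.factorial_succ]; push_cast; ring
    have f2 : ((n + 1).factorial : ℂ) = (n + 1) * n.factorial := by
      rw [Nat.factorial_succ]; push_cast; ring
    have g1 : (n.factorial : ℂ) ≠ 0 := by exact_mod_cast n.factorial_ne_zero
    have g2 : ((3 * n + 2).factorial : ℂ) ≠ 0 := by exact_mod_cast (3 * n + 2).factorial_ne_zero
    have g3 : (n : ℂ) + 1 ≠ 0 := by exact_mod_cast n.succ_ne_zero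
    have step : (3 * (n + 1) * (3 * n + 2).factorial * 3 ^ n * n.factorial : ℂ) ^ 2 *
        ((((2 * n + 1).factorial : ℂ) ^ 2 *
        ((2 * n + 2).factorial : ℂ) ^ 2) / ((n.factorial : ℂ) * ((n + 1) * n.factorial) *
        ((3 * n + 2).factorial : ℂ) * (3 * (n + 1) * (3 * n + 2).factorial))) =
        3 ^ (2 * n + 1) * (((2 * n + 1).factorial : ℂ) * (2 * n + 2).factorial) ^ 2 := by
      field_simp
      ring
    rw [vdm_expLow_add_two, vdm_expHigh_add_two, vdm_id_add_two, hI, f1, f2,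
      show (n + 1) ^ 2 = n ^ 2 + (2 * n + 1) by ring, pow_add]
    linear_combination (3 * (n + 1) * (3 * n + 2).factorial * 3 ^ n * n.factorial : ℂ) ^ 2 *
        ((((2 * n + 1).factorial : ℂ) ^ 2 *
        ((2 * n + 2).factorial : ℂ) ^ 2) / ((n.factorial : ℂ) * ((n + 1) * n.factorial) *
        ((3 * n + 2).factorial : ℂ) * (3 * (n + 1) * (3 * n + 2).factorial))) * ih +
      3 ^ (n ^ 2) * vdm (fun j => (j : ℂ)) (2 * n + 1) ^ 2 * step

theorem vdm_id_ne_zero (N : ℕ) : vdm (fun j => (j : ℂ)) N ≠ 0 := by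
  refine Finset.prod_ne_zero_iff.2 fun j _ => Finset.prod_ne_zero_iff.2 fun i hi => ?_
  exact sub_ne_zero.2 (Nat.cast_injective.ne (Finset.mem_range.1 hi).ne')

theorem normSum_one_mul_invHT (n : ℕ) :
    normSum n (List.replicate (2 * n + 1) 1) * invHT n =
      phi (List.replicate (n + 1) false ++ List.replicate n true) ^ 2 := by
  have h := normSum_one n
  have h' := vdm_mul_invHT n
  have hv := vdm_id_ne_zero (2 * n + 1)
  have h1 : ((-1 : ℂ) ^ n) * (-1) ^ n = 1 := by rw [← mul_pow]; simp
  have h2 : normSum n (List.replicate (2 * n + 1) 1) * invHT n =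
      (-1) ^ n * ω ^ (2 * (n * (n + 1)) + 2 * n) * 3 ^ (n ^ 2) := by
    apply mul_right_cancel₀ (pow_ne_zero 2 hv)
    linear_combination (-1) ^ n * invHT n * h +
      (-1) ^ n * ω ^ (2 * (n * (n + 1)) + 2 * n) * h' -
      normSum n (List.replicate (2 * n + 1) 1) * invHT n *
        vdm (fun j => (j : ℂ)) (2 * n + 1) ^ 2 * h1
  have h3 : ∀ k, ω ^ (3 * k) = 1 := fun k => by rw [pow_mul, ω_cube, one_pow]
  have h4 : (1 - ω) ^ 2 = -3 * ω := by linear_combination ω_rel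
  have h5 : ((-1 : ℂ)) ^ (n ^ 2) = (-1) ^ n := by
    rcases Nat.even_or_odd n with hn | hn
    · rw [hn.neg_one_pow, (Nat.even_pow.2 ⟨hn, two_ne_zero⟩).neg_one_pow]
    · rw [hn.neg_one_pow, hn.pow.neg_one_pow]
  rw [h2, phi_extreme, mul_pow, ← pow_mul, mul_comm (n ^ 2) 2, pow_mul (1 - ω), h4, mul_pow,
    neg_pow (3 : ℂ), h5, ← pow_mul]
  have h6 : ω ^ (n ^ 2) * ω ^ (2 * n * (n + 1) * 2) =
      ω ^ (2 * (n * (n + 1)) + 2 * n) * ω ^ (3 * n ^ 2) := by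
    rw [← pow_add, ← pow_add]
    congr 1
    ring
  rw [h3, mul_one] at h6
  linear_combination -((-1) ^ n * 3 ^ (n ^ 2)) * h6

/-- The words of length `N`. -/
def words (N : ℕ) : Finset (List Bool) :=
  (Finset.univ : Finset (Fin N → Bool)).map ⟨List.ofFn, List.ofFn_injective⟩

theorem mem_words {N : ℕ} {a : List Bool} : a ∈ words N ↔ a.length = N := by
  constructor
  · intro h
    obtain ⟨f, -, rfl⟩ := Finset.mem_map.1 h
    exact List.length_ofFn
  · rintro rfl
    exact Finset.mem_map.2 ⟨a.get, Finset.mem_univ _, List.ofFn_get a⟩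

theorem sum_words {R : Type*} [AddCommMonoid R] (N : ℕ) (F : List Bool → R) :
    ∑ a ∈ words N, F a = ∑ f : Fin N → Bool, F (List.ofFn f) := Finset.sum_map _ _ _

theorem sum_words_append {R : Type*} [AddCommMonoid R] (p q : ℕ) (F : List Bool → R) :
    ∑ a ∈ words (p + q), F a = ∑ y ∈ words p, ∑ z ∈ words q, F (y ++ z) := by
  rw [← Finset.sum_product']
  symm
  refine Finset.sum_nbij' (fun w => w.1 ++ w.2) (fun a => (a.take p, a.drop p)) ?_ ?_ ?_ ?_ ?_
  · rintro ⟨y, z⟩ h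
    obtain ⟨h1, h2⟩ := Finset.mem_product.1 h
    rw [mem_words] at *
    simp only at h1 h2
    simp [h1, h2]
  · intro a h
    rw [mem_words] at h
    simp [mem_words, h]
  · rintro ⟨y, z⟩ h
    obtain ⟨h1, h2⟩ := Finset.mem_product.1 h
    rw [mem_words] at *
    simp only at h1 h2
    simp [← h1]
  · intro a h
    simp
  · intro w h
    rfl

theorem sum_words_one {R : Type*} [AddCommMonoid R] (F : List Bool → R) :
    ∑ a ∈ words 1, F a = F [true] + F [false] := by
  rw [sum_words, ← (Equiv.funUnique (Fin 1) Bool).symm.sum_comp]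
  simp [List.ofFn_succ]

theorem sum_words_succ {R : Type*} [AddCommMonoid R] (N : ℕ) (F : List Bool → R) :
    ∑ a ∈ words (N + 1), F a = ∑ a ∈ words N, F (true :: a) + ∑ a ∈ words N, F (false :: a) := by
  rw [add_comm N 1, sum_words_append, sum_words_one]
  rfl

theorem sum_words_rotate {R : Type*} [AddCommMonoid R] (N k : ℕ) (F : List Bool → R) :
    ∑ a ∈ words N, F (a.rotate k) = ∑ a ∈ words N, F a := by
  refine Finset.sum_bij (fun a _ => a.rotate k) ?_ ?_ ?_ ?_
  · intro a h
    simpa [mem_words] using h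
  · intro a _ b _ h
    exact List.rotate_injective k h
  · intro b h
    rw [mem_words] at h
    obtain ⟨a, ha⟩ : ∃ a : List Bool, a.rotate k = b := by
      refine ⟨b.rotate (b.length - k % b.length), ?_⟩
      exact List.rotate_eq_iff.2 rfl |>.symm ▸ by simp
    exact ⟨a, mem_words.2 (by rw [← h, ← ha, List.length_rotate]), ha⟩
  · intros; rfl

theorem sumB_replicate_one (N : ℕ) (F : List (Bool × ℂ) → ℂ) :
    sumB (List.replicate N 1) F = ∑ a ∈ words N, F (ones a) := by
  induction N generalizing F with
  | zero =>
    rw [sum_words]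
    simp [sumB, ones]
  | succ N ih =>
    rw [List.replicate_succ, sumB, ih, ih, sum_words_succ]
    simp only [ones_cons]

theorem normSum_ones (n N : ℕ) : normSum n (List.replicate N 1) =
    ∑ a ∈ words N, if a.count true = n then phi a * phi a.reverse else 0 := by
  rw [normSum, sumB_replicate_one]
  refine Finset.sum_congr rfl fun a _ => ?_
  have hu : ∀ b, upProd (ones b) = 1 := by
    intro b
    induction b with
    | nil => rfl
    | cons s b ih => rw [ones_cons, upProd_cons, ih]; simp
  have hr : (ones a).reverse = ones a.reverse := by simp [ones]
  rw [countP_ones, hu, hr, mul_one, phi, phi]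

/-- A rotation-antiperiodic average has nonnegative overlap with the original function. -/
theorem sum_rotate_nonneg (m : ℕ) (g : List Bool → ℝ) :
    0 ≤ ∑ k ∈ Finset.range (2 * m), (-1) ^ k * ∑ a ∈ words (2 * m), g a * g (a.rotate k) := by
  rcases Nat.eq_zero_or_pos m with rfl | hm
  · simp
  set S : List Bool → ℝ := fun a => ∑ k ∈ Finset.range (2 * m), (-1) ^ k * g (a.rotate k) with hS
  have h1 : ∀ a ∈ words (2 * m), S (a.rotate 1) = -S a := by
    intro a ha
    have hl := mem_words.1 ha
    have e : ∀ k, (-1 : ℝ) ^ k * g ((a.rotate 1).rotate k) =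
        -((-1) ^ (k + 1) * g (a.rotate (k + 1))) := by
      intro k
      rw [List.rotate_rotate, add_comm 1 k, pow_succ]
      ring
    simp only [hS, e, Finset.sum_neg_distrib]
    rw [neg_inj]
    have h2 := Finset.sum_range_succ (fun k => (-1 : ℝ) ^ k * g (a.rotate k)) (2 * m)
    have h3 := Finset.sum_range_succ' (fun k => (-1 : ℝ) ^ k * g (a.rotate k)) (2 * m)
    have h4 : a.rotate (2 * m) = a := by rw [← hl, List.rotate_length]
    have h5 : (-1 : ℝ) ^ (2 * m) = 1 := by rw [pow_mul]; simp
    rw [h4, h5] at h2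
    rw [List.rotate_zero, pow_zero] at h3
    linarith
  have h2 : ∀ k, ∀ a ∈ words (2 * m), S (a.rotate k) = (-1) ^ k * S a := by
    intro k
    induction k with
    | zero => intro a _; simp
    | succ k ih =>
      intro a ha
      have ha' : a.rotate k ∈ words (2 * m) := by
        rw [mem_words, List.length_rotate]; exact mem_words.1 ha
      rw [← List.rotate_rotate, h1 _ ha', ih a ha, pow_succ]
      ring
  have h3 : ∑ k ∈ Finset.range (2 * m), (-1) ^ k * ∑ a ∈ words (2 * m), g a * g (a.rotate k) =
      ∑ a ∈ words (2 * m), g a * S a := by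
    simp only [hS, Finset.mul_sum]
    rw [Finset.sum_comm]
    exact Finset.sum_congr rfl fun a _ => Finset.sum_congr rfl fun k _ => by ring
  have h4 : ∑ a ∈ words (2 * m), S a ^ 2 = (2 * m : ℕ) * ∑ a ∈ words (2 * m), g a * S a := by
    calc ∑ a ∈ words (2 * m), S a ^ 2
        = ∑ a ∈ words (2 * m), ∑ k ∈ Finset.range (2 * m), g (a.rotate k) * S (a.rotate k) := by
          refine Finset.sum_congr rfl fun a ha => ?_
          rw [sq, Finset.sum_congr rfl fun k _ => by rw [h2 k a ha]]
          conv_lhs => rw [hS]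
          rw [Finset.sum_mul]
          exact Finset.sum_congr rfl fun k _ => by ring
      _ = _ := by
          rw [Finset.sum_comm, Finset.sum_congr rfl fun k _ =>
            sum_words_rotate (2 * m) k fun a => g a * S a]
          simp
  rw [h3]
  have h5 : 0 ≤ ∑ a ∈ words (2 * m), S a ^ 2 := Finset.sum_nonneg fun a _ => sq_nonneg _
  rw [h4] at h5
  exact nonneg_of_mul_nonneg_right h5 (by exact_mod_cast (by omega : 0 < 2 * m))

/-- Transfers a function on words of odd length to words with one more letter. -/
def growUp (v : List Bool → ℝ) : List Bool → ℝ
  | true :: true :: a => v (false :: a)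
  | _ => 0

/-- Transfers a function on words of odd length to words with one letter less. -/
def shrinkUp (v : List Bool → ℝ) : List Bool → ℝ
  | false :: a => v (true :: true :: a)
  | _ => 0

theorem sum_growUp_mul (N : ℕ) (v F : List Bool → ℝ) :
    ∑ a ∈ words (N + 2), growUp v a * F a = ∑ a ∈ words N, v (false :: a) * F (true :: true :: a) := by
  simp [sum_words_succ, growUp]

theorem sum_shrinkUp_mul (N : ℕ) (v F : List Bool → ℝ) :
    ∑ a ∈ words (N + 1), shrinkUp v a * F a =
      ∑ a ∈ words N, v (true :: true :: a) * F (false :: a) := by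
  simp [sum_words_succ, shrinkUp]

theorem eq_of_rotate_one {R : Type*} {N : ℕ} {v : List Bool → R}
    (hv : ∀ a : List Bool, a.length = N → v (a.rotate 1) = v a) (a b : List Bool)
    (h : (a ++ b).length = N) : v (a ++ b) = v (b ++ a) := by
  have key : ∀ k (c : List Bool), c.length = N → v (c.rotate k) = v c := by
    intro k
    induction k with
    | zero => intro c _; rw [List.rotate_zero]
    | succ k ih =>
      intro c hc
      rw [← List.rotate_rotate, hv _ (by rw [List.length_rotate]; exact hc), ih c hc]
  rw [← key a.length (a ++ b) h, List.rotate_append_length_eq]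

section
variable {m : ℕ} {v : List Bool → ℝ}

theorem growUp_overlap (hv : ∀ a : List Bool, a.length = 2 * m + 3 → v (a.rotate 1) = v a)
    (k : ℕ) (hk : k ≤ 2 * m) :
    ∑ a ∈ words (2 * (m + 2)), growUp v a * growUp v (a.rotate (k + 2)) =
      ∑ y ∈ words k, ∑ z ∈ words (2 * m - k),
        v (true :: true :: y ++ false :: z) * v (true :: true :: z ++ false :: y) := by
  rw [show 2 * (m + 2) = k + (2 * m - k + 2) + 2 by omega,
    sum_growUp_mul _ v fun a => growUp v (a.rotate (k + 2)), sum_words_append]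
  refine Finset.sum_congr rfl fun y hy => ?_
  have hly := mem_words.1 hy
  have h1 : ∀ u : List Bool, (true :: true :: (y ++ u)).rotate (k + 2) = u ++ true :: true :: y := by
    intro u
    have := List.rotate_append_length_eq (true :: true :: y) u
    rwa [List.length_cons, List.length_cons, hly] at this
  simp only [h1]
  have h2 : ∑ u ∈ words (2 * m - k + 2), v (false :: (y ++ u)) * growUp v (u ++ true :: true :: y) =
      ∑ z ∈ words (2 * m - k), v (false :: (y ++ true :: true :: z)) *
        v (false :: (z ++ true :: true :: y)) := by
    simp [sum_words_succ, growUp]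
  rw [h2]
  refine Finset.sum_congr rfl fun z hz => ?_
  have hlz := mem_words.1 hz
  have h3 := eq_of_rotate_one hv (false :: y) (true :: true :: z) (by simp; omega)
  have h4 := eq_of_rotate_one hv (false :: z) (true :: true :: y) (by simp; omega)
  simp only [List.cons_append] at h3 h4 ⊢
  rw [h3, h4, mul_comm]

theorem shrinkUp_overlap (k : ℕ) (hk : k ≤ 2 * m) :
    ∑ a ∈ words (2 * (m + 1)), shrinkUp v a * shrinkUp v (a.rotate (k + 1)) =
      ∑ y ∈ words k, ∑ z ∈ words (2 * m - k),
        v (true :: true :: y ++ false :: z) * v (true :: true :: z ++ false :: y) := by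
  rw [show 2 * (m + 1) = k + (2 * m - k + 1) + 1 by omega,
    sum_shrinkUp_mul _ v fun a => shrinkUp v (a.rotate (k + 1)), sum_words_append]
  refine Finset.sum_congr rfl fun y hy => ?_
  have hly := mem_words.1 hy
  have h1 : ∀ u : List Bool, (false :: (y ++ u)).rotate (k + 1) = u ++ false :: y := by
    intro u
    have := List.rotate_append_length_eq (false :: y) u
    rwa [List.length_cons, hly] at this
  simp only [h1]
  simp [sum_words_succ, shrinkUp]

theorem growUp_overlap_one (hv : ∀ a : List Bool, a.length = 2 * m + 3 → v (a.rotate 1) = v a) :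
    ∑ a ∈ words (2 * (m + 2)), growUp v a * growUp v (a.rotate 1) =
      ∑ y ∈ words (2 * m + 1), v (false :: true :: y) * v (true :: false :: y) := by
  rw [show 2 * (m + 2) = 2 * m + 1 + 1 + 2 by omega,
    sum_growUp_mul _ v fun a => growUp v (a.rotate 1)]
  simp only [List.rotate_cons_succ, List.rotate_zero]
  rw [sum_words_succ]
  simp only [List.cons_append, growUp, mul_zero, Finset.sum_const_zero, add_zero]
  refine Finset.sum_congr rfl fun y hy => ?_
  have hly := mem_words.1 hy
  rw [← List.cons_append, eq_of_rotate_one hv (false :: y) [true] (by simp; omega)]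
  rfl

theorem growUp_overlap_last (hv : ∀ a : List Bool, a.length = 2 * m + 3 → v (a.rotate 1) = v a) :
    ∑ a ∈ words (2 * (m + 2)), growUp v a * growUp v (a.rotate (2 * m + 3)) =
      ∑ y ∈ words (2 * m + 1), v (false :: true :: y) * v (true :: false :: y) := by
  rw [← growUp_overlap_one hv,
    ← sum_words_rotate _ 1 fun a => growUp v a * growUp v (a.rotate (2 * m + 3))]
  refine Finset.sum_congr rfl fun a ha => ?_
  have hl := mem_words.1 ha
  rw [List.rotate_rotate, show 1 + (2 * m + 3) = 2 * (m + 2) by ring, ← hl, List.rotate_length,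
    mul_comm]

/-- Nonnegativity of the shifted bond energy of a translation invariant state. -/
theorem susy_nonneg (hv : ∀ a : List Bool, a.length = 2 * m + 3 → v (a.rotate 1) = v a) :
    0 ≤ ∑ x ∈ words (2 * m + 2), v (false :: x) ^ 2 +
      ∑ y ∈ words (2 * m + 1), v (true :: true :: y) ^ 2 -
      2 * ∑ y ∈ words (2 * m + 1), v (false :: true :: y) * v (true :: false :: y) := by
  have hG := sum_rotate_nonneg (m + 2) (growUp v)
  have hH := sum_rotate_nonneg (m + 1) (shrinkUp v)
  rw [show 2 * (m + 2) = 2 * m + 1 + 1 + 1 + 1 by ring, Finset.sum_range_succ,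
    Finset.sum_range_succ', Finset.sum_range_succ'] at hG
  rw [show 2 * (m + 1) = 2 * m + 1 + 1 by ring, Finset.sum_range_succ'] at hH
  rw [show 2 * m + 1 + 1 + 1 + 1 = 2 * (m + 2) by ring, growUp_overlap_one hv,
    growUp_overlap_last hv] at hG
  rw [show 2 * m + 1 + 1 = 2 * (m + 1) by ring] at hH
  have hc : ∑ k ∈ Finset.range (2 * m + 1), (-1 : ℝ) ^ (k + 1 + 1) *
      ∑ a ∈ words (2 * (m + 2)), growUp v a * growUp v (a.rotate (k + 1 + 1)) =
      -∑ k ∈ Finset.range (2 * m + 1), (-1 : ℝ) ^ (k + 1) *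
      ∑ a ∈ words (2 * (m + 1)), shrinkUp v a * shrinkUp v (a.rotate (k + 1)) := by
    rw [← Finset.sum_neg_distrib]
    refine Finset.sum_congr rfl fun k hk => ?_
    have hk' : k ≤ 2 * m := by have := Finset.mem_range.1 hk; omega
    rw [growUp_overlap hv k hk', shrinkUp_overlap k hk', pow_succ]
    ring
  have hG0 : ∑ a ∈ words (2 * (m + 2)), growUp v a * growUp v (a.rotate 0) =
      ∑ x ∈ words (2 * m + 2), v (false :: x) ^ 2 := by
    simp only [List.rotate_zero]
    rw [show 2 * (m + 2) = 2 * m + 2 + 2 by ring, sum_growUp_mul]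
    simp only [growUp, sq]
  have hH0 : ∑ a ∈ words (2 * (m + 1)), shrinkUp v a * shrinkUp v (a.rotate 0) =
      ∑ y ∈ words (2 * m + 1), v (true :: true :: y) ^ 2 := by
    simp only [List.rotate_zero]
    rw [show 2 * (m + 1) = 2 * m + 1 + 1 by ring, sum_shrinkUp_mul]
    simp only [shrinkUp, sq]
  have hs : (-1 : ℝ) ^ (2 * m + 1 + 1 + 1) = -1 := by
    rw [show 2 * m + 1 + 1 + 1 = 2 * (m + 1) + 1 by ring, pow_succ, pow_mul]; simp
  rw [hc, hG0] at hG
  rw [hH0] at hH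
  rw [hs] at hG
  norm_num at hG hH
  linarith
end

theorem localOp_mulVec (N : ℕ) (i : Fin N) (A : Matrix Bool Bool ℂ) (Ψ : Cfg N → ℂ) (f : Cfg N) :
    (localOp N i A).mulVec Ψ f = ∑ b, A (f i) b * Ψ (Function.update f i b) := by
  rw [Matrix.mulVec, dotProduct]
  have h1 : ∀ g : Cfg N, localOp N i A f g * Ψ g =
      if (∀ j ∈ Finset.univ.erase i, f j = g j) then A (f i) (g i) * Ψ g else 0 := by
    intro g
    rw [localOp, Matrix.of_apply, Finset.prod_ite_zero]
    split_ifs <;> simp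
  simp only [h1]
  rw [← Finset.sum_filter]
  symm
  refine Finset.sum_bij (fun b _ => Function.update f i b) ?_ ?_ ?_ ?_
  · intro b _
    simp only [Finset.mem_filter, Finset.mem_univ, true_and, Finset.mem_erase]
    intro j hj
    rw [Function.update_of_ne hj.1]
  · intro b _ b' _ h
    simpa using congrFun h i
  · intro g hg
    refine ⟨g i, Finset.mem_univ _, ?_⟩
    simp only [Finset.mem_filter, Finset.mem_univ, true_and, Finset.mem_erase] at hg
    ext j
    by_cases hj : j = i
    · subst hj; simp
    · rw [Function.update_of_ne hj, hg j ⟨hj, trivial⟩]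
  · intro b _
    simp

theorem matrix_ext_mulVec {ι : Type*} [Fintype ι] [DecidableEq ι] {A B : Matrix ι ι ℂ}
    (h : ∀ v, A.mulVec v = B.mulVec v) : A = B := by
  ext i j
  simpa using congrFun (h (Pi.single j 1)) i

theorem localOp_comm (N : ℕ) {i j : Fin N} (hij : i ≠ j) (A B : Matrix Bool Bool ℂ) :
    localOp N i A * localOp N j B = localOp N j B * localOp N i A := by
  refine matrix_ext_mulVec fun v => ?_
  ext f
  rw [← Matrix.mulVec_mulVec, ← Matrix.mulVec_mulVec, localOp_mulVec, localOp_mulVec]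
  simp only [localOp_mulVec, Fintype.sum_bool, Function.update_of_ne hij, Function.update_of_ne hij.symm,
    Function.update_comm hij]
  ring

theorem localOp_conjTranspose (N : ℕ) (i : Fin N) (A : Matrix Bool Bool ℂ) :
    (localOp N i A).conjTranspose = localOp N i A.conjTranspose := by
  ext f g
  simp only [Matrix.conjTranspose_apply, localOp, Matrix.of_apply, star_mul', star_prod]
  congr 1
  refine Finset.prod_congr rfl fun j _ => ?_
  by_cases h : f j = g j <;> simp [h, eq_comm]

theorem sigmaX_conjTranspose : sigmaX.conjTranspose = sigmaX := by
  ext b c; cases b <;> cases c <;> simp [sigmaX]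

theorem sigmaY_conjTranspose : sigmaY.conjTranspose = sigmaY := by
  ext b c; cases b <;> cases c <;> simp [sigmaY]

theorem sigmaZ_conjTranspose : sigmaZ.conjTranspose = sigmaZ := by
  ext b c; cases b <;> cases c <;> simp [sigmaZ]

theorem cyc_ne {N : ℕ} (hN : 2 ≤ N) (i : Fin N) : cyc N i ≠ i := by
  intro h
  have h1 := congrArg Fin.val h
  simp only [cyc] at h1
  have h2 := i.isLt
  rcases Nat.lt_or_ge (i.val + 1) N with h3 | h3
  · rw [Nat.mod_eq_of_lt h3] at h1; omega
  · rw [show i.val + 1 = N by omega, Nat.mod_self] at h1; omega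

theorem Hper_isHermitian {N : ℕ} (hN : 2 ≤ N) : (Hper N).IsHermitian := by
  have h : ∀ (i : Fin N) (A : Matrix Bool Bool ℂ), A.conjTranspose = A →
      (localOp N i A * localOp N (cyc N i) A).conjTranspose =
        localOp N i A * localOp N (cyc N i) A := by
    intro i A hA
    rw [Matrix.conjTranspose_mul, localOp_conjTranspose, localOp_conjTranspose, hA,
      localOp_comm N (cyc_ne hN i)]
  rw [Matrix.IsHermitian, Hper, Matrix.conjTranspose_smul, Matrix.conjTranspose_sum]
  simp only [Matrix.conjTranspose_sub, Matrix.conjTranspose_add, Matrix.conjTranspose_smul,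
    h _ _ sigmaX_conjTranspose, h _ _ sigmaY_conjTranspose, h _ _ sigmaZ_conjTranspose]
  simp

/-- The local Hamiltonian density, shifted by `3/4`, at the bond starting at site `i`. -/
def hop {N : ℕ} (i : Fin N) (Ψ : Cfg N → ℂ) (f : Cfg N) : ℂ :=
  if f i = f (cyc N i) then Ψ f else Ψ f / 2 - Ψ (f ∘ Equiv.swap i (cyc N i))

theorem Hper_mulVec {N : ℕ} (hN : 2 ≤ N) (Ψ : Cfg N → ℂ) (f : Cfg N) :
    (Hper N).mulVec Ψ f = ∑ i, hop i Ψ f - 3 * N / 4 * Ψ f := by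
  have hc : (3 * N / 4 * Ψ f : ℂ) = ∑ i : Fin N, 3 / 4 * Ψ f := by
    simp; ring
  rw [hc, ← Finset.sum_sub_distrib, Hper, Matrix.smul_mulVec, Matrix.sum_mulVec, Pi.smul_apply,
    Finset.sum_apply, smul_eq_mul, Finset.mul_sum]
  refine Finset.sum_congr rfl fun i _ => ?_
  have hne := cyc_ne hN i
  have e1 : f i ≠ f (cyc N i) → f ∘ Equiv.swap i (cyc N i) =
      Function.update (Function.update f i (!f i)) (cyc N i) (!f (cyc N i)) := by
    intro h
    ext j
    by_cases hj : j = cyc N i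
    · subst hj; simp; cases hf : f i <;> cases hf' : f (cyc N i) <;> simp_all
    by_cases hj' : j = i
    · subst hj'; simp [Function.update_of_ne hj]
      cases hf : f j <;> cases hf' : f (cyc N j) <;> simp_all
    · simp [Function.update_of_ne hj, Function.update_of_ne hj', Equiv.swap_apply_of_ne_of_ne hj' hj]
  have e2 : ∀ g : Cfg N, ∀ j b, g j = b → Function.update g j b = g := by
    rintro g j b rfl; simp
  rw [Matrix.sub_mulVec, Matrix.add_mulVec, Matrix.smul_mulVec, ← Matrix.mulVec_mulVec,
    ← Matrix.mulVec_mulVec, ← Matrix.mulVec_mulVec]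
  simp only [Pi.sub_apply, Pi.add_apply, Pi.smul_apply, localOp_mulVec, Fintype.sum_bool,
    Function.update_of_ne hne, hop, smul_eq_mul]
  cases hf : f i <;> cases hf' : f (cyc N i)
  · simp [sigmaX, sigmaY, sigmaZ, e2 f _ _ hf, e2 f _ _ hf']
    linear_combination (-1 / 2) * Ψ (Function.update (Function.update f i true) (cyc N i) true) * Complex.I_sq
  · rw [if_neg (by simp), e1 (by simp [hf, hf'])]
    simp [sigmaX, sigmaY, sigmaZ, e2 f _ _ hf, e2 f _ _ hf', hf, hf']
    linear_combination (1 / 2) * Ψ (Function.update (Function.update f i true) (cyc N i) false) * Complex.I_sq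
  · rw [if_neg (by simp), e1 (by simp [hf, hf'])]
    simp [sigmaX, sigmaY, sigmaZ, e2 f _ _ hf, e2 f _ _ hf', hf, hf']
    linear_combination (1 / 2) * Ψ (Function.update (Function.update f i false) (cyc N i) true) * Complex.I_sq
  · simp [sigmaX, sigmaY, sigmaZ, e2 f _ _ hf, e2 f _ _ hf']
    linear_combination (-1 / 2) * Ψ (Function.update (Function.update f i false) (cyc N i) false) * Complex.I_sq

section
open scoped ComplexOrder

theorem count_ofFn_eq_sum {N : ℕ} (f : Cfg N) (b : Bool) :
    (List.ofFn f).count b = ∑ i, if f i = b then 1 else 0 := by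
  induction N with
  | zero => simp
  | succ N ih =>
    rw [List.ofFn_succ, List.count_cons, ih, Fin.sum_univ_succ, add_comm]
    simp

theorem exists_perm_of_count_eq {N : ℕ} {f g : Cfg N}
    (h : (List.ofFn f).count true = (List.ofFn g).count true) :
    ∃ σ : Equiv.Perm (Fin N), g = f ∘ σ := by
  have hl : ∀ f : Cfg N, (List.ofFn f).count true + (List.ofFn f).count false = N := by
    intro f
    rw [count_ofFn_eq_sum, count_ofFn_eq_sum, ← Finset.sum_add_distrib]
    rw [Finset.sum_congr rfl (g := fun _ => 1) fun i _ => by cases f i <;> rfl]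
    simp
  have hc : ∀ b, (List.ofFn g).count b = (List.ofFn f).count b := by
    intro b
    have h1 := hl f
    have h2 := hl g
    cases b <;> omega
  have e : ∀ b, Nonempty ({i // g i = b} ≃ {i // f i = b}) := by
    intro b
    refine ⟨Fintype.equivOfCardEq ?_⟩
    have h1 := hc b
    rw [count_ofFn_eq_sum, count_ofFn_eq_sum, ← Finset.card_filter, ← Finset.card_filter] at h1
    rwa [Fintype.card_subtype, Fintype.card_subtype]
  refine ⟨Equiv.ofFiberEquiv fun b => (e b).some, ?_⟩
  ext i
  exact (Equiv.ofFiberEquiv_map _ i).symm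

/-- The Hamiltonian shifted by its smallest eigenvalue is positive semidefinite. -/
theorem shifted_posSemidef {N : ℕ} (hN : 2 ≤ N) {E₀ : ℝ}
    (hmin : ∀ (E : ℂ) (v : Cfg N → ℂ), v ≠ 0 → (Hper N).mulVec v = E • v → E₀ ≤ E.re) :
    (Hper N - (E₀ : ℂ) • 1).PosSemidef := by
  have hA : (Hper N - (E₀ : ℂ) • 1).IsHermitian := by
    refine (Hper_isHermitian hN).sub ?_
    rw [Matrix.IsHermitian, Matrix.conjTranspose_smul]
    simp
  refine hA.posSemidef_iff_eigenvalues_nonneg.2 fun j => ?_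
  have h1 := hA.mulVec_eigenvectorBasis j
  have h2 : (⇑(hA.eigenvectorBasis j) : Cfg N → ℂ) ≠ 0 := by
    intro h
    refine hA.eigenvectorBasis.orthonormal.ne_zero j ?_
    ext i
    exact congrFun h i
  have h3 := hmin (hA.eigenvalues j + E₀ : ℂ) _ h2 (by
    rw [Matrix.sub_mulVec, Matrix.smul_mulVec, Matrix.one_mulVec, sub_eq_iff_eq_add] at h1
    rw [h1, add_smul]
    rfl)
  simp at h3
  simpa using h3

theorem shifted_mulVec_eq_zero {N : ℕ} {E₀ : ℝ} {v : Cfg N → ℂ} :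
    (Hper N - (E₀ : ℂ) • 1).mulVec v = 0 ↔ (Hper N).mulVec v = (E₀ : ℂ) • v := by
  rw [Matrix.sub_mulVec, Matrix.smul_mulVec, Matrix.one_mulVec, sub_eq_zero]

/-- The modulus of a vector. -/
def absVec {N : ℕ} (w : Cfg N → ℂ) : Cfg N → ℂ := fun f => ((‖w f‖ : ℝ) : ℂ)

theorem hop_abs_le {N : ℕ} (i : Fin N) (w : Cfg N → ℂ) (f : Cfg N) :
    (star (absVec w f) * hop i (absVec w) f).re ≤ (star (w f) * hop i w f).re := by
  have h1 : (star (w f) * w f).re = ‖w f‖ ^ 2 := by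
    rw [Complex.star_def, ← Complex.normSq_eq_conj_mul_self, Complex.ofReal_re,
      Complex.normSq_eq_norm_sq]
  simp only [hop]
  split_ifs with h
  · rw [h1]
    simp [absVec, sq]
  · have h2 := Complex.re_le_norm (star (w f) * w (f ∘ Equiv.swap i (cyc N i)))
    rw [norm_mul, norm_star] at h2
    rw [mul_sub, mul_sub, Complex.sub_re, Complex.sub_re, ← mul_div_assoc, ← mul_div_assoc]
    have h3 : (star (w f) * w f / 2).re = ‖w f‖ ^ 2 / 2 := by
      rw [← h1]; simp
    rw [h3]
    simp only [absVec, Complex.star_def, Complex.conj_ofReal, ← Complex.ofReal_mul, Complex.ofReal_re]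
    have h4 : (((‖w f‖ * ‖w f‖ : ℝ) : ℂ) / 2).re = ‖w f‖ ^ 2 / 2 := by
      rw [← Complex.ofReal_ofNat, ← Complex.ofReal_div, Complex.ofReal_re, sq]
    rw [h4]
    simp only [Complex.star_def] at h2
    linarith

theorem shifted_energy_re {N : ℕ} (hN : 2 ≤ N) (E₀ : ℝ) (w : Cfg N → ℂ) :
    (star w ⬝ᵥ (Hper N - (E₀ : ℂ) • 1).mulVec w).re =
      ∑ f, ∑ i, (star (w f) * hop i w f).re - (3 * N / 4 + E₀) * ∑ f, ‖w f‖ ^ 2 := by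
  rw [dotProduct, Complex.re_sum, Finset.mul_sum, ← Finset.sum_sub_distrib]
  refine Finset.sum_congr rfl fun f _ => ?_
  rw [Matrix.sub_mulVec, Matrix.smul_mulVec, Matrix.one_mulVec, Pi.sub_apply, Hper_mulVec hN,
    Pi.smul_apply, Pi.star_apply, ← Complex.re_sum, ← Finset.mul_sum]
  have h1 : star (w f) * w f = ((‖w f‖ ^ 2 : ℝ) : ℂ) := by
    rw [Complex.star_def, ← Complex.normSq_eq_conj_mul_self, Complex.normSq_eq_norm_sq]
  have h2 : star (w f) * (∑ i, hop i w f - 3 * N / 4 * w f - (E₀ : ℂ) • w f) =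
      star (w f) * ∑ i, hop i w f - (((3 * N / 4 + E₀) * ‖w f‖ ^ 2 : ℝ) : ℂ) := by
    push_cast at h1 ⊢
    rw [smul_eq_mul]
    linear_combination (-(3 * N / 4 : ℂ) - E₀) * h1
  rw [h2, Complex.sub_re, Complex.ofReal_re]

theorem ground_abs {N : ℕ} (hN : 2 ≤ N) {E₀ : ℝ}
    (hA : (Hper N - (E₀ : ℂ) • 1).PosSemidef) {w : Cfg N → ℂ}
    (hw : (Hper N).mulVec w = (E₀ : ℂ) • w) :
    (Hper N).mulVec (absVec w) = (E₀ : ℂ) • absVec w := by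
  rw [← shifted_mulVec_eq_zero, ← hA.dotProduct_mulVec_zero_iff]
  have h0 := hA.dotProduct_mulVec_nonneg (absVec w)
  have h1 := shifted_energy_re hN E₀ w
  rw [shifted_mulVec_eq_zero.2 hw, dotProduct_zero, Complex.zero_re] at h1
  have h2 := shifted_energy_re hN E₀ (absVec w)
  have h3 : ∑ f, ∑ i, (star (absVec w f) * hop i (absVec w) f).re ≤
      ∑ f, ∑ i, (star (w f) * hop i w f).re :=
    Finset.sum_le_sum fun f _ => Finset.sum_le_sum fun i _ => hop_abs_le i w f
  have h4 : ∀ f, ‖absVec w f‖ = ‖w f‖ := fun f => by simp [absVec]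
  simp only [h4] at h2
  have h5 := (Complex.nonneg_iff.1 h0)
  refine Complex.ext ?_ h5.2.symm
  rw [Complex.zero_re]
  linarith [h5.1]

theorem ground_zero_spread {N : ℕ} (hN : 2 ≤ N) {E₀ : ℝ} {r : Cfg N → ℝ} (hr : ∀ f, 0 ≤ r f)
    (hw : (Hper N).mulVec (fun f => (r f : ℂ)) = (E₀ : ℂ) • fun f => (r f : ℂ))
    {f : Cfg N} (hf : r f = 0) (i : Fin N) : r (f ∘ Equiv.swap i (cyc N i)) = 0 := by
  by_cases h : f i = f (cyc N i)
  · rw [← hf]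
    congr 1
    ext j
    rw [Function.comp_apply, Equiv.swap_apply_def]
    split_ifs with h1 h2
    · rw [h1, h]
    · rw [h2, h]
    · rfl
  have h1 := congrFun hw f
  rw [Hper_mulVec hN, Pi.smul_apply, hf] at h1
  have h2 : ∀ i : Fin N, hop i (fun f => (r f : ℂ)) f =
      ((if f i = f (cyc N i) then 0 else -r (f ∘ Equiv.swap i (cyc N i)) : ℝ) : ℂ) := by
    intro i
    rw [hop]
    split_ifs <;> simp [hf]
  simp only [h2, Complex.ofReal_zero, mul_zero, smul_zero, sub_zero] at h1
  rw [← Complex.ofReal_sum, Complex.ofReal_eq_zero] at h1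
  have h3 : ∀ i ∈ (Finset.univ : Finset (Fin N)),
      (if f i = f (cyc N i) then 0 else -r (f ∘ Equiv.swap i (cyc N i)) : ℝ) ≤ 0 := by
    intro i _
    split_ifs
    · rfl
    · linarith [hr (f ∘ Equiv.swap i (cyc N i))]
  have h4 := (Finset.sum_eq_zero_iff_of_nonpos h3).1 h1 i (Finset.mem_univ i)
  rw [if_neg h] at h4
  linarith

theorem ground_zero_perm {N : ℕ} (hN : 2 ≤ N) {E₀ : ℝ} {r : Cfg N → ℝ} (hr : ∀ f, 0 ≤ r f)
    (hw : (Hper N).mulVec (fun f => (r f : ℂ)) = (E₀ : ℂ) • fun f => (r f : ℂ))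
    (σ : Equiv.Perm (Fin N)) : ∀ f : Cfg N, r f = 0 → r (f ∘ σ) = 0 := by
  obtain ⟨M, rfl⟩ : ∃ M, N = M + 1 := ⟨N - 1, by omega⟩
  have hσ : σ ∈ Submonoid.closure
      (Set.range fun i : Fin M => Equiv.swap i.castSucc i.succ) := by
    rw [Equiv.Perm.mclosure_swap_castSucc_succ]
    trivial
  induction hσ using Submonoid.closure_induction with
  | mem τ h =>
    obtain ⟨i, rfl⟩ := h
    intro f hf
    have h1 : cyc (M + 1) i.castSucc = i.succ := by
      ext
      simp only [cyc, Fin.val_castSucc, Fin.val_succ]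
      exact Nat.mod_eq_of_lt (by omega)
    have h2 := ground_zero_spread hN hr hw hf i.castSucc
    rwa [h1] at h2
  | one => exact fun f hf => hf
  | mul τ ρ _ _ h1 h2 => exact fun f hf => h2 _ (h1 f hf)

/-- A ground state in the sector with `m` up spins. -/
def IsGround (N : ℕ) (E₀ : ℝ) (m : ℕ) (w : Cfg N → ℂ) : Prop :=
  (Hper N).mulVec w = (E₀ : ℂ) • w ∧ ∀ f, (List.ofFn f).count true ≠ m → w f = 0

theorem IsGround.abs {N : ℕ} (hN : 2 ≤ N) {E₀ : ℝ} (hA : (Hper N - (E₀ : ℂ) • 1).PosSemidef)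
    {m : ℕ} {w : Cfg N → ℂ} (hw : IsGround N E₀ m w) : IsGround N E₀ m (absVec w) :=
  ⟨ground_abs hN hA hw.1, fun f hf => by simp [absVec, hw.2 f hf]⟩

theorem IsGround.eq_zero {N : ℕ} (hN : 2 ≤ N) {E₀ : ℝ} (hA : (Hper N - (E₀ : ℂ) • 1).PosSemidef)
    {m : ℕ} {w : Cfg N → ℂ} (hw : IsGround N E₀ m w) {f : Cfg N}
    (hf : (List.ofFn f).count true = m) (h0 : w f = 0) : w = 0 := by
  ext g
  by_cases hg : (List.ofFn g).count true = m
  · obtain ⟨σ, rfl⟩ := exists_perm_of_count_eq (hf.trans hg.symm)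
    have := ground_zero_perm hN (r := fun f => ‖w f‖) (fun f => norm_nonneg _)
      (ground_abs hN hA hw.1) σ f (by simp [h0])
    simpa using this
  · exact hw.2 g hg

/-- The Perron–Frobenius theorem: ground states in a sector are proportional. -/
theorem IsGround.proportional {N : ℕ} (hN : 2 ≤ N) {E₀ : ℝ}
    (hA : (Hper N - (E₀ : ℂ) • 1).PosSemidef)
    {m : ℕ} {u v : Cfg N → ℂ} (hu : IsGround N E₀ m u) (hv : IsGround N E₀ m v) {f : Cfg N}
    (hf : (List.ofFn f).count true = m) (g : Cfg N) : u f * v g = v f * u g := by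
  have h : IsGround N E₀ m (u f • v - v f • u) := by
    refine ⟨?_, fun g hg => ?_⟩
    · rw [Matrix.mulVec_sub, Matrix.mulVec_smul, Matrix.mulVec_smul, hu.1, hv.1, smul_sub,
        smul_comm, smul_comm (v f)]
    · simp [hu.2 g hg, hv.2 g hg]
  have h0 := h.eq_zero hN hA hf (by simp [mul_comm])
  have := congrFun h0 g
  simpa [sub_eq_zero] using this
end

section
open scoped ComplexOrder

theorem cyc_injective (N : ℕ) : Function.Injective (cyc N) := by
  intro i j h
  have h1 : (i.val + 1) % N = (j.val + 1) % N := congrArg Fin.val h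
  have hi := i.isLt
  have hj := j.isLt
  ext
  rcases Nat.lt_or_ge (i.val + 1) N with h2 | h2 <;> rcases Nat.lt_or_ge (j.val + 1) N with h3 | h3
  · rw [Nat.mod_eq_of_lt h2, Nat.mod_eq_of_lt h3] at h1; omega
  · rw [Nat.mod_eq_of_lt h2, show j.val + 1 = N by omega, Nat.mod_self] at h1; omega
  · rw [Nat.mod_eq_of_lt h3, show i.val + 1 = N by omega, Nat.mod_self] at h1; omega
  · omega

/-- The translation of the sites by one. -/
def cycPerm (N : ℕ) : Equiv.Perm (Fin N) :=
  Equiv.ofBijective (cyc N) (Finite.injective_iff_bijective.1 (cyc_injective N))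

/-- Permutations of the sites mapping bonds to bonds commute with the Hamiltonian. -/
theorem Hper_mulVec_comp {N : ℕ} (hN : 2 ≤ N) (τ e : Equiv.Perm (Fin N))
    (h : ∀ j, (τ j = e j ∧ τ (cyc N j) = cyc N (e j)) ∨ (τ j = cyc N (e j) ∧ τ (cyc N j) = e j))
    (Ψ : Cfg N → ℂ) (f : Cfg N) :
    (Hper N).mulVec (fun g => Ψ (g ∘ τ)) f = (Hper N).mulVec Ψ (f ∘ τ) := by
  rw [Hper_mulVec hN, Hper_mulVec hN, ← Equiv.sum_comp e]
  congr 1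
  refine Finset.sum_congr rfl fun j _ => ?_
  have hs : (f ∘ τ) ∘ Equiv.swap j (cyc N j) = (f ∘ Equiv.swap (τ j) (τ (cyc N j))) ∘ τ := by
    ext i
    simp only [Function.comp_apply]
    exact congrArg f (by simp [Equiv.swap_apply_def, apply_ite τ])
  rw [hop, hop, hs]
  simp only [Function.comp_apply]
  rcases h j with ⟨h1, h2⟩ | ⟨h1, h2⟩
  · simp only [h1, h2]
  · simp only [h1, h2]
    rw [Equiv.swap_comm]
    simp only [eq_comm]

theorem IsGround.comp {N : ℕ} (hN : 2 ≤ N) {E₀ : ℝ} {m : ℕ} {w : Cfg N → ℂ}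
    (hw : IsGround N E₀ m w) (τ e : Equiv.Perm (Fin N))
    (h : ∀ j, (τ j = e j ∧ τ (cyc N j) = cyc N (e j)) ∨ (τ j = cyc N (e j) ∧ τ (cyc N j) = e j)) :
    IsGround N E₀ m fun f => w (f ∘ τ) := by
  refine ⟨?_, fun f hf => hw.2 _ ?_⟩
  · ext f
    rw [Hper_mulVec_comp hN τ e h, hw.1]
    rfl
  · rwa [(Equiv.Perm.ofFn_comp_perm τ f).count_eq]

theorem IsGround.abs_comp {N : ℕ} (hN : 2 ≤ N) {E₀ : ℝ}
    (hA : (Hper N - (E₀ : ℂ) • 1).PosSemidef) {m : ℕ} {w : Cfg N → ℂ}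
    (hw : IsGround N E₀ m w) (hw0 : w ≠ 0) (τ e : Equiv.Perm (Fin N))
    (h : ∀ j, (τ j = e j ∧ τ (cyc N j) = cyc N (e j)) ∨ (τ j = cyc N (e j) ∧ τ (cyc N j) = e j))
    (f : Cfg N) : absVec w (f ∘ τ) = absVec w f := by
  have ha := hw.abs hN hA
  have hb := ha.comp hN τ e h
  by_cases hf : (List.ofFn f).count true = m
  · have h1 := fun g => ha.proportional hN hA hb hf g
    have h2 : ∑ g, absVec w f * absVec w (g ∘ τ) = ∑ g, absVec w (f ∘ τ) * absVec w g :=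
      Finset.sum_congr rfl fun g _ => h1 g
    have h3 : ∑ g : Cfg N, absVec w (g ∘ τ) = ∑ g, absVec w g :=
      (Equiv.arrowCongr τ.symm (Equiv.refl Bool)).sum_comp (absVec w)
    rw [← Finset.mul_sum, ← Finset.mul_sum, h3] at h2
    refine (mul_right_cancel₀ ?_ h2).symm
    simp only [absVec]
    rw [← Complex.ofReal_sum, Complex.ofReal_ne_zero]
    intro h0
    refine hw0 (funext fun g => ?_)
    exact norm_eq_zero.1 ((Finset.sum_eq_zero_iff_of_nonneg fun _ _ => norm_nonneg _).1 h0 g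
      (Finset.mem_univ g))
  · exact (hb.2 f hf).trans (ha.2 f hf).symm

theorem ofFn_comp_cyc {N : ℕ} (f : Cfg N) : List.ofFn (f ∘ cyc N) = (List.ofFn f).rotate 1 := by
  refine List.ext_getElem (by simp) fun k h1 h2 => ?_
  simp [List.getElem_rotate, cyc]

theorem ofFn_comp_rev {N : ℕ} (f : Cfg N) : List.ofFn (f ∘ Fin.rev) = (List.ofFn f).reverse := by
  refine List.ext_getElem (by simp) fun k h1 h2 => ?_
  simp only [List.getElem_ofFn, List.getElem_reverse, Function.comp_apply]
  congr 1
  ext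
  simp [Fin.val_rev]
  omega

theorem IsGround.abs_cyc {N : ℕ} (hN : 2 ≤ N) {E₀ : ℝ}
    (hA : (Hper N - (E₀ : ℂ) • 1).PosSemidef) {m : ℕ} {w : Cfg N → ℂ}
    (hw : IsGround N E₀ m w) (hw0 : w ≠ 0) (f : Cfg N) :
    absVec w (f ∘ cyc N) = absVec w f :=
  hw.abs_comp hN hA hw0 (cycPerm N) (cycPerm N) (fun _ => Or.inl ⟨rfl, rfl⟩) f

theorem IsGround.abs_rev {N : ℕ} (hN : 2 ≤ N) {E₀ : ℝ}
    (hA : (Hper N - (E₀ : ℂ) • 1).PosSemidef) {m : ℕ} {w : Cfg N → ℂ}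
    (hw : IsGround N E₀ m w) (hw0 : w ≠ 0) (f : Cfg N) :
    absVec w (f ∘ Fin.rev) = absVec w f := by
  refine hw.abs_comp hN hA hw0 Fin.revPerm (Fin.revPerm * cycPerm N) (fun j => Or.inr ⟨?_, rfl⟩) f
  change Fin.rev j = cyc N (Fin.rev (cyc N j))
  have hj := j.isLt
  ext
  simp only [cyc, Fin.val_rev]
  rcases Nat.lt_or_ge (j.val + 1) N with h | h
  · rw [Nat.mod_eq_of_lt h, Nat.mod_eq_of_lt (by omega)]; omega
  · rw [show j.val + 1 = N by omega, Nat.mod_self, show N - (0 + 1) + 1 = N by omega, Nat.mod_self]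
    omega

theorem rotate_invariant {R : Type*} {N : ℕ} {v : List Bool → R}
    (hv : ∀ a : List Bool, a.length = N → v (a.rotate 1) = v a) (k : ℕ) :
    ∀ a : List Bool, a.length = N → v (a.rotate k) = v a := by
  induction k with
  | zero => intro a _; rw [List.rotate_zero]
  | succ k ih =>
    intro a ha
    rw [← List.rotate_rotate, hv _ (by rw [List.length_rotate]; exact ha), ih a ha]

theorem hop_eq_bond {N : ℕ} (hN : 2 ≤ N) {φ : List Bool → ℂ}
    (hφ : ∀ a : List Bool, a.length = N → φ (a.rotate 1) = φ a) (i : Fin N) (f : Cfg N) :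
    hop i (fun g => φ (List.ofFn g)) f = bond φ ((List.ofFn f).rotate i) := by
  have hne := cyc_ne hN i
  have hget : ∀ (g : Cfg N) (k : ℕ) (hk : k < ((List.ofFn g).rotate i).length),
      ((List.ofFn g).rotate i)[k] = g ⟨(k + i) % N, Nat.mod_lt _ (by omega)⟩ := by
    intro g k hk
    simp [List.getElem_rotate]
  have hc : ∀ h, (⟨(0 + 1 + i.val) % N, h⟩ : Fin N) = cyc N i := by
    intro h; ext; simp [cyc, add_comm]
  have hi : ∀ h, (⟨(0 + i.val) % N, h⟩ : Fin N) = i := by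
    intro h; ext; simp [Nat.mod_eq_of_lt i.isLt]
  obtain ⟨s, t, c, hb⟩ : ∃ s t c, (List.ofFn f).rotate i = s :: t :: c := by
    have hl : ((List.ofFn f).rotate i).length = N := by simp
    match h : (List.ofFn f).rotate i with
    | [] => rw [h] at hl; simp at hl; omega
    | [_] => rw [h] at hl; simp at hl; omega
    | s :: t :: c => exact ⟨s, t, c, rfl⟩
  have hl : c.length + 2 = N := by
    have := congrArg List.length hb
    simpa using this.symm
  have hs : f i = s := by
    have := hget f 0 (by simp; omega)
    simp only [hb, List.getElem_cons_zero, hi] at this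
    exact this.symm
  have ht : f (cyc N i) = t := by
    have := hget f (0 + 1) (by simp; omega)
    simp only [hb, List.getElem_cons_succ, List.getElem_cons_zero, hc] at this
    exact this.symm
  have hswap : (List.ofFn (f ∘ Equiv.swap i (cyc N i))).rotate i = t :: s :: c := by
    refine List.ext_getElem (by simp [hl]) fun k h1 h2 => ?_
    rw [hget]
    match k with
    | 0 => rw [hi]; simp [ht]
    | 0 + 1 => rw [hc]; simp [hs]
    | k + 2 =>
      have hk : k + 2 < N := by simpa using h1
      have h3 := hget f (k + 2) (by simpa using h1)
      simp only [hb, List.getElem_cons_succ] at h3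
      rw [List.getElem_cons_succ, List.getElem_cons_succ, h3, Function.comp_apply]
      have hii := i.isLt
      rw [Equiv.swap_apply_of_ne_of_ne]
      · intro h
        have h4 : (k + 2 + i.val) % N = i.val := congrArg Fin.val h
        have h5 : (k + 2 + i.val) % N = (0 + i.val) % N := by
          rw [h4, zero_add, Nat.mod_eq_of_lt hii]
        have h6 : (k + 2) % N = 0 % N := Nat.ModEq.add_right_cancel' i.val h5
        rw [Nat.mod_eq_of_lt hk, Nat.zero_mod] at h6
        omega
      · intro h
        have h4 : (k + 2 + i.val) % N = (i.val + 1) % N := congrArg Fin.val h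
        rw [add_comm i.val] at h4
        have h6 : (k + 2) % N = 1 % N := Nat.ModEq.add_right_cancel' i.val h4
        rw [Nat.mod_eq_of_lt hk, Nat.mod_eq_of_lt (by omega)] at h6
        omega
  have e1 : φ (List.ofFn f) = φ (s :: t :: c) := by
    rw [← hb, rotate_invariant hφ i _ List.length_ofFn]
  have e2 : φ (List.ofFn (f ∘ Equiv.swap i (cyc N i))) = φ (t :: s :: c) := by
    rw [← hswap, rotate_invariant hφ i _ List.length_ofFn]
  rw [hb, hop, bond, hs, ht, e1, e2]

theorem sum_mul_bond_nonneg {m : ℕ} {v : List Bool → ℝ}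
    (hv : ∀ a : List Bool, a.length = 2 * m + 3 → v (a.rotate 1) = v a) :
    0 ≤ ∑ a ∈ words (2 * m + 3), ((v a : ℂ) * bond (fun a => (v a : ℂ)) a).re := by
  have h1 := susy_nonneg hv
  have h2 : ∑ y ∈ words (2 * m + 1), v (true :: false :: y) ^ 2 =
      ∑ y ∈ words (2 * m + 1), v (false :: true :: y) ^ 2 := by
    set F : List Bool → ℝ := fun a => match a with
      | true :: _ => v a ^ 2
      | _ => 0 with hF
    have h3 := sum_words_rotate (2 * m + 1 + 1 + 1) 1 F
    simp only [sum_words_succ (2 * m + 1 + 1), sum_words_succ (2 * m + 1), List.rotate_cons_succ,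
      List.rotate_zero, List.cons_append, hF, Finset.sum_const_zero, add_zero] at h3
    have h4 : ∀ s : Bool, ∑ y ∈ words (2 * m + 1), v (true :: (y ++ [s])) ^ 2 =
        ∑ y ∈ words (2 * m + 1), v (s :: true :: y) ^ 2 := by
      intro s
      refine Finset.sum_congr rfl fun y hy => ?_
      have hl := mem_words.1 hy
      rw [← List.cons_append, eq_of_rotate_one hv (true :: y) [s] (by simp; omega)]
      rfl
    rw [h4, h4] at h3
    linarith
  have h3 : ∀ a, ((v a : ℂ) * bond (fun a => (v a : ℂ)) a).re = v a * match a with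
      | s :: t :: a => if s = t then v (s :: t :: a) else v (s :: t :: a) / 2 - v (t :: s :: a)
      | _ => 0 := by
    intro a
    rw [Complex.re_ofReal_mul]
    congr 1
    match a with
    | [] => rfl
    | [_] => rfl
    | s :: t :: a =>
      simp only [bond]
      split_ifs
      · simp
      · rw [Complex.sub_re, Complex.ofReal_re, ← Complex.ofReal_ofNat, ← Complex.ofReal_div,
          Complex.ofReal_re]
  simp only [h3]
  rw [show 2 * m + 3 = 2 * m + 1 + 1 + 1 by ring]
  rw [show 2 * m + 2 = 2 * m + 1 + 1 by ring] at h1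
  simp only [sum_words_succ (2 * m + 1 + 1), sum_words_succ (2 * m + 1), if_true,
    reduceCtorEq, if_false] at h1 ⊢
  have h5 : ∑ y ∈ words (2 * m + 1), v (true :: false :: y) *
      (v (true :: false :: y) / 2 - v (false :: true :: y)) =
      (∑ y ∈ words (2 * m + 1), v (true :: false :: y) ^ 2) / 2 -
      ∑ y ∈ words (2 * m + 1), v (false :: true :: y) * v (true :: false :: y) := by
    rw [Finset.sum_div, ← Finset.sum_sub_distrib]
    exact Finset.sum_congr rfl fun y _ => by ring
  have h6 : ∑ y ∈ words (2 * m + 1), v (false :: true :: y) *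
      (v (false :: true :: y) / 2 - v (true :: false :: y)) =
      (∑ y ∈ words (2 * m + 1), v (false :: true :: y) ^ 2) / 2 -
      ∑ y ∈ words (2 * m + 1), v (false :: true :: y) * v (true :: false :: y) := by
    rw [Finset.sum_div, ← Finset.sum_sub_distrib]
    exact Finset.sum_congr rfl fun y _ => by ring
  simp only [sq] at h1 h2 h5 h6
  rw [h5, h6, h2]
  linarith
end

section
open scoped ComplexOrder

theorem exists_ofFn {N : ℕ} {a : List Bool} (h : a.length = N) : ∃ f : Cfg N, List.ofFn f = a := by
  obtain ⟨f, -, hf⟩ := Finset.mem_map.1 (mem_words.2 h)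
  exact ⟨f, hf⟩

/-- The restriction of `phi` to its magnetization sector. -/
def phiSector (a : List Bool) : ℂ := if 2 * a.count true + 1 = a.length then phi a else 0

theorem phiSector_rotate_one (a : List Bool) : phiSector (a.rotate 1) = phiSector a := by
  rw [phiSector, phiSector, (a.rotate_perm 1).count_eq, List.length_rotate]
  split_ifs with h
  · exact phi_rotate_one a h
  · rfl

theorem bond_phiSector (a : List Bool) :
    bond phiSector a = if 2 * a.count true + 1 = a.length then bond phi a else 0 := by
  match a with
  | [] => simp [bond]
  | [_] => simp [bond]
  | s :: t :: a =>
    have hc : (t :: s :: a).count true = (s :: t :: a).count true := (List.Perm.swap s t a).count_eq true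
    have hl : (t :: s :: a).length = (s :: t :: a).length := rfl
    simp only [bond, phiSector, hc, hl]
    split_ifs <;> simp

/-- The explicit ground state. -/
def phiVec (N : ℕ) : Cfg N → ℂ := fun f => phiSector (List.ofFn f)

theorem Hper_mulVec_phiVec (n : ℕ) (hn : 1 ≤ n) :
    (Hper (2 * n + 1)).mulVec (phiVec (2 * n + 1)) =
      (-(3 * (2 * n + 1 : ℕ) / 4 : ℂ)) • phiVec (2 * n + 1) := by
  ext f
  have hs : ∑ i, hop i (phiVec (2 * n + 1)) f = 0 := by
    have h1 : ∀ i, hop i (phiVec (2 * n + 1)) f = bond phiSector ((List.ofFn f).rotate i) :=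
      fun i => hop_eq_bond (by omega) (fun a _ => phiSector_rotate_one a) i f
    simp only [h1]
    rw [← Finset.sum_range fun k => bond phiSector ((List.ofFn f).rotate k)]
    simp only [bond_phiSector, (List.rotate_perm _ _).count_eq, List.length_rotate, List.length_ofFn]
    split_ifs with h
    · exact sum_bond_phi n hn _ List.length_ofFn (by omega)
    · simp
  rw [Hper_mulVec (by omega), hs, Pi.smul_apply, smul_eq_mul]
  ring

theorem count_extreme (n : ℕ) :
    (List.replicate (n + 1) false ++ List.replicate n true).count true = n := by
  simp [List.count_replicate]

theorem phi_extreme_ne_zero (n : ℕ) :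
    phi (List.replicate (n + 1) false ++ List.replicate n true) ≠ 0 := by
  rw [phi_extreme]
  exact mul_ne_zero (pow_ne_zero _ one_sub_ω_ne_zero) (pow_ne_zero _ ω_ne_zero)

theorem ground_energy {n : ℕ} (hn : 1 ≤ n) {E₀ : ℝ}
    (hmin : ∀ (E : ℂ) (v : Cfg (2 * n + 1) → ℂ), v ≠ 0 →
      (Hper (2 * n + 1)).mulVec v = E • v → E₀ ≤ E.re) {m : ℕ} {w : Cfg (2 * n + 1) → ℂ}
    (hw : IsGround (2 * n + 1) E₀ m w) (hw0 : w ≠ 0) : E₀ = -(3 * (2 * n + 1 : ℕ) / 4) := by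
  have hN : 2 ≤ 2 * n + 1 := by omega
  have hA := shifted_posSemidef hN hmin
  apply le_antisymm
  · have h0 : phiVec (2 * n + 1) ≠ 0 := by
      obtain ⟨f, hf⟩ := exists_ofFn (N := 2 * n + 1)
        (a := List.replicate (n + 1) false ++ List.replicate n true) (by simp; omega)
      intro h
      have h1 := congrFun h f
      rw [phiVec, hf, phiSector, count_extreme, if_pos (by simp; omega)] at h1
      exact phi_extreme_ne_zero n h1
    have h1 := hmin _ _ h0 (Hper_mulVec_phiVec n hn)
    have h2 : (-(3 * (2 * n + 1 : ℕ) / 4 : ℂ)) = ((-(3 * (2 * n + 1 : ℕ) / 4) : ℝ) : ℂ) := by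
      push_cast; ring
    rwa [h2, Complex.ofReal_re] at h1
  · obtain ⟨m', rfl⟩ : ∃ m', n = m' + 1 := ⟨n - 1, by omega⟩
    have h1 := shifted_energy_re hN E₀ (absVec w)
    rw [shifted_mulVec_eq_zero.2 (ground_abs hN hA hw.1), dotProduct_zero, Complex.zero_re] at h1
    set v : List Bool → ℝ := fun a => ‖w fun i => a.getD i false‖ with hvdef
    have hv0 : ∀ f, v (List.ofFn f) = ‖w f‖ := by
      intro f
      simp only [hvdef]
      congr 2
      ext i
      rw [List.getD_eq_getElem _ _ (by rw [List.length_ofFn]; exact i.isLt), List.getElem_ofFn]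
    have hv : ∀ a : List Bool, a.length = 2 * m' + 3 → v (a.rotate 1) = v a := by
      intro a ha
      obtain ⟨f, rfl⟩ := exists_ofFn (N := 2 * (m' + 1) + 1) (a := a) (by omega)
      rw [← ofFn_comp_cyc, hv0, hv0]
      exact Complex.ofReal_injective (hw.abs_cyc hN hA hw0 f)
    have h2 : absVec w = fun f => ((v (List.ofFn f) : ℝ) : ℂ) := by
      ext f
      rw [hv0]
      rfl
    have h3 : ∀ i f, (star (absVec w f) * hop i (absVec w) f).re =
        ((v (List.ofFn f) : ℂ) * bond (fun a => (v a : ℂ)) ((List.ofFn f).rotate i)).re := by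
      intro i f
      rw [h2, hop_eq_bond hN (φ := fun a => (v a : ℂ)) (fun a ha => by rw [hv a ha])]
      simp
    have h4 : 0 ≤ ∑ f, ∑ i, (star (absVec w f) * hop i (absVec w) f).re := by
      rw [Finset.sum_comm]
      refine Finset.sum_nonneg fun i _ => ?_
      simp only [h3]
      rw [← sum_words (2 * (m' + 1) + 1) fun a =>
        ((v a : ℂ) * bond (fun a => (v a : ℂ)) (a.rotate i)).re]
      have h5 := sum_mul_bond_nonneg hv
      rw [← sum_words_rotate _ i] at h5
      refine h5.trans_eq (Finset.sum_congr rfl fun a ha => ?_)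
      rw [rotate_invariant hv i a (mem_words.1 ha)]
    have h5 : 0 < ∑ f, ‖absVec w f‖ ^ 2 := by
      obtain ⟨f, hf⟩ := Function.ne_iff.1 hw0
      refine Finset.sum_pos' (fun _ _ => sq_nonneg _) ⟨f, Finset.mem_univ f, ?_⟩
      have : 0 < ‖absVec w f‖ := by
        simpa [absVec] using hf
      positivity
    have h6 : 0 ≤ (3 * (2 * (m' + 1) + 1 : ℕ) / 4 + E₀) * ∑ f, ‖absVec w f‖ ^ 2 := by linarith
    have h7 := nonneg_of_mul_nonneg_left h6 h5
    linarith

theorem norm_sq_extreme {n : ℕ} (hn : 1 ≤ n) {E₀ : ℝ}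
    (hmin : ∀ (E : ℂ) (v : Cfg (2 * n + 1) → ℂ), v ≠ 0 →
      (Hper (2 * n + 1)).mulVec v = E • v → E₀ ≤ E.re) {w : Cfg (2 * n + 1) → ℂ}
    (hw : IsGround (2 * n + 1) E₀ n w) (hw0 : w ≠ 0) {b : Cfg (2 * n + 1)}
    (hb : List.ofFn b = List.replicate (n + 1) false ++ List.replicate n true) :
    absVec w b ^ 2 = (∑ f, absVec w f ^ 2) * invHT n := by
  have hN : 2 ≤ 2 * n + 1 := by omega
  have hA := shifted_posSemidef hN hmin
  have hE := ground_energy hn hmin hw hw0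
  have hΦ : IsGround (2 * n + 1) E₀ n (phiVec (2 * n + 1)) := by
    refine ⟨?_, fun f hf => ?_⟩
    · rw [Hper_mulVec_phiVec n hn, hE]
      push_cast
      rfl
    · rw [phiVec, phiSector, List.length_ofFn, if_neg (by omega)]
  have hbc : (List.ofFn b).count true = n := by rw [hb, count_extreme]
  have hp := fun g => (hw.abs hN hA).proportional hN hA hΦ hbc g
  have hΦb : phiVec (2 * n + 1) b = phi (List.replicate (n + 1) false ++ List.replicate n true) := by
    rw [phiVec, phiSector, List.length_ofFn, hbc, if_pos rfl, hb]
  have hsum : ∑ f, phiVec (2 * n + 1) f * phiVec (2 * n + 1) (f ∘ Fin.rev) * invHT n =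
      phiVec (2 * n + 1) b ^ 2 := by
    rw [← Finset.sum_mul, hΦb, ← normSum_one_mul_invHT, normSum_ones, sum_words]
    congr 1
    refine Finset.sum_congr rfl fun f _ => ?_
    rw [phiVec, phiVec, ofFn_comp_rev, phiSector, phiSector, List.count_reverse, List.length_reverse,
      List.length_ofFn]
    by_cases h : (List.ofFn f).count true = n
    · rw [if_pos (by omega), if_pos (by omega), if_pos h]
    · rw [if_neg (by omega), if_neg h, zero_mul]
  have hmul : phiVec (2 * n + 1) b ^ 2 * ((∑ f, absVec w f ^ 2) * invHT n) =
      phiVec (2 * n + 1) b ^ 2 * absVec w b ^ 2 := by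
    nth_rw 2 [← hsum]
    rw [Finset.sum_mul, Finset.sum_mul, Finset.mul_sum]
    refine Finset.sum_congr rfl fun f _ => ?_
    have h1 := hp f
    have h2 := hp (f ∘ Fin.rev)
    rw [hw.abs_rev hN hA hw0 f] at h2
    linear_combination -(phiVec (2 * n + 1) b * absVec w f * invHT n) * h1 -
      (absVec w b * phiVec (2 * n + 1) f * invHT n) * h2
  refine (mul_left_cancel₀ (pow_ne_zero 2 ?_) hmul).symm
  rw [hΦb]
  exact phi_extreme_ne_zero n
end

theorem pUp_mulVec (N : ℕ) (i : Fin N) (Ψ : Cfg N → ℂ) (f : Cfg N) :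
    (pUp N i).mulVec Ψ f = if f i then Ψ f else 0 := by
  have e : ∀ b, f i = b → Function.update f i b = f := by rintro b rfl; simp
  rw [pUp, Matrix.smul_mulVec, Matrix.add_mulVec, Matrix.one_mulVec, Pi.smul_apply, Pi.add_apply,
    localOp_mulVec, Fintype.sum_bool]
  cases h : f i
  · simp [sigmaZ, e _ h]
  · simp [sigmaZ, e _ h]; ring

theorem prod_pUp_mulVec (N : ℕ) (l : List (Fin N)) (Ψ : Cfg N → ℂ) (f : Cfg N) :
    ((l.map (pUp N)).prod).mulVec Ψ f = if ∀ i ∈ l, f i = true then Ψ f else 0 := by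
  induction l with
  | nil => simp
  | cons i l ih =>
    rw [List.map_cons, List.prod_cons, ← Matrix.mulVec_mulVec, pUp_mulVec, ih]
    by_cases h : f i = true <;> simp [h]

/-- The configuration with the first `k` spins up and the other spins down. -/
def firstUp (N k : ℕ) : Cfg N := fun i => decide (i.val < k)

theorem ofFn_firstUp (k l : ℕ) :
    List.ofFn (firstUp (k + l) k) = List.replicate k true ++ List.replicate l false := by
  refine List.ext_getElem (by simp) fun i h1 h2 => ?_
  simp only [List.getElem_ofFn, firstUp, List.getElem_append, List.length_replicate,
    List.getElem_replicate]
  split_ifs with h <;> simp [h]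

theorem eq_firstUp {k l : ℕ} {f : Cfg (k + l)} (hf : (List.ofFn f).count true = k)
    (h : ∀ i : Fin (k + l), i.val < k → f i = true) : f = firstUp (k + l) k := by
  have h1 : (List.ofFn (firstUp (k + l) k)).count true = k := by
    rw [ofFn_firstUp]; simp [List.count_replicate]
  rw [count_ofFn_eq_sum] at hf h1
  have h2 : ∀ i ∈ Finset.univ, (if firstUp (k + l) k i = true then 1 else 0) ≤
      if f i = true then 1 else 0 := by
    intro i _
    by_cases hi : i.val < k
    · simp [h i hi, firstUp, hi]
    · simp [firstUp, hi]
  have h3 := (Finset.sum_eq_sum_iff_of_le h2).1 (h1.trans hf.symm)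
  ext i
  have h4 := h3 i (Finset.mem_univ i)
  cases hfi : f i <;> cases hgi : firstUp (k + l) k i <;> simp_all

theorem EFP_eq_of_sector {k l : ℕ} {Ψ : Cfg (k + l) → ℂ}
    (h : ∀ f, (List.ofFn f).count true ≠ k → Ψ f = 0) :
    EFP Ψ k = absVec Ψ (firstUp (k + l) k) ^ 2 / ∑ f, absVec Ψ f ^ 2 := by
  have hsq : ∀ f, (starRingEnd ℂ) (Ψ f) * Ψ f = absVec Ψ f ^ 2 := by
    intro f
    rw [← Complex.normSq_eq_conj_mul_self, Complex.normSq_eq_norm_sq, absVec, Complex.ofReal_pow]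
  rw [EFP, hermInner, hermInner]
  simp only [hsq]
  congr 1
  rw [Finset.sum_eq_single (firstUp (k + l) k)]
  · rw [projProd, prod_pUp_mulVec, if_pos, hsq]
    intro i hi
    simpa [firstUp] using hi
  · intro f _ hf
    rw [projProd, prod_pUp_mulVec]
    split_ifs with hc
    · by_cases hk : (List.ofFn f).count true = k
      · refine absurd (eq_firstUp hk fun i hi => hc i ?_) hf
        simpa using hi
      · rw [h f hk, mul_zero]
    · rw [mul_zero]
  · intro hn
    exact absurd (Finset.mem_univ _) hn

theorem Sz_mulVec (N : ℕ) (Ψ : Cfg N → ℂ) (f : Cfg N) :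
    (Sz N).mulVec Ψ f = ((List.ofFn f).count true - N / 2 : ℂ) * Ψ f := by
  have h1 : ∀ i, (localOp N i sigmaZ).mulVec Ψ f = (2 * (if f i = true then 1 else 0) - 1) * Ψ f := by
    intro i
    have e : ∀ b, f i = b → Function.update f i b = f := by rintro b rfl; simp
    rw [localOp_mulVec, Fintype.sum_bool]
    cases h : f i
    · simp [sigmaZ, e _ h]
    · simp [sigmaZ, e _ h]; ring
  rw [Sz, Matrix.smul_mulVec, Matrix.sum_mulVec, Pi.smul_apply, Finset.sum_apply]
  simp only [h1]
  rw [← Finset.sum_mul, Finset.sum_sub_distrib, ← Finset.mul_sum, count_ofFn_eq_sum]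
  push_cast
  simp
  ring

theorem Hper_mulVec_flip {N : ℕ} (hN : 2 ≤ N) (Ψ : Cfg N → ℂ) (f : Cfg N) :
    (Hper N).mulVec (fun g => Ψ (not ∘ g)) f = (Hper N).mulVec Ψ (not ∘ f) := by
  rw [Hper_mulVec hN, Hper_mulVec hN]
  congr 1
  refine Finset.sum_congr rfl fun i _ => ?_
  simp [hop, Function.comp_assoc]

theorem count_ofFn_not {N : ℕ} (f : Cfg N) :
    (List.ofFn (not ∘ f)).count true + (List.ofFn f).count true = N := by
  rw [count_ofFn_eq_sum, count_ofFn_eq_sum, ← Finset.sum_add_distrib,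
    Finset.sum_congr rfl (g := fun _ => 1) fun i _ => by by_cases h : f i = true <;> simp [h]]
  simp

theorem absVec_iterate_cyc {N : ℕ} {w : Cfg N → ℂ}
    (h : ∀ f, absVec w (f ∘ cyc N) = absVec w f) {f g : Cfg N} (k : ℕ)
    (hfg : List.ofFn g = (List.ofFn f).rotate k) : absVec w g = absVec w f := by
  induction k generalizing g with
  | zero => rw [List.rotate_zero] at hfg; rw [List.ofFn_injective hfg]
  | succ k ih =>
    obtain ⟨g', hg'⟩ := exists_ofFn (N := N) (a := (List.ofFn f).rotate k) (by simp)
    rw [← List.rotate_rotate, ← hg', ← ofFn_comp_cyc] at hfg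
    rw [List.ofFn_injective hfg, h, ih hg']

theorem EFP_half_chain (n : ℕ) (hn : 1 ≤ n)
    (Ψm Ψp : Cfg (2*n+1) → ℂ) (hΨm : Ψm ≠ 0) (hΨp : Ψp ≠ 0) (E₀ : ℝ)
    (hgroundm : (Hper (2*n+1)).mulVec Ψm = (E₀ : ℂ) • Ψm)
    (hgroundp : (Hper (2*n+1)).mulVec Ψp = (E₀ : ℂ) • Ψp)
    (hmin : ∀ (E : ℂ) (v : Cfg (2*n+1) → ℂ), v ≠ 0 →
      (Hper (2*n+1)).mulVec v = E • v → E₀ ≤ E.re)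
    (hSzm : (Sz (2*n+1)).mulVec Ψm = (-(1/2) : ℂ) • Ψm)
    (hSzp : (Sz (2*n+1)).mulVec Ψp = ((1/2) : ℂ) • Ψp) :
    EFP Ψm n =
      (∏ j ∈ Finset.Icc 1 n,
        (((2*j-1).factorial : ℂ)^2 * ((2*j).factorial : ℂ)^2) /
          (((j-1).factorial : ℂ) * ((j).factorial : ℂ) * ((3*j-1).factorial : ℂ) *
            ((3*j).factorial : ℂ))) ∧
    EFP Ψp (n+1) =
      (∏ j ∈ Finset.Icc 1 n,
        (((2*j-1).factorial : ℂ)^2 * ((2*j).factorial : ℂ)^2) /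
          (((j-1).factorial : ℂ) * ((j).factorial : ℂ) * ((3*j-1).factorial : ℂ) *
            ((3*j).factorial : ℂ))) := by
  have hN : 2 ≤ 2 * n + 1 := by omega
  have hA := shifted_posSemidef hN hmin
  have sector : ∀ (Ψ : Cfg (2 * n + 1) → ℂ) (m : ℕ),
      (Sz (2 * n + 1)).mulVec Ψ = ((m : ℂ) - (2 * n + 1 : ℕ) / 2) • Ψ →
      ∀ f, (List.ofFn f).count true ≠ m → Ψ f = 0 := by
    intro Ψ m h f hf
    have h1 := congrFun h f
    rw [Sz_mulVec, Pi.smul_apply, smul_eq_mul] at h1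
    by_contra h0
    have h2 := mul_right_cancel₀ h0 h1
    exact hf (Nat.cast_injective (R := ℂ) (by linear_combination h2))
  have hm : IsGround (2 * n + 1) E₀ n Ψm := by
    refine ⟨hgroundm, sector Ψm n ?_⟩
    rw [hSzm]; congr 1; push_cast; ring
  have hps : ∀ f, (List.ofFn f).count true ≠ n + 1 → Ψp f = 0 := by
    refine sector Ψp (n + 1) ?_
    rw [hSzp]; congr 1; push_cast; ring
  obtain ⟨b, hb⟩ := exists_ofFn (N := 2 * n + 1)
    (a := List.replicate (n + 1) false ++ List.replicate n true) (by simp; omega)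
  have ratio : ∀ (w : Cfg (2 * n + 1) → ℂ), w ≠ 0 → ∀ x : ℂ,
      x = (∑ f, absVec w f ^ 2) * invHT n → x / ∑ f, absVec w f ^ 2 = invHT n := by
    intro w hw x hx
    have h0 : ∑ f, absVec w f ^ 2 ≠ 0 := by
      simp only [absVec]
      simp only [← Complex.ofReal_pow]
      rw [← Complex.ofReal_sum, Complex.ofReal_ne_zero]
      intro h
      refine hw (funext fun f => ?_)
      have := (Finset.sum_eq_zero_iff_of_nonneg fun f _ => sq_nonneg ‖w f‖).1 h f (Finset.mem_univ f)
      exact norm_eq_zero.1 (pow_eq_zero_iff two_ne_zero |>.1 this)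
    rw [hx, mul_div_cancel_left₀ _ h0]
  constructor
  · have e : 2 * n + 1 = n + (n + 1) := by ring
    have hval : EFP Ψm n = absVec Ψm (firstUp (2 * n + 1) n) ^ 2 / ∑ f, absVec Ψm f ^ 2 := by
      have hs := hm.2
      clear * - hs e
      revert Ψm
      rw [e]
      exact fun Ψm hs => EFP_eq_of_sector hs
    have hfu : List.ofFn (firstUp (2 * n + 1) n) = (List.ofFn b).rotate (n + 1) := by
      have h1 := List.rotate_append_length_eq (List.replicate (n + 1) false) (List.replicate n true)
      rw [List.length_replicate] at h1
      rw [hb, h1, ← ofFn_firstUp, e]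
    rw [hval, absVec_iterate_cyc (hm.abs_cyc hN hA hΨm) (n + 1) hfu]
    exact ratio Ψm hΨm _ (norm_sq_extreme hn hmin hm hΨm hb)
  · have e : 2 * n + 1 = n + 1 + n := by ring
    have hval : EFP Ψp (n + 1) =
        absVec Ψp (firstUp (2 * n + 1) (n + 1)) ^ 2 / ∑ f, absVec Ψp f ^ 2 := by
      clear * - hps e
      revert Ψp
      rw [e]
      exact fun Ψp hs => EFP_eq_of_sector hs
    have hp : IsGround (2 * n + 1) E₀ n fun f => Ψp (not ∘ f) := by
      refine ⟨?_, fun f hf => hps _ ?_⟩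
      · ext f
        rw [Hper_mulVec_flip hN, hgroundp]
        rfl
      · have := count_ofFn_not f
        omega
    have hinv : ∀ f : Cfg (2 * n + 1), not ∘ not ∘ f = f := fun f => by ext; simp
    have hp0 : (fun f => Ψp (not ∘ f)) ≠ 0 := by
      intro h
      refine hΨp (funext fun f => ?_)
      have := congrFun h (not ∘ f)
      simp only [hinv] at this
      exact this
    have hfu : firstUp (2 * n + 1) (n + 1) = not ∘ b := by
      apply List.ofFn_injective
      rw [← List.map_ofFn, hb]
      have h1 := ofFn_firstUp (n + 1) n
      rw [← e] at h1
      rw [h1]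
      simp
    have hmain := norm_sq_extreme hn hmin hp hp0 hb
    have hsum : ∑ f, absVec (fun f => Ψp (not ∘ f)) f ^ 2 = ∑ f, absVec Ψp f ^ 2 :=
      Function.Bijective.sum_comp (e := fun f : Cfg (2 * n + 1) => not ∘ f)
        (Function.Involutive.bijective hinv) fun f => absVec Ψp f ^ 2
    rw [hsum] at hmain
    rw [hval, hfu]
    exact ratio Ψp hΨp _ hmain
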